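/- Let d ≥ 2 and define λ⋆ : (0,1] → ℝ by λ⋆(α) := inf{ |Ω|^{2/d} λ₁^g(Ω) : Ω ⊆ ℝ^d open, bounded and nonempty, g ∈ L^∞_α }. Then λ⋆ is strictly increasing on (0,1], continuously differentiable on (0,1), and satisfies lim_{α→0⁺} λ⋆(α) = |B|^{2/d} λ₁(B), lim_{α→1⁻} λ⋆(α) = λ⋆(1), and λ⋆(1) = 2^{2/d} |B|^{2/d} λ₁(B), where B is the open unit ball of ℝ^d. (Here 2^{2/d}|B|^{2/d}λ₁(B) equals |B^∧ ∪ B^∨|^{2/d} λ₂(B^∧ ∪ B^∨) for any two disjoint balls of equal measure.) -/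

import Mathlib

open MeasureTheory Metric Set Filter

open scoped Classical ENNReal

noncomputable section

/-- The Rayleigh quotient of `u : ℝ^d → ℝ`. -/
def rayleigh (d : ℕ) (u : EuclideanSpace ℝ (Fin d) → ℝ) : ℝ :=
  (∫ x, ‖gradient u x‖ ^ 2) / (∫ x, (u x) ^ 2)

/-- A trial function for the Dirichlet eigenvalue on `Ω`: Lipschitz, vanishing outside `Ω`,
and not almost everywhere zero. -/
def IsDirTrial (d : ℕ) (Ω : Set (EuclideanSpace ℝ (Fin d)))
    (u : EuclideanSpace ℝ (Fin d) → ℝ) : Prop :=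
  (∃ K, LipschitzWith K u) ∧ (∀ x ∉ Ω, u x = 0) ∧ ¬ (u =ᵐ[volume] fun _ => (0 : ℝ))

/-- The first Dirichlet eigenvalue of `Ω`. -/
def dirichletEV (d : ℕ) (Ω : Set (EuclideanSpace ℝ (Fin d))) : ℝ :=
  sInf { r | ∃ u, IsDirTrial d Ω u ∧ rayleigh d u = r }

/-- The first twisted eigenvalue of `Ω` with orthogonality constraint `g`. -/
def twistedEV (d : ℕ) (Ω : Set (EuclideanSpace ℝ (Fin d)))
    (g : EuclideanSpace ℝ (Fin d) → ℝ) : ℝ :=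
  sInf { r | ∃ u, IsDirTrial d Ω u ∧ (∫ x, u x * g x) = 0 ∧ rayleigh d u = r }

/-- `u` is a minimizer for the first twisted eigenvalue `λ₁^g(Ω)`. -/
def IsTwistedMin (d : ℕ) (Ω : Set (EuclideanSpace ℝ (Fin d)))
    (g u : EuclideanSpace ℝ (Fin d) → ℝ) : Prop :=
  IsDirTrial d Ω u ∧ (∫ x, u x * g x) = 0 ∧ rayleigh d u = twistedEV d Ω g

/-- The bang-bang function equal to `1` on `Bm` and `α` elsewhere. -/
def chiBang (d : ℕ) (α : ℝ) (Bm : Set (EuclideanSpace ℝ (Fin d))) :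
    EuclideanSpace ℝ (Fin d) → ℝ :=
  fun x => if x ∈ Bm then 1 else α

open scoped Pointwise in
/-- The one-dimensional Brunn–Minkowski inequality. -/
lemma volume_add_le_volume_add_set {A B : Set ℝ} (hA : MeasurableSet A) (hB : MeasurableSet B)
    (hAn : A.Nonempty) (hBn : B.Nonempty) : volume A + volume B ≤ volume (A + B) := by
  have key : ∀ K L : Set ℝ, IsCompact K → IsCompact L → K.Nonempty → L.Nonempty →
      volume K + volume L ≤ volume (K + L) := by
    intro K L hK hL hKn hLn
    obtain ⟨a, haK, ha⟩ := hK.exists_isGreatest hKn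
    obtain ⟨b, hbL, hb⟩ := hL.exists_isLeast hLn
    have h1 : (fun x => x + b) '' K ∪ (fun x => a + x) '' L ⊆ K + L := by
      rintro x (⟨y, hy, rfl⟩ | ⟨y, hy, rfl⟩)
      · exact ⟨y, hy, b, hbL, rfl⟩
      · exact ⟨a, haK, y, hy, rfl⟩
    have h2 : volume ((fun x => x + b) '' K) = volume K := by
      simp [Set.image_add_right]
    have h3 : volume ((fun x => a + x) '' L) = volume L := by
      simp [Set.image_add_left]
    refine le_trans ?_ (measure_mono h1)
    rw [measure_union₀ ((hL.image (by fun_prop)).measurableSet.nullMeasurableSet), h2, h3]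
    have : (fun x => x + b) '' K ∩ (fun x => a + x) '' L ⊆ {a + b} := by
      rintro x ⟨⟨y, hy, rfl⟩, ⟨z, hz, hzy⟩⟩
      have := ha hy
      have := hb hz
      simp only [mem_singleton_iff] at *
      linarith
    exact measure_mono_null this (by simp)
  obtain ⟨a, ha⟩ := hAn
  obtain ⟨b, hb⟩ := hBn
  rw [hA.measure_eq_iSup_isCompact, hB.measure_eq_iSup_isCompact]
  simp only [iSup_and']
  refine ENNReal.biSup_add_biSup_le' ⟨∅, by simp⟩ ⟨∅, by simp⟩ ?_
  rintro K ⟨hKA, hK⟩ L ⟨hLB, hL⟩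
  calc volume K + volume L ≤ volume (insert a K) + volume (insert b L) := by
        gcongr <;> exact subset_insert _ _
    _ ≤ volume (insert a K + insert b L) :=
        key _ _ (hK.insert a) (hL.insert b) (insert_nonempty _ _) (insert_nonempty _ _)
    _ ≤ volume (A + B) := by
        gcongr
        · exact insert_subset ha hKA
        · exact insert_subset hb hLB

lemma lintegral_eq_lintegral_Ioo_meas_lt {α : Type*} [MeasurableSpace α] (μ : Measure α)
    {f : α → ℝ≥0∞} (hf : Measurable f) (h1 : ∀ x, f x ≤ 1) :
    ∫⁻ x, f x ∂μ = ∫⁻ t in Ioo (0 : ℝ) 1, μ {x | ENNReal.ofReal t < f x} := by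
  have h2 : ∀ x, f x = ENNReal.ofReal (f x).toReal := fun x =>
    (ENNReal.ofReal_toReal (ne_top_of_le_ne_top ENNReal.one_ne_top (h1 x))).symm
  have h4 : ∀ x, ∀ t : ℝ, 0 < t → (t < (f x).toReal ↔ ENNReal.ofReal t < f x) := by
    intro x t ht
    rw [ENNReal.ofReal_lt_iff_lt_toReal ht.le (ne_top_of_le_ne_top ENNReal.one_ne_top (h1 x))]
  rw [lintegral_congr h2, lintegral_eq_lintegral_meas_lt μ (by filter_upwards with x; positivity)
    hf.ennreal_toReal.aemeasurable]
  have h3 : Ioi (0 : ℝ) = Ioo 0 1 ∪ Ici 1 := by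
    ext x; simp only [mem_Ioi, mem_union, mem_Ioo, mem_Ici]; grind
  rw [h3, lintegral_union measurableSet_Ici]
  · have : ∫⁻ t in Ici (1 : ℝ), μ {x | t < (f x).toReal} = 0 := by
      rw [setLIntegral_congr_fun (g := fun _ => 0) measurableSet_Ici]
      · simp
      · intro t ht
        have : {x | t < (f x).toReal} = ∅ := by
          ext x
          simp only [mem_ofPred_eq, mem_empty_iff_false, iff_false, not_lt]
          exact le_trans (ENNReal.toReal_le_of_le_ofReal zero_le_one (by simpa using h1 x)) ht
        simp [this]
    rw [this, add_zero]
    refine setLIntegral_congr_fun measurableSet_Ioo fun t ht => ?_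
    simp only [h4 _ t ht.1]
  · rw [Set.disjoint_left]; intro x hx hx'; exact absurd hx.2 (not_lt.2 hx')

lemma ennreal_geom_mean_le_arith_mean {s : ℝ} (hs : s ∈ Ioo (0 : ℝ) 1) (x y : ℝ≥0∞) :
    x ^ (1 - s) * y ^ s ≤ ENNReal.ofReal (1 - s) * x + ENNReal.ofReal s * y := by
  have h1 : 0 < 1 - s := by linarith [hs.2]
  rcases eq_or_ne x ∞ with rfl | hx
  · rw [ENNReal.mul_top (by simpa using h1)]; simp
  rcases eq_or_ne y ∞ with rfl | hy
  · rw [ENNReal.mul_top (by simpa using hs.1)]; simp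
  lift x to NNReal using hx
  lift y to NNReal using hy
  have := NNReal.geom_mean_le_arith_mean2_weighted (Real.toNNReal (1 - s)) (Real.toNNReal s) x y
    (by rw [← Real.toNNReal_add h1.le hs.1.le]; simp)
  rw [Real.coe_toNNReal _ h1.le, Real.coe_toNNReal _ hs.1.le] at this
  rw [ENNReal.ofReal, ENNReal.ofReal, ← ENNReal.coe_rpow_of_nonneg _ h1.le,
    ← ENNReal.coe_rpow_of_nonneg _ hs.1.le]
  exact_mod_cast this

/-- The Prékopa–Leindler inequality as a property of a measure space. -/
def PrekopaLeindler (V : Type*) [AddCommGroup V] [Module ℝ V] [MeasureSpace V] : Prop :=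
  ∀ s ∈ Ioo (0 : ℝ) 1, ∀ f g h : V → ℝ≥0∞, Measurable f → Measurable g → Measurable h →
    (∀ x y, f x ^ (1 - s) * g y ^ s ≤ h ((1 - s) • x + s • y)) →
    (∫⁻ x, f x) ^ (1 - s) * (∫⁻ x, g x) ^ s ≤ ∫⁻ x, h x

open scoped Pointwise in
lemma lintegral_le_of_iSup_eq_one {s : ℝ} (hs : s ∈ Ioo (0 : ℝ) 1) {f g h : ℝ → ℝ≥0∞}
    (hf : Measurable f) (hg : Measurable g)
    (hh : Measurable h) (hf1 : ⨆ x, f x = 1) (hg1 : ⨆ x, g x = 1)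
    (hfgh : ∀ x y, f x ^ (1 - s) * g y ^ s ≤ h ((1 - s) • x + s • y)) :
    ENNReal.ofReal (1 - s) * (∫⁻ x, f x) + ENNReal.ofReal s * (∫⁻ x, g x) ≤ ∫⁻ x, h x := by
  have h1 : 0 < 1 - s := by linarith [hs.2]
  have hf2 : ∀ x, f x ≤ 1 := fun x => hf1 ▸ le_iSup f x
  have hg2 : ∀ x, g x ≤ 1 := fun x => hg1 ▸ le_iSup g x
  have hm : ∫⁻ x, min (h x) 1 ≤ ∫⁻ x, h x := lintegral_mono fun x => min_le_left _ _
  refine le_trans ?_ hm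
  rw [lintegral_eq_lintegral_Ioo_meas_lt volume hf hf2,
    lintegral_eq_lintegral_Ioo_meas_lt volume hg hg2,
    lintegral_eq_lintegral_Ioo_meas_lt volume (hh.min measurable_const) fun x => min_le_right _ _]
  have hanti : ∀ F : ℝ → ℝ≥0∞, Measurable fun t : ℝ => volume {x | ENNReal.ofReal t < F x} := by
    intro F
    refine Antitone.measurable fun t t' htt' => measure_mono fun x hx => ?_
    exact lt_of_le_of_lt (ENNReal.ofReal_le_ofReal htt') hx
  rw [← lintegral_const_mul _ (hanti f), ← lintegral_const_mul _ (hanti g),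
    ← lintegral_add_left ((hanti f).const_mul _)]
  refine setLIntegral_mono' measurableSet_Ioo fun t ht => ?_
  have ht1 : ENNReal.ofReal t < 1 := by simpa using ht.2
  set A := {x | ENNReal.ofReal t < f x}
  set B := {x | ENNReal.ofReal t < g x}
  have hA : MeasurableSet A := measurableSet_lt measurable_const hf
  have hB : MeasurableSet B := measurableSet_lt measurable_const hg
  have hAn : A.Nonempty := by
    rw [← hf1, lt_iSup_iff] at ht1
    exact ht1
  have hBn : B.Nonempty := by
    have ht1 : ENNReal.ofReal t < 1 := by simpa using ht.2
    rw [← hg1, lt_iSup_iff] at ht1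
    exact ht1
  have e1 : ENNReal.ofReal (1 - s) * volume A = volume ((1 - s) • A) := by
    rw [Measure.addHaar_smul]; simp [abs_of_pos h1]
  have e2 : ENNReal.ofReal s * volume B = volume (s • B) := by
    rw [Measure.addHaar_smul]; simp [abs_of_pos hs.1]
  rw [e1, e2]
  refine (volume_add_le_volume_add_set (hA.const_smul₀ _) (hB.const_smul₀ _)
    (hAn.smul_set) (hBn.smul_set)).trans (measure_mono ?_)
  rintro _ ⟨_, ⟨x, hx, rfl⟩, _, ⟨y, hy, rfl⟩, rfl⟩
  have ht0 : ENNReal.ofReal t ≠ 0 := by simpa using ht.1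
  show ENNReal.ofReal t < min _ 1
  refine lt_min (lt_of_lt_of_le ?_ (hfgh x y)) (by simpa using ht.2)
  calc ENNReal.ofReal t = ENNReal.ofReal t ^ (1 - s) * ENNReal.ofReal t ^ s := by
        rw [← ENNReal.rpow_add _ _ ht0 ENNReal.ofReal_ne_top]; simp
    _ < f x ^ (1 - s) * g y ^ s := by
        refine ENNReal.mul_lt_mul ?_ ?_
        · exact ENNReal.rpow_lt_rpow hx h1
        · exact ENNReal.rpow_lt_rpow hy hs.1

lemma prekopaLeindler_real : PrekopaLeindler ℝ := by
  intro s hs f g h hf hg hh hfgh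
  have h1 : 0 < 1 - s := by linarith [hs.2]
  have hbdd : ∀ N : ℕ, (∫⁻ x, min (f x) N) ^ (1 - s) * (∫⁻ x, min (g x) N) ^ s ≤ ∫⁻ x, h x := by
    intro N
    set F : ℝ → ℝ≥0∞ := fun x => min (f x) N
    set G : ℝ → ℝ≥0∞ := fun x => min (g x) N
    set a := ⨆ x, F x
    set b := ⨆ x, G x
    have hF : Measurable F := hf.min measurable_const
    have hG : Measurable G := hg.min measurable_const
    have haN : a ≤ N := iSup_le fun x => min_le_right _ _
    have hbN : b ≤ N := iSup_le fun x => min_le_right _ _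
    have hat : a ≠ ∞ := ne_top_of_le_ne_top (by simp) haN
    have hbt : b ≠ ∞ := ne_top_of_le_ne_top (by simp) hbN
    rcases eq_or_ne a 0 with ha | ha
    · have : F = fun _ => 0 := funext fun x => le_antisymm (ha ▸ le_iSup F x) zero_le
      rw [this]
      simp [h1]
    rcases eq_or_ne b 0 with hb | hb
    · have : G = fun _ => 0 := funext fun x => le_antisymm (hb ▸ le_iSup G x) zero_le
      rw [this]
      simp [hs.1]
    have hFG : ∀ x y, F x ^ (1 - s) * G y ^ s ≤ h ((1 - s) • x + s • y) := fun x y =>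
      le_trans (mul_le_mul' (ENNReal.rpow_le_rpow (min_le_left _ _) h1.le)
        (ENNReal.rpow_le_rpow (min_le_left _ _) hs.1.le)) (hfgh x y)
    set c := a ^ (1 - s) * b ^ s
    have hc0 : c ≠ 0 := by
      refine mul_ne_zero ?_ ?_
      · simp [ha, hat]
      · simp [hb, hbt]
    have hct : c ≠ ∞ := ENNReal.mul_ne_top (ENNReal.rpow_ne_top_of_nonneg h1.le hat)
      (ENNReal.rpow_ne_top_of_nonneg hs.1.le hbt)
    have hci : c⁻¹ = (a⁻¹) ^ (1 - s) * (b⁻¹) ^ s := by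
      rw [ENNReal.inv_rpow, ENNReal.inv_rpow, ENNReal.mul_inv]
      · left; simp [ha, hat]
      · right; simp [hb, hbt]
    have key := lintegral_le_of_iSup_eq_one hs (hF.const_mul a⁻¹) (hG.const_mul b⁻¹)
      (hh.const_mul c⁻¹) (by rw [← ENNReal.mul_iSup]; exact ENNReal.inv_mul_cancel ha hat)
      (by rw [← ENNReal.mul_iSup]; exact ENNReal.inv_mul_cancel hb hbt) (by
        intro x y
        rw [ENNReal.mul_rpow_of_nonneg _ _ h1.le, ENNReal.mul_rpow_of_nonneg _ _ hs.1.le, hci]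
        calc _ = (a⁻¹) ^ (1 - s) * (b⁻¹) ^ s * (F x ^ (1 - s) * G y ^ s) := by ring
          _ ≤ _ := by gcongr; exact hFG x y)
    have key2 := (ennreal_geom_mean_le_arith_mean hs _ _).trans key
    rw [lintegral_const_mul _ hF, lintegral_const_mul _ hG, lintegral_const_mul _ hh,
      ENNReal.mul_rpow_of_nonneg _ _ h1.le, ENNReal.mul_rpow_of_nonneg _ _ hs.1.le] at key2
    have e : (a⁻¹ ^ (1 - s) * (∫⁻ x, F x) ^ (1 - s)) * (b⁻¹ ^ s * (∫⁻ x, G x) ^ s) =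
      c⁻¹ * ((∫⁻ x, F x) ^ (1 - s) * (∫⁻ x, G x) ^ s) := by rw [hci]; ring
    rw [e] at key2
    exact (ENNReal.mul_le_mul_iff_right (ENNReal.inv_ne_zero.2 hct)
      (ENNReal.inv_ne_top.2 hc0)).1 key2
  have hlim : ∀ F : ℝ → ℝ≥0∞, Measurable F →
      Tendsto (fun N : ℕ => ∫⁻ x, min (F x) N) atTop (nhds (∫⁻ x, F x)) := by
    intro F hF
    refine lintegral_tendsto_of_tendsto_of_monotone
      (fun n => (hF.min measurable_const).aemeasurable) ?_ ?_
    · filter_upwards with x m n hmn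
      exact min_le_min_left _ (by exact_mod_cast hmn)
    · filter_upwards with x
      have := (tendsto_const_nhds (x := F x)).min ENNReal.tendsto_nat_nhds_top
      simpa using this
  by_cases hz : (∫⁻ x, f x) = 0 ∨ (∫⁻ x, g x) = 0
  · rcases hz with hz | hz
    · simp [hz, h1]
    · simp [hz, hs.1]
  push Not at hz
  refine le_of_tendsto' (ENNReal.Tendsto.mul ((hlim f hf).ennrpow_const _) (Or.inl ?_)
    ((hlim g hg).ennrpow_const _) (Or.inl ?_)) hbdd
  all_goals simp [hz.1, hz.2, hs.1.le, hs.2.le]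

lemma PrekopaLeindler.prod {V : Type*} [AddCommGroup V] [Module ℝ V] [MeasureSpace V]
    [SFinite (volume : Measure V)] (hV : PrekopaLeindler V) : PrekopaLeindler (ℝ × V) := by
  intro s hs f g h hf hg hh hfgh
  rw [Measure.volume_eq_prod, lintegral_prod _ hf.aemeasurable, lintegral_prod _ hg.aemeasurable,
    lintegral_prod _ hh.aemeasurable]
  refine prekopaLeindler_real s hs _ _ _ hf.lintegral_prod_right' hg.lintegral_prod_right'
    hh.lintegral_prod_right' fun x y => ?_
  exact hV s hs _ _ _ (by fun_prop) (by fun_prop) (by fun_prop)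
    fun x' y' => hfgh (x, x') (y, y')

lemma PrekopaLeindler.congr {V W : Type*} [AddCommGroup V] [Module ℝ V] [MeasureSpace V]
    [AddCommGroup W] [Module ℝ W] [MeasureSpace W] (hV : PrekopaLeindler V) (e : V →ₗ[ℝ] W)
    (he : MeasurePreserving e volume volume) : PrekopaLeindler W := by
  intro s hs f g h hf hg hh hfgh
  rw [← he.lintegral_comp hf, ← he.lintegral_comp hg, ← he.lintegral_comp hh]
  refine hV s hs _ _ _ (hf.comp he.measurable) (hg.comp he.measurable) (hh.comp he.measurable) ?_
  intro x y
  simpa using hfgh (e x) (e y)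

lemma prekopaLeindler_pi (n : ℕ) : PrekopaLeindler (Fin n → ℝ) := by
  induction n with
  | zero =>
    intro s hs f g h hf hg hh hfgh
    have : (volume : Measure (Fin 0 → ℝ)) = Measure.dirac default := by
      rw [volume_pi, Measure.pi_of_empty _ default]
    simp only [this, lintegral_dirac]
    have := hfgh default default
    convert this using 2
  | succ n ih =>
    have e := (volume_preserving_piFinSuccAbove (fun _ : Fin (n + 1) => ℝ) 0).symm
    refine ih.prod.congr
      { toFun := (MeasurableEquiv.piFinSuccAbove (fun _ : Fin (n + 1) => ℝ) 0).symm
        map_add' := ?_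
        map_smul' := ?_ } e
    · intro x y
      ext i
      refine Fin.cases ?_ (fun j => ?_) i <;> simp [MeasurableEquiv.piFinSuccAbove]
    · intro c x
      ext i
      refine Fin.cases ?_ (fun j => ?_) i <;> simp [MeasurableEquiv.piFinSuccAbove]

lemma prekopaLeindler_euclidean (d : ℕ) : PrekopaLeindler (EuclideanSpace ℝ (Fin d)) :=
  (prekopaLeindler_pi d).congr (WithLp.linearEquiv 2 ℝ (Fin d → ℝ)).symm.toLinearMap
    (PiLp.volume_preserving_toLp (Fin d))

open scoped Pointwise in
/-- The Brunn–Minkowski inequality for a neighbourhood of a set. -/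
lemma rpow_volume_add_ball_le {d : ℕ} (hd : 0 < d) {A S : Set (EuclideanSpace ℝ (Fin d))}
    (hA : MeasurableSet A) (hS : MeasurableSet S) {r : ℝ} (hr : 0 < r)
    (hA0 : volume A ≠ 0) (hAt : volume A ≠ ∞) (hSt : volume S ≠ ∞)
    (hsub : A + ball 0 r ⊆ S) :
    (volume A).toReal ^ (1 / (d : ℝ)) +
      (volume (ball (0 : EuclideanSpace ℝ (Fin d)) 1)).toReal ^ (1 / (d : ℝ)) * r
      ≤ (volume S).toReal ^ (1 / (d : ℝ)) := by
  have hd' : (0 : ℝ) < d := by exact_mod_cast hd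
  have : Nonempty (Fin d) := ⟨⟨0, hd⟩⟩
  set ω := (volume (ball (0 : EuclideanSpace ℝ (Fin d)) 1)).toReal with hω
  have hωpos : 0 < ω := ENNReal.toReal_pos (measure_ball_pos _ _ one_pos).ne' measure_ball_lt_top.ne
  have hApos : 0 < (volume A).toReal := ENNReal.toReal_pos hA0 hAt
  set a := (volume A).toReal ^ (1 / (d : ℝ)) with ha
  set b := ω ^ (1 / (d : ℝ)) * r with hb
  have hapos : 0 < a := by positivity
  have hbpos : 0 < b := by positivity
  set s := b / (a + b) with hs
  have hs0 : 0 < s := by positivity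
  have hs1 : 1 - s = a / (a + b) := by rw [hs]; field_simp; ring
  have hs1' : 0 < 1 - s := by rw [hs1]; positivity
  have hpow : ∀ x : ℝ, 0 ≤ x → (x ^ (1 / (d : ℝ))) ^ d = x := by
    intro x hx
    rw [← Real.rpow_natCast, ← Real.rpow_mul hx]; field_simp; simp
  have hvA : volume ((1 - s)⁻¹ • A) = ENNReal.ofReal ((a + b) ^ d) := by
    rw [Measure.addHaar_smul, ← ENNReal.ofReal_toReal hAt, ← ENNReal.ofReal_mul (abs_nonneg _)]
    congr 1
    rw [abs_of_pos (by positivity), hs1]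
    simp only [finrank_euclideanSpace, Fintype.card_fin]
    rw [← hpow _ hApos.le, ← ha, inv_div, div_pow]
    field_simp
  have hvB : volume (s⁻¹ • ball (0 : EuclideanSpace ℝ (Fin d)) r) =
      ENNReal.ofReal ((a + b) ^ d) := by
    rw [Measure.addHaar_smul, Measure.addHaar_ball _ _ hr.le,
      ← ENNReal.ofReal_toReal (measure_ball_lt_top (x := (0 : EuclideanSpace ℝ (Fin d)))
        (r := 1)).ne, ← ENNReal.ofReal_mul (by positivity), ← ENNReal.ofReal_mul (abs_nonneg _)]
    congr 1
    rw [abs_of_pos (by positivity), ← hω, hs]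
    simp only [finrank_euclideanSpace, Fintype.card_fin]
    rw [← hpow ω hωpos.le, mul_comm (r ^ d), ← mul_pow, ← hb, inv_div, div_pow]
    field_simp
  have key := prekopaLeindler_euclidean d s ⟨hs0, by linarith⟩
    (((1 - s)⁻¹ • A).indicator 1) ((s⁻¹ • ball (0 : EuclideanSpace ℝ (Fin d)) r).indicator 1)
    (S.indicator 1) (measurable_one.indicator (hA.const_smul₀ _))
    (measurable_one.indicator (measurableSet_ball.const_smul₀ _))
    (measurable_one.indicator hS) (by
      intro x y
      by_cases hx : x ∈ (1 - s)⁻¹ • A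
      swap
      · simp [hx, hs1']
      by_cases hy : y ∈ s⁻¹ • ball (0 : EuclideanSpace ℝ (Fin d)) r
      swap
      · simp [hy, hs0]
      have hmem : (1 - s) • x + s • y ∈ S := by
        refine hsub (add_mem_add ?_ ?_)
        · exact (mem_inv_smul_set_iff₀ hs1'.ne' _ _).1 hx
        · exact (mem_inv_smul_set_iff₀ hs0.ne' _ _).1 hy
      simp [hx, hy, hmem])
  rw [lintegral_indicator_one (hA.const_smul₀ _),
    lintegral_indicator_one (measurableSet_ball.const_smul₀ _), lintegral_indicator_one hS,
    hvA, hvB, ← ENNReal.rpow_add_of_nonneg _ _ hs1'.le hs0.le] at key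
  simp only [sub_add_cancel, ENNReal.rpow_one] at key
  have key2 : (a + b) ^ d ≤ (volume S).toReal := (ENNReal.ofReal_le_iff_le_toReal hSt).1 key
  calc a + b = ((a + b) ^ d) ^ (1 / (d : ℝ)) := by
        rw [← Real.rpow_natCast, ← Real.rpow_mul (by positivity)]; field_simp; simp
    _ ≤ _ := by gcongr

/-- The sup-convolution of `v` with a parabola of width `ε`. -/
def supConv {d : ℕ} (v : EuclideanSpace ℝ (Fin d) → ℝ) (ε : ℝ)
    (x : EuclideanSpace ℝ (Fin d)) : ℝ :=
  ⨆ y, (v y - ‖x - y‖ ^ 2 / (2 * ε))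

section SupConv

variable {d : ℕ} {v : EuclideanSpace ℝ (Fin d) → ℝ} {K : NNReal} {ε : ℝ}

lemma LipschitzWith.sub_le_mul_norm (hv : LipschitzWith K v) (x y : EuclideanSpace ℝ (Fin d)) :
    v y - v x ≤ K * ‖x - y‖ := by
  have h := hv.dist_le_mul y x
  rw [Real.dist_eq, dist_eq_norm, norm_sub_rev] at h
  exact (le_abs_self _).trans h

lemma supConv_term_le (hv : LipschitzWith K v) (hε : 0 < ε) (x y : EuclideanSpace ℝ (Fin d)) :
    v y - ‖x - y‖ ^ 2 / (2 * ε) ≤ v x + K ^ 2 * ε / 2 := by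
  have h1 := hv.sub_le_mul_norm x y
  have h2 : K * ‖x - y‖ ≤ ‖x - y‖ ^ 2 / (2 * ε) + K ^ 2 * ε / 2 := by
    rw [div_add_div _ _ (by positivity) (by positivity), le_div_iff₀ (by positivity)]
    nlinarith [sq_nonneg (‖x - y‖ - K * ε)]
  linarith

lemma supConv_bddAbove (hv : LipschitzWith K v) (hε : 0 < ε) (x : EuclideanSpace ℝ (Fin d)) :
    BddAbove (range fun y => v y - ‖x - y‖ ^ 2 / (2 * ε)) :=
  ⟨v x + K ^ 2 * ε / 2, by rintro _ ⟨y, rfl⟩; exact supConv_term_le hv hε x y⟩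

lemma le_supConv (hv : LipschitzWith K v) (hε : 0 < ε) (x : EuclideanSpace ℝ (Fin d)) :
    v x ≤ supConv v ε x := by
  simpa [supConv] using le_ciSup (supConv_bddAbove hv hε x) x

lemma supConv_le (hv : LipschitzWith K v) (hε : 0 < ε) (x : EuclideanSpace ℝ (Fin d)) :
    supConv v ε x ≤ v x + K ^ 2 * ε / 2 :=
  ciSup_le (supConv_term_le hv hε x)

lemma lt_supConv_iff (hv : LipschitzWith K v) (hε : 0 < ε) (x : EuclideanSpace ℝ (Fin d))
    (t : ℝ) : t < supConv v ε x ↔ ∃ y, t < v y - ‖x - y‖ ^ 2 / (2 * ε) :=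
  lt_ciSup_iff (supConv_bddAbove hv hε x)

lemma isOpen_lt_supConv (hv : LipschitzWith K v) (hε : 0 < ε) (t : ℝ) :
    IsOpen {x | t < supConv v ε x} := by
  have : {x | t < supConv v ε x} = ⋃ y, {x | t < v y - ‖x - y‖ ^ 2 / (2 * ε)} := by
    ext x; simp [lt_supConv_iff hv hε]
  rw [this]
  exact isOpen_iUnion fun y => isOpen_lt continuous_const (by fun_prop)

lemma measurable_supConv (hv : LipschitzWith K v) (hε : 0 < ε) : Measurable (supConv v ε) :=
  measurable_of_Ioi fun t => (isOpen_lt_supConv hv hε t).measurableSet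

lemma supConv_eq_zero (hv : LipschitzWith K v) (hε : 0 < ε) (hε1 : ε ≤ 1) (hv0 : ∀ x, 0 ≤ v x)
    {R : ℝ} (hR : ∀ x, R ≤ ‖x‖ → v x = 0) {x : EuclideanSpace ℝ (Fin d)}
    (hx : R + 2 * K ≤ ‖x‖) : supConv v ε x = 0 := by
  have hvx : v x = 0 := hR x (by have := K.2; simp at *; linarith)
  refine le_antisymm (ciSup_le fun y => ?_) ((hv0 x).trans (le_supConv hv hε x))
  rcases le_or_gt R ‖y‖ with hy | hy
  · rw [hR y hy]
    have : 0 ≤ ‖x - y‖ ^ 2 / (2 * ε) := by positivity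
    linarith
  · have h1 := hv.sub_le_mul_norm x y
    have h2 : 2 * (K : ℝ) ≤ ‖x - y‖ := by
      have := norm_sub_norm_le x y
      linarith
    have h3 : K * ‖x - y‖ ≤ ‖x - y‖ ^ 2 / (2 * ε) := by
      rw [le_div_iff₀ (by positivity)]
      have := norm_nonneg (x - y)
      have : (K : ℝ) * (2 * ε) ≤ ‖x - y‖ := by nlinarith [K.2, show (0 : ℝ) ≤ K from K.2]
      nlinarith
    linarith

lemma tendsto_supConv_sub_div (hv : LipschitzWith K v) {x : EuclideanSpace ℝ (Fin d)}
    (hx : DifferentiableAt ℝ v x) :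
    Tendsto (fun ε => (supConv v ε x - v x) / ε) (nhdsWithin 0 (Ioi 0))
      (nhds (‖gradient v x‖ ^ 2 / 2)) := by
  set G := gradient v x with hG
  have hgr : HasGradientAt v G x := hx.hasGradientAt
  have hlo : ∀ η > 0, ∃ δ > 0, ∀ h : EuclideanSpace ℝ (Fin d), ‖h‖ < δ →
      |v (x + h) - v x - inner ℝ G h| ≤ η * ‖h‖ := by
    intro η hη
    have := (hasGradientAt_iff_isLittleO_nhds_zero.1 hgr).def hη
    obtain ⟨δ, hδ, h⟩ := Metric.eventually_nhds_iff.1 this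
    exact ⟨δ, hδ, fun y hy => by simpa using h (by simpa using hy)⟩
  have hpos : ∀ᶠ ε : ℝ in nhdsWithin 0 (Ioi 0), 0 < ε := eventually_mem_nhdsWithin
  have hsmall : ∀ δ > 0, ∀ C : ℝ, 0 ≤ C → ∀ᶠ ε : ℝ in nhdsWithin 0 (Ioi 0), C * ε < δ := by
    intro δ hδ C _
    have : Tendsto (fun ε : ℝ => C * ε) (nhdsWithin 0 (Ioi 0)) (nhds (C * 0)) :=
      ((continuous_const.mul continuous_id).tendsto 0).mono_left nhdsWithin_le_nhds
    rw [mul_zero] at this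
    exact this.eventually_lt_const hδ
  rw [tendsto_order]
  constructor
  · intro a ha
    obtain ⟨η, hη, hηa⟩ : ∃ η > 0, a < ‖G‖ ^ 2 / 2 - η * ‖G‖ := by
      refine ⟨(‖G‖ ^ 2 / 2 - a) / (2 * (‖G‖ + 1)), by
        have := norm_nonneg G
        exact div_pos (by linarith) (by positivity), ?_⟩
      have := norm_nonneg G
      have h2 : (‖G‖ ^ 2 / 2 - a) / (2 * (‖G‖ + 1)) * ‖G‖ < ‖G‖ ^ 2 / 2 - a := by
        rw [div_mul_eq_mul_div, div_lt_iff₀ (by positivity)]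
        nlinarith
      linarith
    obtain ⟨δ, hδ, hh⟩ := hlo η hη
    filter_upwards [hpos, hsmall δ hδ ‖G‖ (norm_nonneg _)] with ε hε hε2
    have h1 := hh (ε • G) (by rw [norm_smul, Real.norm_of_nonneg hε.le]; linarith)
    rw [norm_smul, Real.norm_of_nonneg hε.le, real_inner_smul_right, real_inner_self_eq_norm_sq]
      at h1
    have h2 := le_ciSup (supConv_bddAbove hv hε x) (x + ε • G)
    have h3 : ‖x - (x + ε • G)‖ ^ 2 / (2 * ε) = ε * ‖G‖ ^ 2 / 2 := by
      rw [sub_add_cancel_left, norm_neg, norm_smul, Real.norm_of_nonneg hε.le]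
      field_simp
    simp only [h3] at h2
    change _ ≤ supConv v ε x at h2
    rw [lt_div_iff₀ hε]
    have := (abs_le.1 h1).1
    nlinarith
  · intro b hb
    obtain ⟨η, hη, hηb⟩ : ∃ η > 0, (‖G‖ + η) ^ 2 / 2 < b := by
      have hc : Tendsto (fun η : ℝ => (‖G‖ + η) ^ 2 / 2) (nhdsWithin 0 (Ioi 0))
          (nhds ((‖G‖ + 0) ^ 2 / 2)) :=
        ((by fun_prop : Continuous fun η : ℝ => (‖G‖ + η) ^ 2 / 2).tendsto 0).mono_left
          nhdsWithin_le_nhds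
      rw [add_zero] at hc
      obtain ⟨η, h1, h2⟩ := ((hc.eventually_lt_const hb).and hpos).exists
      exact ⟨η, h2, h1⟩
    obtain ⟨δ, hδ, hh⟩ := hlo η hη
    filter_upwards [hpos, hsmall δ hδ (2 * K) (by positivity)] with ε hε hε2
    refine lt_of_le_of_lt ?_ hηb
    rw [div_le_iff₀ hε, sub_le_iff_le_add]
    refine ciSup_le fun y => ?_
    rcases lt_or_ge ‖y - x‖ δ with hy | hy
    · have h1 := hh (y - x) hy
      rw [add_sub_cancel] at h1
      have h2 := (abs_le.1 h1).2
      have h3 := real_inner_le_norm G (y - x)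
      rw [norm_sub_rev x y]
      have h4 : (‖G‖ + η) * ‖y - x‖ ≤ ‖y - x‖ ^ 2 / (2 * ε) + (‖G‖ + η) ^ 2 / 2 * ε := by
        rw [← sub_nonneg]
        have : ‖y - x‖ ^ 2 / (2 * ε) + (‖G‖ + η) ^ 2 / 2 * ε - (‖G‖ + η) * ‖y - x‖
          = (‖y - x‖ - ε * (‖G‖ + η)) ^ 2 / (2 * ε) := by field_simp; ring
        rw [this]; positivity
      linarith
    · have h1 := hv.sub_le_mul_norm x y
      rw [norm_sub_rev x y] at h1 ⊢
      have h3 : K * ‖y - x‖ ≤ ‖y - x‖ ^ 2 / (2 * ε) := by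
        rw [le_div_iff₀ (by positivity)]
        have := norm_nonneg (y - x)
        nlinarith
      have h4 : 0 ≤ (‖G‖ + η) ^ 2 / 2 * ε := by positivity
      linarith

lemma integrable_of_continuous_of_eq_zero {f : EuclideanSpace ℝ (Fin d) → ℝ} (hf : Continuous f)
    {R : ℝ} (hR : ∀ x, R ≤ ‖x‖ → f x = 0) : Integrable f := by
  refine hf.integrable_of_hasCompactSupport
    (HasCompactSupport.intro (isCompact_closedBall 0 R) fun x hx => hR x ?_)
  simp only [mem_closedBall, dist_zero_right, not_le] at hx
  exact hx.le

lemma integrable_supConv (hv : LipschitzWith K v) (hε : 0 < ε) (hε1 : ε ≤ 1)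
    (hv0 : ∀ x, 0 ≤ v x) {R : ℝ} (hR : ∀ x, R ≤ ‖x‖ → v x = 0) : Integrable (supConv v ε) := by
  have h1 : Integrable (fun x => v x + (closedBall (0 : EuclideanSpace ℝ (Fin d))
      (R + 2 * K)).indicator (fun _ => (K : ℝ) ^ 2 * ε / 2) x) :=
    (integrable_of_continuous_of_eq_zero hv.continuous hR).add
      ((integrable_indicator_iff measurableSet_closedBall).2
        (integrableOn_const (measure_closedBall_lt_top.ne)))
  refine h1.mono' (measurable_supConv hv hε).aestronglyMeasurable
    (Eventually.of_forall fun x => ?_)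
  rw [Real.norm_of_nonneg ((hv0 x).trans (le_supConv hv hε x))]
  rcases le_or_gt ‖x‖ (R + 2 * K) with hx | hx
  · rw [indicator_of_mem (by simpa using hx)]
    exact supConv_le hv hε x
  · rw [indicator_of_notMem (by simpa using hx), supConv_eq_zero hv hε hε1 hv0 hR hx.le]
    simpa using hv0 x

/-- The first-order expansion of the integral of the sup-convolution. -/
lemma tendsto_integral_supConv (hv : LipschitzWith K v) (hv0 : ∀ x, 0 ≤ v x)
    {R : ℝ} (hR : ∀ x, R ≤ ‖x‖ → v x = 0) :
    Tendsto (fun ε => ((∫ x, supConv v ε x) - ∫ x, v x) / ε) (nhdsWithin 0 (Ioi 0))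
      (nhds (∫ x, ‖gradient v x‖ ^ 2 / 2)) := by
  have hev : ∀ᶠ ε : ℝ in nhdsWithin 0 (Ioi 0), 0 < ε ∧ ε ≤ 1 := by
    have : Ioc (0 : ℝ) 1 ∈ nhdsWithin 0 (Ioi 0) := Ioc_mem_nhdsGT one_pos
    exact this
  have h := tendsto_integral_filter_of_dominated_convergence (μ := volume)
    (l := nhdsWithin (0 : ℝ) (Ioi 0))
    (F := fun ε x => (supConv v ε x - v x) / ε) (f := fun x => ‖gradient v x‖ ^ 2 / 2)
    ((closedBall (0 : EuclideanSpace ℝ (Fin d)) (R + 2 * K)).indicator fun _ => (K : ℝ) ^ 2 / 2)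
    (by
      filter_upwards [hev] with ε hε
      exact (((measurable_supConv hv hε.1).sub hv.continuous.measurable).div_const
        ε).aestronglyMeasurable)
    (by
      filter_upwards [hev] with ε hε
      refine Eventually.of_forall fun x => ?_
      have h1 := le_supConv hv hε.1 x
      rw [Real.norm_of_nonneg (div_nonneg (by linarith) hε.1.le)]
      rcases le_or_gt ‖x‖ (R + 2 * K) with hx | hx
      · rw [indicator_of_mem (by simpa using hx), div_le_iff₀ hε.1]
        have := supConv_le hv hε.1 x
        linarith
      · rw [indicator_of_notMem (by simpa using hx), supConv_eq_zero hv hε.1 hε.2 hv0 hR hx.le,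
          hR x (by linarith [K.2, show (0 : ℝ) ≤ K from K.2])]
        simp)
    ((integrable_indicator_iff measurableSet_closedBall).2
        (integrableOn_const (measure_closedBall_lt_top.ne)))
    (by
      filter_upwards [hv.ae_differentiableAt] with x hx
      exact tendsto_supConv_sub_div hv hx)
  refine h.congr' ?_
  filter_upwards [hev] with ε hε
  rw [integral_div, integral_sub (integrable_supConv hv hε.1 hε.2 hv0 hR)
    (integrable_of_continuous_of_eq_zero hv.continuous hR)]

end SupConv

lemma integral_le_integral_of_meas_lt_le {α β : Type*} [MeasurableSpace α] [MeasurableSpace β]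
    {μ : Measure α} {ν : Measure β}
    {f : α → ℝ} {g : β → ℝ} (hf : ∀ x, 0 ≤ f x) (hg : ∀ x, 0 ≤ g x) (hfm : Measurable f)
    (hgi : Integrable g ν) (h : ∀ t, 0 < t → μ {x | t < f x} ≤ ν {x | t < g x}) :
    ∫ x, f x ∂μ ≤ ∫ x, g x ∂ν := by
  rw [integral_eq_lintegral_of_nonneg_ae (Eventually.of_forall hf) hfm.aestronglyMeasurable,
    integral_eq_lintegral_of_nonneg_ae (Eventually.of_forall hg) hgi.aestronglyMeasurable]
  refine ENNReal.toReal_mono ?_ ?_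
  · exact ((hasFiniteIntegral_iff_ofReal (Eventually.of_forall hg)).1 hgi.2).ne
  · rw [lintegral_eq_lintegral_meas_lt _ (Eventually.of_forall hf) hfm.aemeasurable,
      lintegral_eq_lintegral_meas_lt _ (Eventually.of_forall hg) hgi.aemeasurable]
    exact setLIntegral_mono' measurableSet_Ioi h

/-- The volume of the unit ball. -/
def ballVol (d : ℕ) : ℝ := (volume (ball (0 : EuclideanSpace ℝ (Fin d)) 1)).toReal

lemma ballVol_pos (d : ℕ) : 0 < ballVol d :=
  ENNReal.toReal_pos (measure_ball_pos _ _ one_pos).ne' measure_ball_lt_top.ne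

/-- The radius of a ball with the same volume as the superlevel set `{v > t}`. -/
def levelRadius {d : ℕ} (v : EuclideanSpace ℝ (Fin d) → ℝ) (t : ℝ) : ℝ :=
  ((volume {x | t < v x}).toReal / ballVol d) ^ (1 / (d : ℝ))

/-- The profile of the symmetric decreasing rearrangement of `v`. -/
def decProfile {d : ℕ} (v : EuclideanSpace ℝ (Fin d) → ℝ) (r : ℝ) : ℝ :=
  sSup {t | 0 ≤ t ∧ |r| < levelRadius v t}

section Rearrangement

variable {d : ℕ} {v : EuclideanSpace ℝ (Fin d) → ℝ} {K : NNReal} {R : ℝ}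

lemma volume_ball_eq (hd : 0 < d) {r : ℝ} (hr : 0 ≤ r) (a : EuclideanSpace ℝ (Fin d)) :
    volume (ball a r) = ENNReal.ofReal (r ^ d * ballVol d) := by
  have : Nonempty (Fin d) := ⟨⟨0, hd⟩⟩
  rw [Measure.addHaar_ball _ _ hr, ENNReal.ofReal_mul (by positivity), ballVol,
    ENNReal.ofReal_toReal measure_ball_lt_top.ne]
  simp

lemma volume_level_lt_top (hR : ∀ x, R ≤ ‖x‖ → v x = 0) {t : ℝ} (ht : 0 ≤ t) :
    volume {x | t < v x} < ∞ := by
  refine lt_of_le_of_lt (measure_mono fun x hx => ?_)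
    (measure_ball_lt_top (x := (0 : EuclideanSpace ℝ (Fin d))) (r := R))
  rw [mem_ball_zero_iff]
  by_contra! h
  have : t < v x := hx
  rw [hR x h] at this
  linarith

lemma levelRadius_nonneg (t : ℝ) : 0 ≤ levelRadius v t := by
  have := ballVol_pos d
  unfold levelRadius
  positivity

lemma levelRadius_pow (hd : 0 < d) (hR : ∀ x, R ≤ ‖x‖ → v x = 0) {t : ℝ} (ht : 0 ≤ t) :
    ENNReal.ofReal (levelRadius v t ^ d * ballVol d) = volume {x | t < v x} := by
  have := ballVol_pos d
  have hd' : (0 : ℝ) < d := by exact_mod_cast hd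
  rw [levelRadius, ← Real.rpow_natCast, ← Real.rpow_mul (by positivity)]
  rw [one_div_mul_cancel hd'.ne', Real.rpow_one, div_mul_cancel₀ _ this.ne',
    ENNReal.ofReal_toReal (volume_level_lt_top hR ht).ne]

lemma levelRadius_anti (hd : 0 < d) (hR : ∀ x, R ≤ ‖x‖ → v x = 0) {s t : ℝ} (hs : 0 ≤ s)
    (hst : s ≤ t) : levelRadius v t ≤ levelRadius v s := by
  have := ballVol_pos d
  unfold levelRadius
  gcongr
  exact (volume_level_lt_top hR hs).ne

lemma exists_lt_levelRadius (hd : 0 < d) (hR : ∀ x, R ≤ ‖x‖ → v x = 0) {r t : ℝ} (ht : 0 ≤ t)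
    (h : r < levelRadius v t) : ∃ s, t < s ∧ r < levelRadius v s := by
  have hω := ballVol_pos d
  have h1 : {x | t < v x} = ⋃ n : ℕ, {x | t + 1 / ((n : ℝ) + 1) < v x} := by
    ext x
    simp only [mem_ofPred_eq, mem_iUnion]
    constructor
    · intro hx
      obtain ⟨n, hn⟩ := exists_nat_one_div_lt (sub_pos.2 hx)
      exact ⟨n, by linarith⟩
    · rintro ⟨n, hn⟩
      have : 0 < 1 / ((n : ℝ) + 1) := by positivity
      linarith
  have h2 : Tendsto (fun n : ℕ => volume {x | t + 1 / ((n : ℝ) + 1) < v x}) atTop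
      (nhds (volume {x | t < v x})) := by
    rw [h1]
    refine tendsto_measure_iUnion_atTop fun m n hmn x hx => ?_
    refine lt_of_le_of_lt ?_ (show t + 1 / ((m : ℝ) + 1) < v x from hx)
    gcongr
  have h3 : Tendsto (fun n : ℕ => levelRadius v (t + 1 / ((n : ℝ) + 1))) atTop
      (nhds (levelRadius v t)) := by
    refine Tendsto.rpow_const (Tendsto.div_const ?_ _) (Or.inr (by positivity))
    exact (ENNReal.tendsto_toReal (volume_level_lt_top hR ht).ne).comp h2
  obtain ⟨n, hn⟩ := (h3.eventually_const_lt h).exists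
  exact ⟨_, by have : 0 < 1 / ((n : ℝ) + 1) := by positivity
               linarith, hn⟩

lemma exists_bound_of_lipschitz (hv : LipschitzWith K v) (hR : ∀ x, R ≤ ‖x‖ → v x = 0) :
    ∃ M, 0 ≤ M ∧ ∀ x, v x ≤ M := by
  obtain ⟨M, hM⟩ := hv.continuous.bounded_above_of_compact_support
    (HasCompactSupport.intro (isCompact_closedBall 0 R) fun x hx => hR x (by
      simp only [mem_closedBall, dist_zero_right, not_le] at hx; exact hx.le))
  exact ⟨|M|, abs_nonneg _, fun x => (le_abs_self _).trans ((hM x).trans (le_abs_self _))⟩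

lemma levelRadius_eq_zero (hd : 0 < d) {M : ℝ} (hM : ∀ x, v x ≤ M) {t : ℝ} (ht : M ≤ t) :
    levelRadius v t = 0 := by
  have : {x | t < v x} = ∅ := by
    ext x; simp only [mem_ofPred_eq, mem_empty_iff_false, iff_false, not_lt]
    exact (hM x).trans ht
  have hd' : (d : ℝ) ≠ 0 := by exact_mod_cast hd.ne'
  rw [levelRadius, this]
  simp [hd']

lemma lt_decProfile_iff (hd : 0 < d) (hv : LipschitzWith K v) (hR : ∀ x, R ≤ ‖x‖ → v x = 0)
    {r t : ℝ} (ht : 0 ≤ t) : t < decProfile v r ↔ |r| < levelRadius v t := by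
  obtain ⟨M, -, hM⟩ := exists_bound_of_lipschitz hv hR
  constructor
  · intro h
    have hne : {t | 0 ≤ t ∧ |r| < levelRadius v t}.Nonempty := by
      by_contra hne
      rw [not_nonempty_iff_eq_empty] at hne
      rw [decProfile, hne, Real.sSup_empty] at h
      linarith
    obtain ⟨s, hs, hts⟩ := exists_lt_of_lt_csSup hne h
    exact hs.2.trans_le (levelRadius_anti hd hR ht hts.le)
  · intro h
    obtain ⟨s, hts, hs⟩ := exists_lt_levelRadius hd hR ht h
    refine hts.trans_le (le_csSup ⟨M, fun u hu => ?_⟩ ⟨by linarith, hs⟩)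
    by_contra! hMu
    have := hu.2
    rw [levelRadius_eq_zero hd hM hMu.le] at this
    exact absurd this (not_lt.2 (abs_nonneg _))

lemma decProfile_nonneg (r : ℝ) : 0 ≤ decProfile v r := Real.sSup_nonneg fun _ h => h.1

lemma decProfile_eq_zero (hd : 0 < d) (hv : LipschitzWith K v) (hR : ∀ x, R ≤ ‖x‖ → v x = 0)
    {r : ℝ} (hr : levelRadius v 0 ≤ r) : decProfile v r = 0 := by
  refine le_antisymm (not_lt.1 fun h => ?_) (decProfile_nonneg r)
  rw [lt_decProfile_iff hd hv hR le_rfl] at h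
  exact absurd (h.trans_le hr) (not_lt.2 (le_abs_self r))

lemma decProfile_antitoneOn (hd : 0 < d) (hv : LipschitzWith K v)
    (hR : ∀ x, R ≤ ‖x‖ → v x = 0) : AntitoneOn (decProfile v) (Ici 0) := by
  intro r hr s hs hrs
  refine le_of_forall_lt fun t ht => ?_
  rcases lt_or_ge t 0 with h | h
  · exact h.trans_le (decProfile_nonneg r)
  · rw [lt_decProfile_iff hd hv hR h] at ht ⊢
    rw [abs_of_nonneg hr]
    rw [abs_of_nonneg hs] at ht
    exact hrs.trans_lt ht

open scoped Pointwise in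
lemma levelRadius_add_le (hd : 0 < d) (hR : ∀ x, R ≤ ‖x‖ → v x = 0)
    (hvm : Measurable v) {t : ℝ} (ht : 0 ≤ t) (hpos : 0 < levelRadius v t)
    {δ : ℝ} (hδ : 0 < δ) {S : Set (EuclideanSpace ℝ (Fin d))} (hS : MeasurableSet S)
    (hSt : volume S ≠ ∞) (hsub : {x | t < v x} + ball 0 δ ⊆ S) :
    levelRadius v t + δ ≤ ((volume S).toReal / ballVol d) ^ (1 / (d : ℝ)) := by
  have hω := ballVol_pos d
  have hd' : (d : ℝ) ≠ 0 := by exact_mod_cast hd.ne'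
  have h0 : volume {x | t < v x} ≠ 0 := by
    intro h
    rw [levelRadius, h] at hpos
    simp [hd'] at hpos
  have := rpow_volume_add_ball_le hd (measurableSet_lt measurable_const hvm) hS hδ h0
    (volume_level_lt_top hR ht).ne hSt hsub
  rw [levelRadius, Real.div_rpow (by positivity) hω.le, Real.div_rpow (by positivity) hω.le,
    le_div_iff₀ (by positivity), add_mul, div_mul_cancel₀ _ (by positivity)]
  rw [mul_comm] at this
  unfold ballVol
  linarith

open scoped Pointwise in
lemma decProfile_lipschitz (hd : 0 < d) (hv : LipschitzWith K v)
    (hR : ∀ x, R ≤ ‖x‖ → v x = 0) : LipschitzWith K (decProfile v) := by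
  refine LipschitzWith.of_le_add_mul K fun r s => ?_
  rcases eq_or_ne r s with rfl | hrs
  · simp
  have hδ : 0 < dist r s := dist_pos.2 hrs
  set δ := dist r s with hδd
  by_contra! h
  obtain ⟨t, ht1, ht2⟩ := exists_between h
  have hs0 : 0 ≤ decProfile v s := decProfile_nonneg s
  have hK : (0 : ℝ) ≤ K := K.2
  have ht : 0 ≤ t - K * δ := by linarith
  have ht' : 0 ≤ t := by nlinarith
  rw [lt_decProfile_iff hd hv hR ht'] at ht2
  have h3 : levelRadius v t + δ ≤ levelRadius v (t - K * δ) := by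
    refine levelRadius_add_le hd hR hv.continuous.measurable ht'
      (lt_of_le_of_lt (abs_nonneg r) ht2) hδ
      (measurableSet_lt measurable_const hv.continuous.measurable)
      (volume_level_lt_top hR ht).ne ?_
    rintro _ ⟨x, hx, h, hh, rfl⟩
    have h4 := hv.sub_le_mul_norm (x + h) x
    rw [add_sub_cancel_left] at h4
    have hx' : t < v x := hx
    rw [mem_ball_zero_iff] at hh
    show t - K * δ < v (x + h)
    nlinarith
  have h5 : t - K * δ < decProfile v s := by
    rw [lt_decProfile_iff hd hv hR ht]
    have : |s| ≤ |r| + δ := by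
      rw [hδd, dist_comm, Real.dist_eq]
      have := abs_sub_abs_le_abs_sub s r
      linarith
    linarith
  linarith

lemma lipschitz_comp_norm {W : ℝ → ℝ} (hW : LipschitzWith K W) :
    LipschitzWith K fun x : EuclideanSpace ℝ (Fin d) => W ‖x‖ := by
  have := hW.comp (lipschitzWith_one_norm (E := EuclideanSpace ℝ (Fin d)))
  rwa [mul_one] at this

lemma volume_decProfile_level (hd : 0 < d) (hv : LipschitzWith K v)
    (hR : ∀ x, R ≤ ‖x‖ → v x = 0) {t : ℝ} (ht : 0 ≤ t) :
    volume {x : EuclideanSpace ℝ (Fin d) | t < decProfile v ‖x‖} = volume {x | t < v x} := by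
  have : {x : EuclideanSpace ℝ (Fin d) | t < decProfile v ‖x‖} = ball 0 (levelRadius v t) := by
    ext x
    rw [mem_ofPred_eq, lt_decProfile_iff hd hv hR ht, mem_ball_zero_iff, abs_norm]
  rw [this, volume_ball_eq hd (levelRadius_nonneg t), levelRadius_pow hd hR ht]

open scoped Pointwise in
lemma volume_supConv_decProfile_le (hd : 0 < d) (hv : LipschitzWith K v) (hv0 : ∀ x, 0 ≤ v x)
    (hR : ∀ x, R ≤ ‖x‖ → v x = 0) {ε : ℝ} (hε : 0 < ε) (hε1 : ε ≤ 1) {t : ℝ} (ht : 0 < t) :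
    volume {x : EuclideanSpace ℝ (Fin d) | t < supConv (fun x => decProfile v ‖x‖) ε x}
      ≤ volume {x | t < supConv v ε x} := by
  have hω := ballVol_pos d
  set S := {x | t < supConv v ε x} with hS
  have hSm : MeasurableSet S := (isOpen_lt_supConv hv hε t).measurableSet
  have hSt : volume S ≠ ∞ := by
    refine ((measure_mono fun x hx => ?_).trans_lt (measure_ball_lt_top
      (x := (0 : EuclideanSpace ℝ (Fin d))) (r := R + 2 * K))).ne
    rw [mem_ball_zero_iff]
    by_contra! h
    have hx' : t < supConv v ε x := hx
    rw [supConv_eq_zero hv hε hε1 hv0 hR h] at hx'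
    linarith
  set ρ := ((volume S).toReal / ballVol d) ^ (1 / (d : ℝ)) with hρ
  have hρ0 : 0 ≤ ρ := by positivity
  have hρS : volume (ball (0 : EuclideanSpace ℝ (Fin d)) ρ) = volume S := by
    have hd' : (d : ℝ) ≠ 0 := by exact_mod_cast hd.ne'
    rw [volume_ball_eq hd hρ0, hρ, ← Real.rpow_natCast, ← Real.rpow_mul (by positivity),
      one_div_mul_cancel hd', Real.rpow_one, div_mul_cancel₀ _ hω.ne', ENNReal.ofReal_toReal hSt]
  rw [← hρS]
  refine measure_mono fun x hx => ?_
  rw [mem_ofPred_eq, lt_supConv_iff (lipschitz_comp_norm (decProfile_lipschitz hd hv hR)) hε] at hx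
  obtain ⟨y, hy⟩ := hx
  rw [lt_sub_iff_add_lt] at hy
  have hs0 : 0 ≤ ‖x - y‖ ^ 2 / (2 * ε) := by positivity
  obtain ⟨u, hu1, hu2⟩ := exists_between hy
  have hu0 : 0 ≤ u := by linarith
  rw [lt_decProfile_iff hd hv hR hu0, abs_norm] at hu2
  have hsu : ‖x - y‖ ^ 2 < 2 * ε * (u - t) := by
    have : ‖x - y‖ ^ 2 / (2 * ε) < u - t := by linarith
    rw [div_lt_iff₀ (by positivity)] at this
    linarith
  have hut : 0 < 2 * ε * (u - t) := lt_of_le_of_lt (by positivity) hsu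
  have hxy : ‖x - y‖ < √(2 * ε * (u - t)) := Real.lt_sqrt_of_sq_lt hsu
  have h3 : levelRadius v u + √(2 * ε * (u - t)) ≤ ρ := by
    refine levelRadius_add_le hd hR hv.continuous.measurable hu0
      (lt_of_le_of_lt (norm_nonneg y) hu2) (Real.sqrt_pos.2 hut) hSm hSt ?_
    rintro _ ⟨z, hz, h, hh, rfl⟩
    rw [hS, mem_ofPred_eq, lt_supConv_iff hv hε]
    refine ⟨z, ?_⟩
    rw [mem_ball_zero_iff] at hh
    have hz' : u < v z := hz
    have h5 : ‖h‖ ^ 2 < 2 * ε * (u - t) := by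
      rw [← Real.sq_sqrt hut.le]
      gcongr
    have h6 : ‖h‖ ^ 2 / (2 * ε) < u - t := by
      rw [div_lt_iff₀ (by positivity)]; linarith
    simp only [add_sub_cancel_left]
    linarith
  rw [mem_ball_zero_iff]
  have := norm_le_norm_add_norm_sub' x y
  linarith

/-- The rearrangement inequality for a Lipschitz function with bounded support. -/
theorem rearrangement (hd : 0 < d) (hv : LipschitzWith K v) (hv0 : ∀ x, 0 ≤ v x)
    (hR : ∀ x, R ≤ ‖x‖ → v x = 0) :
    (∫ x : EuclideanSpace ℝ (Fin d), decProfile v ‖x‖) = ∫ x, v x ∧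
    (∫ x : EuclideanSpace ℝ (Fin d), decProfile v ‖x‖ ^ 2) = ∫ x, v x ^ 2 ∧
    (∫ x, ‖gradient (fun x : EuclideanSpace ℝ (Fin d) => decProfile v ‖x‖) x‖ ^ 2) ≤
      ∫ x, ‖gradient v x‖ ^ 2 := by
  set w : EuclideanSpace ℝ (Fin d) → ℝ := fun x => decProfile v ‖x‖ with hw
  have hwL : LipschitzWith K w := lipschitz_comp_norm (decProfile_lipschitz hd hv hR)
  have hw0 : ∀ x, 0 ≤ w x := fun x => decProfile_nonneg _
  have hwR : ∀ x, levelRadius v 0 ≤ ‖x‖ → w x = 0 := fun x hx =>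
    decProfile_eq_zero hd hv hR hx
  have hlev : ∀ t, 0 < t → volume {x | t < w x} = volume {x | t < v x} := fun t ht =>
    volume_decProfile_level hd hv hR ht.le
  have hvi := integrable_of_continuous_of_eq_zero hv.continuous hR
  have hwi := integrable_of_continuous_of_eq_zero hwL.continuous hwR
  have hvi2 := integrable_of_continuous_of_eq_zero (f := fun x => v x ^ 2)
    (hv.continuous.pow 2) (R := R) (fun x hx => by simp [hR x hx])
  have hwi2 := integrable_of_continuous_of_eq_zero (f := fun x => w x ^ 2)
    (hwL.continuous.pow 2) (R := levelRadius v 0) (fun x hx => by simp [hwR x hx])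
  have hlev2 : ∀ t, 0 < t → volume {x | t < w x ^ 2} = volume {x | t < v x ^ 2} := by
    intro t ht
    have : ∀ f : EuclideanSpace ℝ (Fin d) → ℝ, (∀ x, 0 ≤ f x) →
        {x | t < f x ^ 2} = {x | √t < f x} := by
      intro f hf
      ext x
      rw [mem_ofPred_eq, mem_ofPred_eq, ← Real.sqrt_lt_sqrt_iff ht.le, Real.sqrt_sq (hf x)]
    rw [this w hw0, this v hv0, hlev _ (Real.sqrt_pos.2 ht)]
  have e1 : ∫ x, w x = ∫ x, v x := le_antisymm
    (integral_le_integral_of_meas_lt_le hw0 hv0 hwL.continuous.measurable hvi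
      fun t ht => (hlev t ht).le)
    (integral_le_integral_of_meas_lt_le hv0 hw0 hv.continuous.measurable hwi
      fun t ht => (hlev t ht).ge)
  refine ⟨e1, ?_, ?_⟩
  · exact le_antisymm
      (integral_le_integral_of_meas_lt_le (fun x => sq_nonneg _) (fun x => sq_nonneg _)
        (hwL.continuous.pow 2).measurable hvi2 fun t ht => (hlev2 t ht).le)
      (integral_le_integral_of_meas_lt_le (fun x => sq_nonneg _) (fun x => sq_nonneg _)
        (hv.continuous.pow 2).measurable hwi2 fun t ht => (hlev2 t ht).ge)
  · have h1 := tendsto_integral_supConv hv hv0 hR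
    have h2 := tendsto_integral_supConv hwL hw0 hwR
    have h3 : ∫ x, ‖gradient w x‖ ^ 2 / 2 ≤ ∫ x, ‖gradient v x‖ ^ 2 / 2 := by
      refine le_of_tendsto_of_tendsto h2 h1 ?_
      filter_upwards [Ioc_mem_nhdsGT (one_pos : (0 : ℝ) < 1)] with ε hε
      rw [e1]
      have : ∫ x, supConv w ε x ≤ ∫ x, supConv v ε x :=
        integral_le_integral_of_meas_lt_le
          (fun x => (hw0 x).trans (le_supConv hwL hε.1 x))
          (fun x => (hv0 x).trans (le_supConv hv hε.1 x))
          (measurable_supConv hwL hε.1) (integrable_supConv hv hε.1 hε.2 hv0 hR)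
          fun t ht => volume_supConv_decProfile_le hd hv hv0 hR hε.1 hε.2 ht
      have := hε.1
      gcongr
    rw [integral_div, integral_div] at h3
    linarith

end Rearrangement

section Bessel

/-- An entire function given by a power series with factorially decaying coefficients is
differentiable term by term. -/
lemma hasDerivAt_tsum_pow {a : ℕ → ℝ} (ha : ∀ n, |a n| ≤ 1 / n.factorial) (y : ℝ) :
    HasDerivAt (fun y => ∑' n, a n * y ^ n) (∑' n, ((n + 1 : ℕ) * a (n + 1)) * y ^ n) y := by
  set R : ℝ := |y| + 1
  have hR : 0 < R := by positivity
  have hs1 : Summable fun n : ℕ => (n : ℝ) * (1 / n.factorial) * R ^ (n - 1) := by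
    rw [← summable_nat_add_iff 1]
    refine (Real.summable_pow_div_factorial R).congr fun n => ?_
    rw [Nat.factorial_succ, add_tsub_cancel_right]
    push_cast
    field_simp
  have hd := hasDerivAt_tsum_of_isPreconnected (u := fun n : ℕ => (n : ℝ) * (1 / n.factorial) *
    R ^ (n - 1)) (g := fun n y => a n * y ^ n) (g' := fun n y => a n * (n * y ^ (n - 1)))
    (t := ball 0 R) (y₀ := 0) (y := y) hs1 isOpen_ball (convex_ball _ _).isPreconnected
    (fun n y _ => (hasDerivAt_pow n y).const_mul _) ?_ (mem_ball_self hR) ?_ ?_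
  · refine hd.congr_deriv ?_
    have hs2 : Summable fun n : ℕ => a n * (n * y ^ (n - 1)) := by
      refine Summable.of_norm_bounded hs1 fun n => ?_
      rw [norm_mul, norm_mul, norm_pow, Real.norm_eq_abs, Real.norm_eq_abs, Real.norm_eq_abs,
        Nat.abs_cast]
      have : |y| ≤ R := by simp [R]
      calc _ ≤ 1 / (n.factorial : ℝ) * (n * R ^ (n - 1)) := by gcongr; exact ha n
        _ = _ := by ring
    rw [hs2.tsum_eq_zero_add]
    simp only [Nat.cast_zero, zero_mul, mul_zero, zero_add, add_tsub_cancel_right]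
    exact tsum_congr fun n => by ring
  · intro n z hz
    rw [mem_ball_zero_iff, Real.norm_eq_abs] at hz
    rw [norm_mul, norm_mul, norm_pow, Real.norm_eq_abs, Real.norm_eq_abs, Real.norm_eq_abs,
        Nat.abs_cast]
    calc _ ≤ 1 / (n.factorial : ℝ) * (n * R ^ (n - 1)) := by gcongr; exact ha n
        _ = _ := by ring
  · refine (summable_nat_add_iff 1).1 ?_
    simp
  · simp [R]

lemma summable_coeff_pow {a : ℕ → ℝ} (ha : ∀ n, |a n| ≤ 1 / n.factorial) (y : ℝ) :
    Summable fun n => a n * y ^ n := by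
  refine Summable.of_norm_bounded (Real.summable_pow_div_factorial |y|) fun n => ?_
  rw [norm_mul, norm_pow, Real.norm_eq_abs, Real.norm_eq_abs]
  calc _ ≤ 1 / (n.factorial : ℝ) * |y| ^ n := by gcongr; exact ha n
        _ = _ := by ring

lemma coeff_succ_bound {a : ℕ → ℝ} (ha : ∀ n, |a n| ≤ 1 / n.factorial) (n : ℕ) :
    |((n + 1 : ℕ) : ℝ) * a (n + 1)| ≤ 1 / n.factorial := by
  rw [abs_mul, Nat.abs_cast]
  calc _ ≤ ((n + 1 : ℕ) : ℝ) * (1 / (n + 1).factorial) := by gcongr; exact ha _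
    _ = _ := by
      rw [Nat.factorial_succ]
      push_cast
      field_simp

/-- Coefficients of the radial solution of the Helmholtz equation, as a series in `r ^ 2`. -/
def helmholtzCoeff (d : ℕ) : ℕ → ℝ
  | 0 => 1
  | n + 1 => -helmholtzCoeff d n / (4 * (n + 1) * (n + d / 2))

lemma helmholtzCoeff_bound {d : ℕ} (hd : 2 ≤ d) (n : ℕ) :
    |helmholtzCoeff d n| ≤ 1 / n.factorial := by
  induction n with
  | zero => simp [helmholtzCoeff]
  | succ n ih =>
    have hd' : (2 : ℝ) ≤ d := by exact_mod_cast hd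
    have hn : (0 : ℝ) ≤ n := n.cast_nonneg
    have h1 : (1 : ℝ) ≤ 4 * (n + d / 2) := by linarith
    rw [helmholtzCoeff, abs_div, abs_neg, abs_of_pos (a := 4 * ((n : ℝ) + 1) * _) (by positivity),
      Nat.factorial_succ]
    push_cast
    rw [div_le_div_iff₀ (by positivity) (by positivity)]
    rw [le_div_iff₀ (by positivity)] at ih
    nlinarith [abs_nonneg (helmholtzCoeff d n)]

/-- Existence of the radial solution of the Helmholtz equation, in first order form. -/
lemma exists_helmholtz {d : ℕ} (hd : 2 ≤ d) : ∃ φ h h' : ℝ → ℝ, φ 0 = 1 ∧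
    (∀ r, HasDerivAt φ (-(r * h r)) r) ∧ (∀ r, HasDerivAt h (h' r) r) ∧
    ∀ r, r * h' r + d * h r = φ r := by
  have hd' : (2 : ℝ) ≤ d := by exact_mod_cast hd
  have b0 := helmholtzCoeff_bound hd
  have b1 := coeff_succ_bound b0
  have b2 := coeff_succ_bound (a := fun n => ((n + 1 : ℕ) : ℝ) * helmholtzCoeff d (n + 1)) b1
  set a := helmholtzCoeff d
  set F0 := fun y : ℝ => ∑' n, a n * y ^ n with hF0
  set F1 := fun y : ℝ => ∑' n, ((n + 1 : ℕ) * a (n + 1)) * y ^ n with hF1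
  set F2 := fun y : ℝ => ∑' n, ((n + 1 : ℕ) * (((n + 1 + 1 : ℕ) : ℝ) * a (n + 1 + 1))) * y ^ n
    with hF2
  have d0 : ∀ y, HasDerivAt F0 (F1 y) y := hasDerivAt_tsum_pow b0
  have d1 : ∀ y, HasDerivAt F1 (F2 y) y :=
    hasDerivAt_tsum_pow (a := fun n => ((n + 1 : ℕ) : ℝ) * a (n + 1)) b1
  have sq : ∀ r : ℝ, HasDerivAt (fun r : ℝ => r ^ 2) (2 * r) r := fun r => by
    simpa using hasDerivAt_pow 2 r
  refine ⟨fun r => F0 (r ^ 2), fun r => -2 * F1 (r ^ 2), fun r => -4 * r * F2 (r ^ 2), ?_, ?_, ?_,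
    ?_⟩
  · simp only [hF0]
    rw [(summable_coeff_pow b0 _).tsum_eq_zero_add]
    simp [a, helmholtzCoeff]
  · intro r
    have := (d0 (r ^ 2)).comp r (sq r)
    refine this.congr_deriv ?_
    ring
  · intro r
    have := ((d1 (r ^ 2)).comp r (sq r)).const_mul (-2)
    refine this.congr_deriv ?_
    ring
  · intro r
    have ode : ∀ y, 4 * (y * F2 y) + 2 * d * F1 y + F0 y = 0 := by
      intro y
      have e2 : y * F2 y = ∑' n : ℕ, (n * (((n + 1 : ℕ) : ℝ) * a (n + 1))) * y ^ n := by
        rw [Summable.tsum_eq_zero_add]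
        · simp only [hF2, ← tsum_mul_left]
          simp only [Nat.cast_zero, zero_mul, zero_add]
          exact tsum_congr fun n => by ring
        · refine (summable_nat_add_iff 1).1 ?_
          refine ((summable_coeff_pow b2 y).mul_left y).congr fun n => ?_
          ring
      have s2 : Summable fun n : ℕ => (n * (((n + 1 : ℕ) : ℝ) * a (n + 1))) * y ^ n := by
        refine (summable_nat_add_iff 1).1 ?_
        refine ((summable_coeff_pow b2 y).mul_left y).congr fun n => ?_
        ring
      have s1 := summable_coeff_pow b1 y
      have s0 := summable_coeff_pow b0 y
      rw [e2]
      simp only [hF1, hF0]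
      rw [← tsum_mul_left, ← tsum_mul_left, ← (s2.mul_left 4).tsum_add (s1.mul_left _),
        ← ((s2.mul_left 4).add (s1.mul_left _)).tsum_add s0]
      refine (tsum_congr fun n => ?_).trans tsum_zero
      have : a (n + 1) * (4 * (n + 1) * (n + d / 2)) = -a n := by
        have hpos : (0 : ℝ) < 4 * (n + 1) * (n + d / 2) := by positivity
        rw [show a (n + 1) = -a n / (4 * (n + 1) * (n + d / 2)) from rfl,
          div_mul_cancel₀ _ hpos.ne']
      push_cast
      linear_combination y ^ n * this
    have := ode (r ^ 2)
    linear_combination -this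

end Bessel

section Helmholtz

/-- `φ` is the normalized radial solution of the Helmholtz equation in dimension `d`, whose
derivative is `-r h`. -/
structure IsHelmholtz (d : ℕ) (φ h h' : ℝ → ℝ) : Prop where
  two_le : 2 ≤ d
  phi_zero : φ 0 = 1
  hasDerivAt_phi : ∀ r, HasDerivAt φ (-(r * h r)) r
  hasDerivAt_h : ∀ r, HasDerivAt h (h' r) r
  ode : ∀ r, r * h' r + d * h r = φ r

/-- The function `d h - φ`. -/
def helmE (d : ℕ) (φ h : ℝ → ℝ) (r : ℝ) : ℝ := d * h r - φ r

namespace IsHelmholtz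

variable {d : ℕ} {φ h h' : ℝ → ℝ} (H : IsHelmholtz d φ h h')

include H

lemma d_pos : (0 : ℝ) < d := by
  have := H.two_le
  exact_mod_cast (by omega : 0 < d)

lemma two_le_cast : (2 : ℝ) ≤ d := by exact_mod_cast H.two_le

lemma continuous_phi : Continuous φ :=
  continuous_iff_continuousAt.2 fun r => (H.hasDerivAt_phi r).continuousAt

lemma continuous_h : Continuous h :=
  continuous_iff_continuousAt.2 fun r => (H.hasDerivAt_h r).continuousAt

lemma continuous_helmE : Continuous (helmE d φ h) :=
  (continuous_const.mul H.continuous_h).sub H.continuous_phi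

lemma h_zero : h 0 = 1 / d := by
  have := H.ode 0
  rw [H.phi_zero] at this
  have hd := H.d_pos
  field_simp
  linarith

lemma helmE_eq (r : ℝ) : helmE d φ h r = -(r * h' r) := by
  rw [helmE, ← H.ode r]
  ring

lemma hasDerivAt_helmE (r : ℝ) : HasDerivAt (helmE d φ h) (d * h' r + r * h r) r := by
  refine (((H.hasDerivAt_h r).const_mul (d : ℝ)).sub (H.hasDerivAt_phi r)).congr_deriv ?_
  ring

lemma pow_pred_mul (r : ℝ) : r ^ (d - 1) * r = r ^ d := by
  rw [← pow_succ, Nat.sub_add_cancel (by have := H.two_le; omega)]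

lemma hasDerivAt_flux (r : ℝ) :
    HasDerivAt (fun r => r ^ d * h r) (r ^ (d - 1) * φ r) r := by
  refine ((hasDerivAt_pow d r).mul (H.hasDerivAt_h r)).congr_deriv ?_
  rw [← H.ode r, ← H.pow_pred_mul r]
  ring

lemma hasDerivAt_pow_mul_helmE (r : ℝ) :
    HasDerivAt (fun r => r ^ d * helmE d φ h r) (r ^ (d + 1) * h r) r := by
  refine ((hasDerivAt_pow d r).mul (H.hasDerivAt_helmE r)).congr_deriv ?_
  rw [H.helmE_eq, pow_succ, ← H.pow_pred_mul r]
  ring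

lemma helmE_pos {k : ℝ} (hk : ∀ s, 0 < s → s < k → 0 < h s) {r : ℝ} (hr : 0 < r) (hrk : r ≤ k) :
    0 < helmE d φ h r := by
  have hmono : StrictMonoOn (fun r => r ^ d * helmE d φ h r) (Icc 0 k) := by
    refine strictMonoOn_of_deriv_pos (convex_Icc 0 k)
      ((continuous_pow d).mul H.continuous_helmE).continuousOn fun s hs => ?_
    rw [interior_Icc] at hs
    rw [(H.hasDerivAt_pow_mul_helmE s).deriv]
    have := hs.1
    have := hk s hs.1 hs.2
    positivity
  have h1 := hmono (left_mem_Icc.2 (hr.le.trans hrk)) ⟨hr.le, hrk⟩ hr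
  have hd : d ≠ 0 := by have := H.two_le; omega
  simp only [ne_eq, hd, not_false_eq_true, zero_pow, zero_mul] at h1
  exact pos_of_mul_pos_right h1 (by positivity)

/-- The Riccati equation for the logarithmic derivative of `h`. -/
lemma hasDerivAt_riccati {r : ℝ} (hr : r ≠ 0) (hh : h r ≠ 0) :
    HasDerivAt (fun r => helmE d φ h r / (r * h r))
      (1 - (d + 1) * (helmE d φ h r / (r * h r)) / r + (helmE d φ h r / (r * h r)) ^ 2) r := by
  have h1 := (H.hasDerivAt_helmE r).div ((hasDerivAt_id r).mul (H.hasDerivAt_h r))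
    (mul_ne_zero hr hh)
  refine h1.congr_deriv ?_
  have h2 : h' r = -helmE d φ h r / r := by
    rw [H.helmE_eq]
    field_simp
  simp only [id, Pi.mul_apply, h2]
  field_simp
  ring

/-- `h` has a first positive zero. -/
lemma exists_first_zero : ∃ k, 0 < k ∧ h k = 0 ∧ ∀ s, 0 ≤ s → s < k → 0 < h s := by
  have hd := H.d_pos
  have h0 : 0 < h 0 := by rw [H.h_zero]; positivity
  have key : ∃ r, 0 ≤ r ∧ h r = 0 := by
    by_contra! hne
    have hpos : ∀ r, 0 ≤ r → 0 < h r := by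
      intro r hr
      by_contra! hle
      obtain ⟨s, hs, hs0⟩ := intermediate_value_Icc' hr H.continuous_h.continuousOn
        (show (0 : ℝ) ∈ Icc (h r) (h 0) from ⟨hle, h0.le⟩)
      exact hne s hs.1 hs0
    set u := fun r => helmE d φ h r / (r * h r) with hu
    have hder : ∀ r, 0 < r → HasDerivAt (fun r => Real.arctan (u r) - r / 2)
        (1 / (1 + u r ^ 2) * (1 - (d + 1) * u r / r + u r ^ 2) - 1 / 2) r := fun r hr =>
      ((H.hasDerivAt_riccati hr.ne' (hpos r hr.le).ne').arctan).sub ((hasDerivAt_id r).div_const 2)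
    have hmono : MonotoneOn (fun r => Real.arctan (u r) - r / 2) (Ici ((d : ℝ) + 1)) := by
      refine monotoneOn_of_deriv_nonneg (convex_Ici _) ?_ ?_ ?_
      · intro r hr
        have : 0 < r := lt_of_lt_of_le (by positivity) (mem_Ici.1 hr)
        exact (hder r this).continuousAt.continuousWithinAt
      · intro r hr
        rw [interior_Ici] at hr
        have : 0 < r := lt_trans (by positivity) (mem_Ioi.1 hr)
        exact (hder r this).differentiableAt.differentiableWithinAt
      · intro r hr
        rw [interior_Ici, mem_Ioi] at hr
        have hr0 : 0 < r := lt_trans (by positivity) hr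
        rw [(hder r hr0).deriv]
        have hu0 : 0 < u r := by
          have := hpos r hr0.le
          have := H.helmE_pos (k := r) (fun s hs _ => hpos s hs.le) hr0 le_rfl
          simp only [hu]
          positivity
        have h1 : (d + 1) * u r / r ≤ u r := by
          rw [div_le_iff₀ hr0]
          nlinarith
        rw [sub_nonneg, one_div_mul_eq_div, div_le_div_iff₀ (by positivity) (by positivity)]
        nlinarith [sq_nonneg (u r - 1)]
    have h1 := hmono (a := (d : ℝ) + 1) (b := d + 1 + 2 * Real.pi) (by simp)
      (by simp [Real.pi_nonneg]) (by simp [Real.pi_nonneg])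
    have h2 := Real.neg_pi_div_two_lt_arctan (u (d + 1))
    have h3 := Real.arctan_lt_pi_div_two (u (d + 1 + 2 * Real.pi))
    simp only at h1
    linarith
  have hcl : IsClosed {r | 0 ≤ r ∧ h r = 0} :=
    isClosed_Ici.inter (isClosed_singleton.preimage H.continuous_h)
  have hbdd : BddBelow {r | 0 ≤ r ∧ h r = 0} := ⟨0, fun r hr => hr.1⟩
  obtain ⟨hk0, hk⟩ := hcl.csInf_mem key hbdd
  set k := sInf {r | 0 ≤ r ∧ h r = 0} with hkdef
  refine ⟨k, lt_of_le_of_ne hk0 fun h => ?_, hk, fun s hs hsk => ?_⟩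
  · rw [← h] at hk
    linarith
  · by_contra! hle
    obtain ⟨t, ht, ht0⟩ := intermediate_value_Icc' hs H.continuous_h.continuousOn
      (show (0 : ℝ) ∈ Icc (h s) (h 0) from ⟨hle, h0.le⟩)
    have := csInf_le hbdd ⟨ht.1, ht0⟩
    linarith [ht.2]

end IsHelmholtz

/-- `k` is the first positive zero of `h`. -/
structure IsFirstZero (h : ℝ → ℝ) (k : ℝ) : Prop where
  pos : 0 < k
  eq_zero : h k = 0
  h_pos : ∀ s, 0 ≤ s → s < k → 0 < h s

namespace IsHelmholtz

variable {d : ℕ} {φ h h' : ℝ → ℝ} (H : IsHelmholtz d φ h h') {k : ℝ} (hk : IsFirstZero h k)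

include H hk

lemma helmE_pos' {r : ℝ} (hr : 0 < r) (hrk : r ≤ k) : 0 < helmE d φ h r :=
  H.helmE_pos (fun s hs => hk.h_pos s hs.le) hr hrk

lemma phi_strictAntiOn : StrictAntiOn φ (Icc 0 k) := by
  refine strictAntiOn_of_deriv_neg (convex_Icc 0 k) H.continuous_phi.continuousOn fun s hs => ?_
  rw [interior_Icc] at hs
  rw [(H.hasDerivAt_phi s).deriv]
  have := hs.1
  have := hk.h_pos s hs.1.le hs.2
  simp only [Left.neg_neg_iff]
  positivity

lemma exists_zero_phi : ∃ j, 0 < j ∧ j < k ∧ φ j = 0 := by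
  have hd : d ≠ 0 := by have := H.two_le; omega
  obtain ⟨j, hj, hj0⟩ := exists_hasDerivAt_eq_zero hk.pos
    (f := fun r => r ^ d * h r) (f' := fun r => r ^ (d - 1) * φ r)
    ((continuous_pow d).mul H.continuous_h).continuousOn (by simp [hd, hk.eq_zero])
    fun r _ => H.hasDerivAt_flux r
  refine ⟨j, hj.1, hj.2, ?_⟩
  have := hj.1
  exact (mul_eq_zero.1 hj0).resolve_left (by positivity)

lemma h_le {r : ℝ} (hr : 0 ≤ r) (hrk : r ≤ k) : h r ≤ 1 / d := by
  rw [← H.h_zero]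
  have : AntitoneOn h (Icc 0 k) := by
    refine antitoneOn_of_deriv_nonpos (convex_Icc 0 k) H.continuous_h.continuousOn
      (fun s _ => (H.hasDerivAt_h s).differentiableAt.differentiableWithinAt) fun s hs => ?_
    rw [interior_Icc] at hs
    rw [(H.hasDerivAt_h s).deriv]
    have h1 := H.helmE_pos' hk hs.1 hs.2.le
    rw [H.helmE_eq] at h1
    nlinarith [hs.1]
  exact this (left_mem_Icc.2 hk.pos.le) ⟨hr, hrk⟩ hr

lemma one_sub_le_phi {r : ℝ} (hr : 0 ≤ r) (hrk : r ≤ k) : 1 - r ^ 2 / (2 * d) ≤ φ r := by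
  have hd := H.d_pos
  have : MonotoneOn (fun r => φ r + r ^ 2 / (2 * d)) (Icc 0 k) := by
    have hder : ∀ s, HasDerivAt (fun r => φ r + r ^ 2 / (2 * d)) (-(s * h s) + s / d) s := by
      intro s
      refine ((H.hasDerivAt_phi s).add ((hasDerivAt_pow 2 s).div_const (2 * d))).congr_deriv ?_
      push_cast
      field_simp
    refine monotoneOn_of_deriv_nonneg (convex_Icc 0 k)
      (fun s _ => (hder s).continuousAt.continuousWithinAt)
      (fun s _ => (hder s).differentiableAt.differentiableWithinAt) fun s hs => ?_
    rw [interior_Icc] at hs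
    rw [(hder s).deriv]
    have h1 := H.h_le hk hs.1.le hs.2.le
    have h2 : s * h s ≤ s * (1 / d) := mul_le_mul_of_nonneg_left h1 hs.1.le
    rw [mul_one_div] at h2
    linarith
  have h1 := this (left_mem_Icc.2 hk.pos.le) ⟨hr, hrk⟩ hr
  simp only [H.phi_zero] at h1
  norm_num at h1
  linarith

lemma phi_k_neg : φ k < 0 := by
  obtain ⟨j, hj, hjk, hj0⟩ := H.exists_zero_phi hk
  rw [← hj0]
  exact H.phi_strictAntiOn hk ⟨hj.le, hjk.le⟩ (right_mem_Icc.2 hk.pos.le) hjk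

lemma riccati_le {r : ℝ} (hr : 0 < r) (hrk : r < k) (hφ : 0 ≤ φ r) :
    helmE d φ h r / (r * h r) ≤ r / 2 := by
  have hh := hk.h_pos r hr.le hrk
  have hd : d ≠ 0 := by have := H.two_le; omega
  have hder : ∀ s, HasDerivAt (fun s => s ^ 2 / 2 * (s ^ d * h s) - s ^ d * helmE d φ h s)
      (s ^ 2 / 2 * (s ^ (d - 1) * φ s)) s := by
    intro s
    refine ((((hasDerivAt_pow 2 s).div_const 2).mul (H.hasDerivAt_flux s)).sub
      (H.hasDerivAt_pow_mul_helmE s)).congr_deriv ?_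
    push_cast
    ring
  have : MonotoneOn (fun s => s ^ 2 / 2 * (s ^ d * h s) - s ^ d * helmE d φ h s) (Icc 0 r) := by
    refine monotoneOn_of_deriv_nonneg (convex_Icc 0 r)
      (fun s _ => (hder s).continuousAt.continuousWithinAt)
      (fun s _ => (hder s).differentiableAt.differentiableWithinAt) fun s hs => ?_
    rw [interior_Icc] at hs
    rw [(hder s).deriv]
    have h1 : φ r ≤ φ s := (H.phi_strictAntiOn hk).antitoneOn ⟨hs.1.le, (hs.2.trans hrk).le⟩
      ⟨hr.le, hrk.le⟩ hs.2.le
    have := hs.1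
    have : 0 ≤ φ s := hφ.trans h1
    positivity
  have h1 := this (left_mem_Icc.2 hr.le) (right_mem_Icc.2 hr.le) hr.le
  simp only [ne_eq, hd, not_false_eq_true, zero_pow, zero_mul, mul_zero, sub_zero] at h1
  have h2 : 0 ≤ r ^ d * (r ^ 2 / 2 * h r - helmE d φ h r) := by linarith
  have h3 := nonneg_of_mul_nonneg_right h2 (by positivity)
  rw [div_le_iff₀ (by positivity)]
  linarith

/-- The function whose square is minus the reciprocal of the slope of the energy constant. -/
lemma strictMonoOn_slope :
    StrictMonoOn (fun r => r ^ d * (helmE d φ h r / (r * h r))) (Ioo 0 k) := by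
  have hder : ∀ s ∈ Ioo 0 k, HasDerivAt (fun r => r ^ d * (helmE d φ h r / (r * h r)))
      (s ^ d * (1 - (helmE d φ h s / (s * h s)) / s + (helmE d φ h s / (s * h s)) ^ 2)) s := by
    intro s hs
    have hs0 := hs.1
    refine ((hasDerivAt_pow d s).mul (H.hasDerivAt_riccati hs0.ne'
      (hk.h_pos s hs0.le hs.2).ne')).congr_deriv ?_
    rw [← H.pow_pred_mul s]
    field_simp
    ring
  refine strictMonoOn_of_deriv_pos (convex_Ioo 0 k)
    (fun s hs => (hder s hs).continuousAt.continuousWithinAt) fun s hs => ?_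
  rw [interior_Ioo] at hs
  rw [(hder s hs).deriv]
  have hs0 := hs.1
  have hh := hk.h_pos s hs0.le hs.2
  have hE := H.helmE_pos' hk hs0 hs.2.le
  refine mul_pos (by positivity) ?_
  rcases le_or_gt 0 (φ s) with hφ | hφ
  · have h1 := H.riccati_le hk hs0 hs.2 hφ
    have h2 : helmE d φ h s / (s * h s) / s ≤ 1 / 2 := by
      rw [div_le_iff₀ hs0]
      linarith
    nlinarith [sq_nonneg (helmE d φ h s / (s * h s))]
  · have h1 := H.one_sub_le_phi hk hs0.le hs.2.le
    have hs1 : 1 ≤ s := by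
      by_contra! hlt
      have : s ^ 2 / (2 * d) < 1 := by
        rw [div_lt_one (by have := H.d_pos; positivity)]
        nlinarith [H.two_le_cast]
      linarith
    set u := helmE d φ h s / (s * h s)
    have hu : 0 < u := by positivity
    have h2 : u / s ≤ u := div_le_self hu.le hs1
    nlinarith [sq_nonneg (u - 1), sq_nonneg (u - 1 / 2)]

end IsHelmholtz

end Helmholtz

/-- Abstract properties of an energy constant `C`, with slope `-1 / m` on `(0, pN)`, vanishing at
`p1`, and constant after `pN`. -/
structure IsEnergyConst (C m : ℝ → ℝ) (pN p1 : ℝ) : Prop where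
  p1_pos : 0 < p1
  p1_lt : p1 < pN
  C_p1 : C p1 = 0
  hasDerivAt_C : ∀ p, 0 < p → p < pN → HasDerivAt C (-1 / m p) p
  m_pos : ∀ p, 0 < p → p < pN → 0 < m p
  m_strictMono : StrictMonoOn m (Ioo 0 pN)
  m_cont : ContinuousOn m (Ioo 0 pN)
  m_surj : ∀ μ, 0 < μ → ∃ p, 0 < p ∧ p < pN ∧ m p = μ
  C_const : ∀ p, pN ≤ p → C p = C pN
  C_cont : ContinuousOn C (Ioi 0)

section Helmholtz

/-- The energy constant as a function of the radius. -/
def radConst (d : ℕ) (φ h : ℝ → ℝ) (k r : ℝ) : ℝ :=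
  φ (min r k) / (min r k ^ d * helmE d φ h (min r k))

/-- The energy constant as a function of the normalized volume. -/
def volConst (d : ℕ) (φ h : ℝ → ℝ) (k p : ℝ) : ℝ := radConst d φ h k (p ^ (1 / (d : ℝ)))

/-- Minus the reciprocal of the slope of `volConst`. -/
def volSlope (d : ℕ) (φ h : ℝ → ℝ) (p : ℝ) : ℝ :=
  ((p ^ (1 / (d : ℝ))) ^ d * (helmE d φ h (p ^ (1 / (d : ℝ))) /
    (p ^ (1 / (d : ℝ)) * h (p ^ (1 / (d : ℝ)))))) ^ 2

lemma radConst_eq_of_le {d : ℕ} {φ h : ℝ → ℝ} {k r : ℝ} (hr : r ≤ k) :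
    radConst d φ h k r = φ r / (r ^ d * helmE d φ h r) := by rw [radConst, min_eq_left hr]

lemma rpow_one_div_pow {d : ℕ} (hd : d ≠ 0) {p : ℝ} (hp : 0 ≤ p) : (p ^ (1 / (d : ℝ))) ^ d = p := by
  rw [one_div]
  exact Real.rpow_inv_natCast_pow hp hd

lemma pow_rpow_one_div {d : ℕ} (hd : d ≠ 0) {p : ℝ} (hp : 0 ≤ p) : (p ^ d) ^ (1 / (d : ℝ)) = p := by
  rw [one_div]
  exact Real.pow_rpow_inv_natCast hp hd

lemma rpow_one_div_lt {d : ℕ} (hd : d ≠ 0) {p k : ℝ} (hp : 0 ≤ p) (hk : 0 ≤ k) :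
    p ^ (1 / (d : ℝ)) < k ↔ p < k ^ d := by
  rw [← pow_lt_pow_iff_left₀ (by positivity) hk hd, rpow_one_div_pow hd hp]

namespace IsHelmholtz

variable {d : ℕ} {φ h h' : ℝ → ℝ} (H : IsHelmholtz d φ h h') {k : ℝ} (hk : IsFirstZero h k)

include H

lemma hasDerivAt_ratio {r : ℝ} (hr : 0 < r) (he : 0 < helmE d φ h r) :
    HasDerivAt (fun r => φ r / (r ^ d * helmE d φ h r))
      (-(d * r ^ (d + 1) * h r ^ 2 / (r ^ d * helmE d φ h r) ^ 2)) r := by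
  refine ((H.hasDerivAt_phi r).div (H.hasDerivAt_pow_mul_helmE r)
    (by positivity)).congr_deriv ?_
  rw [← neg_div]
  congr 1
  have : φ r = d * h r - helmE d φ h r := by rw [helmE]; ring
  rw [this]
  ring

lemma d_ne_zero : d ≠ 0 := by have := H.two_le; omega

include hk

lemma radConst_eq_of_ge {r : ℝ} (hr : k ≤ r) : radConst d φ h k r = -1 / k ^ d := by
  have h1 := H.phi_k_neg hk
  have h2 := hk.pos
  rw [radConst, min_eq_right hr, helmE, hk.eq_zero, mul_zero, zero_sub]
  field_simp
  rw [div_self h1.ne]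

lemma continuousOn_radConst : ContinuousOn (radConst d φ h k) (Ioi 0) := by
  have hmin : Continuous fun r : ℝ => min r k := continuous_id.min continuous_const
  refine ContinuousOn.div (H.continuous_phi.comp hmin).continuousOn
    ((hmin.pow d).mul (H.continuous_helmE.comp hmin)).continuousOn fun r hr => ?_
  have h1 := lt_min (mem_Ioi.1 hr) hk.pos
  have h2 := H.helmE_pos' hk h1 (min_le_right r k)
  positivity

lemma isEnergyConst : ∃ p1, IsEnergyConst (volConst d φ h k) (volSlope d φ h) (k ^ d) p1 ∧
    ∃ j, 0 < j ∧ j < k ∧ φ j = 0 ∧ p1 = j ^ d := by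
  obtain ⟨j, hj, hjk, hj0⟩ := H.exists_zero_phi hk
  have hd := H.d_pos
  have hd0 := H.d_ne_zero
  have hk0 := hk.pos
  have root_pos : ∀ p : ℝ, 0 < p → 0 < p ^ (1 / (d : ℝ)) := fun p hp => by positivity
  have root_lt : ∀ p : ℝ, 0 < p → p < k ^ d → p ^ (1 / (d : ℝ)) < k := fun p hp hpk =>
    (rpow_one_div_lt hd0 hp.le hk0.le).2 hpk
  have root_cont : Continuous fun p : ℝ => p ^ (1 / (d : ℝ)) :=
    Real.continuous_rpow_const (by positivity)
  have slope_pos : ∀ r, 0 < r → r < k → 0 < r ^ d * (helmE d φ h r / (r * h r)) := by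
    intro r hr hrk
    have := hk.h_pos r hr.le hrk
    have := H.helmE_pos' hk hr hrk.le
    positivity
  refine ⟨j ^ d, ⟨by positivity, by gcongr, ?_, ?_, ?_, ?_, ?_, ?_, ?_, ?_⟩, j, hj, hjk, hj0, rfl⟩
  · rw [volConst, pow_rpow_one_div hd0 hj.le, radConst_eq_of_le hjk.le, hj0, zero_div]
  · intro p hp hpk
    have hr := root_pos p hp
    have hrk := root_lt p hp hpk
    have hh := hk.h_pos _ hr.le hrk
    have he := H.helmE_pos' hk hr hrk.le
    have h1 := (H.hasDerivAt_ratio hr he).comp p (Real.hasDerivAt_rpow_const (p := 1 / (d : ℝ))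
      (Or.inl hp.ne'))
    have h2 : volConst d φ h k =ᶠ[nhds p]
        (fun r => φ r / (r ^ d * helmE d φ h r)) ∘ fun p : ℝ => p ^ (1 / (d : ℝ)) := by
      filter_upwards [Ioo_mem_nhds hp hpk] with q hq
      exact radConst_eq_of_le (root_lt q hq.1 hq.2).le
    refine (h1.congr_of_eventuallyEq h2).congr_deriv ?_
    rw [volSlope, Real.rpow_sub_one hp.ne']
    set r := p ^ (1 / (d : ℝ))
    have hpr : p = r ^ d := (rpow_one_div_pow hd0 hp.le).symm
    rw [hpr]
    field_simp
    try ring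
  · intro p hp hpk
    have := slope_pos _ (root_pos p hp) (root_lt p hp hpk)
    exact pow_pos this 2
  · intro p hp q hq hpq
    have h1 := slope_pos _ (root_pos p hp.1) (root_lt p hp.1 hp.2)
    refine pow_lt_pow_left₀ (H.strictMonoOn_slope hk ⟨root_pos p hp.1, root_lt p hp.1 hp.2⟩
      ⟨root_pos q hq.1, root_lt q hq.1 hq.2⟩ ?_) h1.le two_ne_zero
    exact Real.rpow_lt_rpow hp.1.le hpq (by positivity)
  · refine ContinuousOn.pow ((root_cont.pow d).continuousOn.mul (ContinuousOn.div
      (H.continuous_helmE.comp root_cont).continuousOn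
      (root_cont.mul (H.continuous_h.comp root_cont)).continuousOn fun p hp => ?_)) 2
    have h1 := root_pos p hp.1
    have h2 := hk.h_pos _ h1.le (root_lt p hp.1 hp.2)
    exact (mul_pos h1 h2).ne'
  · intro μ hμ
    have hc : Continuous fun r => r ^ (d - 1) * helmE d φ h r - √μ * h r :=
      ((continuous_pow _).mul H.continuous_helmE).sub (continuous_const.mul H.continuous_h)
    have hsμ := Real.sqrt_pos.2 hμ
    have hlo : (0 : ℝ) ^ (d - 1) * helmE d φ h 0 - √μ * h 0 < 0 := by
      rw [zero_pow (by have := H.two_le; omega), H.h_zero, zero_mul, zero_sub, neg_lt_zero]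
      positivity
    have hhi : 0 < k ^ (d - 1) * helmE d φ h k - √μ * h k := by
      have := H.helmE_pos' hk hk0 le_rfl
      rw [hk.eq_zero, mul_zero, sub_zero]
      positivity
    obtain ⟨r, hr, hr0⟩ := intermediate_value_Ioo hk0.le hc.continuousOn
      (show (0 : ℝ) ∈ Ioo _ _ from ⟨hlo, hhi⟩)
    have hr1 := hr.1
    have hh := hk.h_pos r hr1.le hr.2
    refine ⟨r ^ d, by positivity, by have := hr.2; gcongr, ?_⟩
    rw [volSlope, pow_rpow_one_div hd0 hr1.le]
    have h1 : r ^ d * (helmE d φ h r / (r * h r)) = √μ := by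
      rw [← H.pow_pred_mul r]
      field_simp
      simp only at hr0
      linarith
    rw [h1, Real.sq_sqrt hμ.le]
  · intro p hp
    have hp0 : 0 ≤ p := le_trans (by positivity) hp
    rw [volConst, volConst, pow_rpow_one_div hd0 hk0.le, H.radConst_eq_of_ge hk le_rfl,
      H.radConst_eq_of_ge hk]
    by_contra! hlt
    rw [rpow_one_div_lt hd0 hp0 hk0.le] at hlt
    linarith
  · exact (H.continuousOn_radConst hk).comp root_cont.continuousOn fun p hp => root_pos p hp

end IsHelmholtz

end Helmholtz

section Duality

/-- The inverse of the slope function `m`, with values in `(0, pN)`. -/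
def dualArg (m : ℝ → ℝ) (pN μ : ℝ) : ℝ :=
  if h : ∃ p, 0 < p ∧ p < pN ∧ m p = μ then h.choose else 0

/-- The dual function `min_p (p + μ C p)`. -/
def dualFun (C m : ℝ → ℝ) (pN μ : ℝ) : ℝ := dualArg m pN μ + μ * C (dualArg m pN μ)

/-- The derivative of the dual problem in the multiplier. -/
def dualDeriv (C m : ℝ → ℝ) (pN β μ : ℝ) : ℝ :=
  C (dualArg m pN μ) + β * C (dualArg m pN (β * μ))

/-- The Lagrange multiplier of the problem of minimizing `p + q` with `C p + β C q ≤ 0`. -/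
def dualMult (C m : ℝ → ℝ) (pN β : ℝ) : ℝ :=
  if h : ∃ μ, 0 < μ ∧ dualDeriv C m pN β μ = 0 then h.choose else 0

/-- The minimum of `p + q` with `C p + β C q ≤ 0`. -/
def minVol (C m : ℝ → ℝ) (pN β : ℝ) : ℝ :=
  dualArg m pN (dualMult C m pN β) + dualArg m pN (β * dualMult C m pN β)

namespace IsEnergyConst

variable {C m : ℝ → ℝ} {pN p1 : ℝ} (S : IsEnergyConst C m pN p1)

include S

lemma dualArg_spec {μ : ℝ} (hμ : 0 < μ) :
    0 < dualArg m pN μ ∧ dualArg m pN μ < pN ∧ m (dualArg m pN μ) = μ := by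
  rw [dualArg, dif_pos (S.m_surj μ hμ)]
  exact (S.m_surj μ hμ).choose_spec

lemma dualArg_m {p : ℝ} (hp : 0 < p) (hpN : p < pN) : dualArg m pN (m p) = p := by
  obtain ⟨h1, h2, h3⟩ := S.dualArg_spec (S.m_pos p hp hpN)
  exact S.m_strictMono.injOn ⟨h1, h2⟩ ⟨hp, hpN⟩ h3

lemma dualArg_strictMonoOn : StrictMonoOn (dualArg m pN) (Ioi 0) := by
  intro a ha b hb hab
  obtain ⟨h1, h2, h3⟩ := S.dualArg_spec ha
  obtain ⟨h4, h5, h6⟩ := S.dualArg_spec hb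
  rw [← S.m_strictMono.lt_iff_lt ⟨h1, h2⟩ ⟨h4, h5⟩, h3, h6]
  exact hab

lemma continuousAt_dualArg {μ : ℝ} (hμ : 0 < μ) : ContinuousAt (dualArg m pN) μ := by
  refine continuousAt_of_monotoneOn_of_image_mem_nhds S.dualArg_strictMonoOn.monotoneOn
    (Ioi_mem_nhds hμ) ?_
  obtain ⟨h1, h2, h3⟩ := S.dualArg_spec hμ
  filter_upwards [Ioo_mem_nhds h1 h2] with p hp
  exact ⟨m p, S.m_pos p hp.1 hp.2, S.dualArg_m hp.1 hp.2⟩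

lemma pN_pos : 0 < pN := S.p1_pos.trans S.p1_lt

lemma C_strictAntiOn : StrictAntiOn C (Ioc 0 pN) := by
  refine strictAntiOn_of_deriv_neg (convex_Ioc 0 pN) (S.C_cont.mono fun p hp => hp.1) fun p hp => ?_
  rw [interior_Ioc] at hp
  rw [(S.hasDerivAt_C p hp.1 hp.2).deriv]
  exact div_neg_of_neg_of_pos (by norm_num) (S.m_pos p hp.1 hp.2)

lemma C_pos {p : ℝ} (hp : 0 < p) (h : p < p1) : 0 < C p := by
  rw [← S.C_p1]
  exact S.C_strictAntiOn ⟨hp, h.le.trans S.p1_lt.le⟩ ⟨S.p1_pos, S.p1_lt.le⟩ h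

lemma C_neg {p : ℝ} (h : p1 < p) : C p < 0 := by
  rw [← S.C_p1]
  rcases le_total p pN with hp | hp
  · exact S.C_strictAntiOn ⟨S.p1_pos, S.p1_lt.le⟩ ⟨S.p1_pos.trans h, hp⟩ h
  · rw [S.C_const p hp]
    exact S.C_strictAntiOn ⟨S.p1_pos, S.p1_lt.le⟩ ⟨S.pN_pos, le_rfl⟩ S.p1_lt

/-- The tangent line inequality. -/
lemma tangent_le {p₀ p : ℝ} (h0 : 0 < p₀) (h0N : p₀ < pN) (hp : 0 < p) :
    p₀ + m p₀ * C p₀ ≤ p + m p₀ * C p := by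
  have hm := S.m_pos p₀ h0 h0N
  have hder : ∀ p, 0 < p → p < pN → HasDerivAt (fun p => p + m p₀ * C p)
      (1 + m p₀ * (-1 / m p)) p := fun p hp hpN =>
    (hasDerivAt_id p).add ((S.hasDerivAt_C p hp hpN).const_mul _)
  have hcont : ContinuousOn (fun p => p + m p₀ * C p) (Ioi 0) :=
    continuousOn_id.add (continuousOn_const.mul S.C_cont)
  have hval : ∀ p, 0 < p → p < pN → 1 + m p₀ * (-1 / m p) = (m p - m p₀) / m p := by
    intro p hp hpN
    have := S.m_pos p hp hpN
    field_simp
    ring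
  have hright : ∀ p, p₀ ≤ p → p ≤ pN → p₀ + m p₀ * C p₀ ≤ p + m p₀ * C p := by
    intro p hp0 hpN
    have hmono : MonotoneOn (fun p => p + m p₀ * C p) (Icc p₀ pN) := by
      refine monotoneOn_of_deriv_nonneg (convex_Icc _ _)
        (hcont.mono fun q hq => h0.trans_le hq.1) (fun q hq => ?_) fun q hq => ?_
      · rw [interior_Icc] at hq
        exact (hder q (h0.trans hq.1) hq.2).differentiableAt.differentiableWithinAt
      · rw [interior_Icc] at hq
        rw [(hder q (h0.trans hq.1) hq.2).deriv, hval q (h0.trans hq.1) hq.2]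
        have := S.m_strictMono ⟨h0, h0N⟩ ⟨h0.trans hq.1, hq.2⟩ hq.1
        exact div_nonneg (by linarith) (by linarith)
    exact hmono ⟨le_rfl, h0N.le⟩ ⟨hp0, hpN⟩ hp0
  rcases le_total p₀ p with h | h
  · rcases le_total p pN with h' | h'
    · exact hright p h h'
    · rw [S.C_const p h']
      exact (hright pN h0N.le le_rfl).trans (by linarith)
  · have hmono : AntitoneOn (fun p => p + m p₀ * C p) (Ioc 0 p₀) := by
      refine antitoneOn_of_deriv_nonpos (convex_Ioc _ _)
        (hcont.mono fun q hq => hq.1) (fun q hq => ?_) fun q hq => ?_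
      · rw [interior_Ioc] at hq
        exact (hder q hq.1 (hq.2.trans h0N)).differentiableAt.differentiableWithinAt
      · rw [interior_Ioc] at hq
        rw [(hder q hq.1 (hq.2.trans h0N)).deriv, hval q hq.1 (hq.2.trans h0N)]
        have := S.m_strictMono ⟨hq.1, hq.2.trans h0N⟩ ⟨h0, h0N⟩ hq.2
        have := S.m_pos q hq.1 (hq.2.trans h0N)
        exact div_nonpos_of_nonpos_of_nonneg (by linarith) (by linarith)
    exact hmono ⟨hp, h⟩ ⟨h0, le_rfl⟩ h

lemma dualFun_le {μ p : ℝ} (hμ : 0 < μ) (hp : 0 < p) : dualFun C m pN μ ≤ p + μ * C p := by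
  obtain ⟨h1, h2, h3⟩ := S.dualArg_spec hμ
  have := S.tangent_le h1 h2 hp
  rwa [h3] at this

lemma dualFun_sub_le {a b : ℝ} (ha : 0 < a) (hb : 0 < b) :
    dualFun C m pN a - dualFun C m pN b ≤ (a - b) * C (dualArg m pN b) := by
  have := S.dualFun_le ha (S.dualArg_spec hb).1
  rw [dualFun] at this ⊢
  rw [dualFun]
  linarith

lemma continuousAt_C_dualArg {μ : ℝ} (hμ : 0 < μ) : ContinuousAt (fun μ => C (dualArg m pN μ)) μ :=
  ContinuousAt.comp (g := C) (S.C_cont.continuousAt (Ioi_mem_nhds (S.dualArg_spec hμ).1))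
    (S.continuousAt_dualArg hμ)

lemma C_dualArg_strictAntiOn : StrictAntiOn (fun μ => C (dualArg m pN μ)) (Ioi 0) := by
  intro a ha b hb hab
  obtain ⟨h1, h2, -⟩ := S.dualArg_spec ha
  obtain ⟨h4, h5, -⟩ := S.dualArg_spec hb
  exact S.C_strictAntiOn ⟨h1, h2.le⟩ ⟨h4, h5.le⟩ (S.dualArg_strictMonoOn ha hb hab)

lemma continuousAt_dualDeriv {β μ : ℝ} (hβ : 0 < β) (hμ : 0 < μ) :
    ContinuousAt (fun x : ℝ × ℝ => dualDeriv C m pN x.1 x.2) (β, μ) := by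
  have h1 : ContinuousAt (fun x : ℝ × ℝ => C (dualArg m pN x.2)) (β, μ) :=
    ContinuousAt.comp (g := fun μ => C (dualArg m pN μ)) (f := fun x : ℝ × ℝ => x.2)
      (S.continuousAt_C_dualArg hμ) continuousAt_snd
  have h2 : ContinuousAt (fun x : ℝ × ℝ => C (dualArg m pN (x.1 * x.2))) (β, μ) :=
    ContinuousAt.comp (g := fun μ => C (dualArg m pN μ)) (f := fun x : ℝ × ℝ => x.1 * x.2)
      (S.continuousAt_C_dualArg (mul_pos hβ hμ)) (continuousAt_fst.mul continuousAt_snd)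
  exact h1.add (continuousAt_fst.mul h2)

lemma dualDeriv_strictAntiOn {β : ℝ} (hβ : 0 < β) :
    StrictAntiOn (dualDeriv C m pN β) (Ioi 0) := by
  intro a ha b hb hab
  have h1 := S.C_dualArg_strictAntiOn ha hb hab
  have h2 := S.C_dualArg_strictAntiOn (mem_Ioi.2 (mul_pos hβ ha)) (mem_Ioi.2 (mul_pos hβ hb))
    (mul_lt_mul_of_pos_left hab hβ)
  simp only [dualDeriv]
  simp only at h1 h2
  nlinarith

lemma m_p1_pos : 0 < m p1 := S.m_pos p1 S.p1_pos S.p1_lt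

lemma C_dualArg_nonneg {μ : ℝ} (hμ : 0 < μ) (h : μ ≤ m p1) : 0 ≤ C (dualArg m pN μ) := by
  have := S.C_dualArg_strictAntiOn.antitoneOn (mem_Ioi.2 hμ) (mem_Ioi.2 S.m_p1_pos) h
  simpa only [S.dualArg_m S.p1_pos S.p1_lt, S.C_p1] using this

lemma C_dualArg_nonpos {μ : ℝ} (h : m p1 ≤ μ) : C (dualArg m pN μ) ≤ 0 := by
  have := S.C_dualArg_strictAntiOn.antitoneOn (mem_Ioi.2 S.m_p1_pos)
    (mem_Ioi.2 (S.m_p1_pos.trans_le h)) h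
  simpa only [S.dualArg_m S.p1_pos S.p1_lt, S.C_p1] using this

lemma exists_dualMult {β : ℝ} (hβ : 0 < β) : ∃ μ, 0 < μ ∧ dualDeriv C m pN β μ = 0 := by
  have hm := S.m_p1_pos
  set a := min (m p1) (m p1 / β) with ha
  set b := max (m p1) (m p1 / β) with hb
  have ha0 : 0 < a := lt_min hm (by positivity)
  have hab : a ≤ b := (min_le_left _ _).trans (le_max_left _ _)
  have hcont : ContinuousOn (dualDeriv C m pN β) (Icc a b) := fun μ hμ =>
    (ContinuousAt.comp (f := fun μ : ℝ => (β, μ)) (g := fun x : ℝ × ℝ => dualDeriv C m pN x.1 x.2)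
      (S.continuousAt_dualDeriv hβ (ha0.trans_le hμ.1)) (by fun_prop)).continuousWithinAt
  have h1 : 0 ≤ dualDeriv C m pN β a := by
    have h2 := S.C_dualArg_nonneg ha0 (min_le_left _ _)
    have h3 := S.C_dualArg_nonneg (mul_pos hβ ha0) (by
      rw [mul_comm, ← le_div_iff₀ hβ]; exact min_le_right _ _)
    rw [dualDeriv]
    positivity
  have h4 : dualDeriv C m pN β b ≤ 0 := by
    have h2 := S.C_dualArg_nonpos (μ := b) (le_max_left _ _)
    have h3 := S.C_dualArg_nonpos (μ := β * b) (by
      rw [mul_comm, ← div_le_iff₀ hβ]; exact le_max_right _ _)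
    rw [dualDeriv]
    nlinarith
  obtain ⟨μ, hμ, hμ0⟩ := intermediate_value_Icc' hab hcont (show (0 : ℝ) ∈ Icc _ _ from ⟨h4, h1⟩)
  exact ⟨μ, ha0.trans_le hμ.1, hμ0⟩

lemma dualMult_spec {β : ℝ} (hβ : 0 < β) :
    0 < dualMult C m pN β ∧ dualDeriv C m pN β (dualMult C m pN β) = 0 := by
  rw [dualMult, dif_pos (S.exists_dualMult hβ)]
  exact (S.exists_dualMult hβ).choose_spec

lemma continuousAt_dualMult {β : ℝ} (hβ : 0 < β) : ContinuousAt (dualMult C m pN) β := by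
  obtain ⟨hμ, hD⟩ := S.dualMult_spec hβ
  set μ := dualMult C m pN β
  have anti := fun {β : ℝ} (hβ : 0 < β) => S.dualDeriv_strictAntiOn hβ
  have cont : ∀ ν, 0 < ν → ContinuousAt (fun b => dualDeriv C m pN b ν) β := fun ν hν =>
    ContinuousAt.comp (f := fun b : ℝ => (b, ν)) (g := fun x : ℝ × ℝ => dualDeriv C m pN x.1 x.2)
      (S.continuousAt_dualDeriv hβ hν) (by fun_prop)
  refine tendsto_order.2 ⟨fun a ha => ?_, fun a ha => ?_⟩
  · have hν : 0 < max a (μ / 2) := lt_max_of_lt_right (by positivity)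
    have h1 : 0 < dualDeriv C m pN β (max a (μ / 2)) := by
      rw [← hD]
      exact anti hβ hν hμ (max_lt ha (by linarith))
    filter_upwards [(cont _ hν).eventually_const_lt h1, Ioi_mem_nhds hβ] with b hb hb0
    obtain ⟨h3, h4⟩ := S.dualMult_spec hb0
    rw [← h4, (anti hb0).lt_iff_gt h3 hν] at hb
    exact (le_max_left _ _).trans_lt hb
  · have hν : 0 < a := hμ.trans ha
    have h1 : dualDeriv C m pN β a < 0 := by
      rw [← hD]
      exact anti hβ hμ hν ha
    filter_upwards [(cont _ hν).eventually_lt_const h1, Ioi_mem_nhds hβ] with b hb hb0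
    obtain ⟨h3, h4⟩ := S.dualMult_spec hb0
    rwa [← h4, (anti hb0).lt_iff_gt hν h3] at hb

lemma minVol_eq {β : ℝ} (hβ : 0 < β) : minVol C m pN β =
    dualFun C m pN (dualMult C m pN β) + dualFun C m pN (β * dualMult C m pN β) := by
  have := (S.dualMult_spec hβ).2
  rw [dualDeriv] at this
  rw [minVol, dualFun, dualFun]
  linear_combination -dualMult C m pN β * this

/-- Weak duality. -/
lemma minVol_le {β p q : ℝ} (hβ : 0 < β) (hp : 0 < p) (hq : 0 < q) (h : C p + β * C q ≤ 0) :
    minVol C m pN β ≤ p + q := by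
  have hμ := (S.dualMult_spec hβ).1
  rw [S.minVol_eq hβ]
  have h1 := S.dualFun_le hμ hp
  have h2 := S.dualFun_le (mul_pos hβ hμ) hq
  nlinarith

/-- Existence of an optimal pair. -/
lemma exists_minVol {β : ℝ} (hβ : 0 < β) : ∃ p q, 0 < p ∧ p < pN ∧ 0 < q ∧ q < pN ∧
    C p + β * C q = 0 ∧ p + q = minVol C m pN β := by
  obtain ⟨hμ, hD⟩ := S.dualMult_spec hβ
  obtain ⟨h1, h2, -⟩ := S.dualArg_spec hμ
  obtain ⟨h3, h4, -⟩ := S.dualArg_spec (mul_pos hβ hμ)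
  exact ⟨_, _, h1, h2, h3, h4, hD, rfl⟩

lemma le_minVol {β ν : ℝ} (hβ : 0 < β) (hν : 0 < ν) :
    dualFun C m pN ν + dualFun C m pN (β * ν) ≤ minVol C m pN β := by
  obtain ⟨p, q, hp, -, hq, -, h, hM⟩ := S.exists_minVol hβ
  have h1 := S.dualFun_le hν hp
  have h2 := S.dualFun_le (mul_pos hβ hν) hq
  rw [← hM]
  have : ν * (C p + β * C q) = 0 := by rw [h, mul_zero]
  nlinarith

lemma hasDerivAt_minVol {β : ℝ} (hβ : 0 < β) : HasDerivAt (minVol C m pN)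
    (dualMult C m pN β * C (dualArg m pN (β * dualMult C m pN β))) β := by
  have hμ := (S.dualMult_spec hβ).1
  have c0 := S.continuousAt_C_dualArg (mul_pos hβ hμ)
  set G := dualMult C m pN β * C (dualArg m pN (β * dualMult C m pN β)) with hG
  rw [hasDerivAt_iff_tendsto_slope]
  set lo := fun b => dualMult C m pN β * C (dualArg m pN (b * dualMult C m pN β)) with hlo
  set hi := fun b => dualMult C m pN b * C (dualArg m pN (β * dualMult C m pN b)) with hhi
  have tlo : Tendsto lo (nhds β) (nhds G) := tendsto_const_nhds.mul
    (ContinuousAt.comp (g := fun μ => C (dualArg m pN μ))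
      (f := fun b : ℝ => b * dualMult C m pN β) c0 (by fun_prop))
  have thi : Tendsto hi (nhds β) (nhds G) := (S.continuousAt_dualMult hβ).tendsto.mul
    (ContinuousAt.comp (g := fun μ => C (dualArg m pN μ))
      (f := fun b : ℝ => β * dualMult C m pN b) c0
      (continuousAt_const.mul (S.continuousAt_dualMult hβ)))
  have tmin := tlo.min thi
  have tmax := tlo.max thi
  rw [min_self] at tmin
  rw [max_self] at tmax
  refine tendsto_of_tendsto_of_tendsto_of_le_of_le' (tmin.mono_left nhdsWithin_le_nhds)
    (tmax.mono_left nhdsWithin_le_nhds) ?_ ?_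
  all_goals
    filter_upwards [self_mem_nhdsWithin, mem_nhdsWithin_of_mem_nhds (Ioi_mem_nhds hβ)]
      with b hb hb0
    have hb0' : 0 < b := hb0
    have hν := (S.dualMult_spec hb0').1
    have e1 := S.le_minVol hb0' hμ
    have e2 := S.le_minVol hβ hν
    have e3 := S.minVol_eq hβ
    have e4 := S.minVol_eq hb0'
    have e5 := S.dualFun_sub_le (mul_pos hβ hμ) (mul_pos hb0' hμ)
    have e6 := S.dualFun_sub_le (mul_pos hb0' hν) (mul_pos hβ hν)
    have f1 : (b - β) * lo b ≤ minVol C m pN b - minVol C m pN β := by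
      simp only [hlo]
      linarith
    have f2 : minVol C m pN b - minVol C m pN β ≤ (b - β) * hi b := by
      simp only [hhi]
      linarith
    rw [slope_def_field]
    rcases lt_or_gt_of_ne (show b ≠ β from hb) with hlt | hgt
  · refine (min_le_right _ _).trans ?_
    rw [le_div_iff_of_neg (by linarith)]
    linarith
  · refine (min_le_left _ _).trans ?_
    rw [le_div_iff₀ (by linarith)]
    linarith
  · refine le_trans ?_ (le_max_left _ _)
    rw [div_le_iff_of_neg (by linarith)]
    linarith
  · refine le_trans ?_ (le_max_right _ _)
    rw [div_le_iff₀ (by linarith)]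
    linarith

lemma continuousAt_deriv_minVol {β : ℝ} (hβ : 0 < β) : ContinuousAt
    (fun β => dualMult C m pN β * C (dualArg m pN (β * dualMult C m pN β))) β := by
  have hμ := (S.dualMult_spec hβ).1
  have c1 := S.continuousAt_dualMult hβ
  exact c1.mul (ContinuousAt.comp (g := fun μ => C (dualArg m pN μ))
    (f := fun b : ℝ => b * dualMult C m pN b) (S.continuousAt_C_dualArg (mul_pos hβ hμ))
    (continuousAt_id.mul c1))

lemma mul_dualMult_lt {β : ℝ} (hβ : 0 < β) (hβ1 : β < 1) : β * dualMult C m pN β < m p1 := by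
  obtain ⟨hμ, hD⟩ := S.dualMult_spec hβ
  by_contra! hle
  have h1 := S.C_dualArg_nonpos hle
  have h2 : m p1 < dualMult C m pN β := by nlinarith
  have h3 := S.C_dualArg_strictAntiOn (mem_Ioi.2 S.m_p1_pos) (mem_Ioi.2 hμ) h2
  simp only [S.dualArg_m S.p1_pos S.p1_lt, S.C_p1] at h3
  rw [dualDeriv] at hD
  nlinarith

lemma minVol_strictMonoOn : StrictMonoOn (minVol C m pN) (Ioc 0 1) := by
  refine strictMonoOn_of_deriv_pos (convex_Ioc 0 1)
    (fun β hβ => (S.hasDerivAt_minVol hβ.1).continuousAt.continuousWithinAt) fun β hβ => ?_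
  rw [interior_Ioc] at hβ
  rw [(S.hasDerivAt_minVol hβ.1).deriv]
  obtain ⟨hμ, -⟩ := S.dualMult_spec hβ.1
  refine mul_pos hμ ?_
  have := S.C_dualArg_strictAntiOn (mem_Ioi.2 (mul_pos hβ.1 hμ)) (mem_Ioi.2 S.m_p1_pos)
    (S.mul_dualMult_lt hβ.1 hβ.2)
  simpa only [S.dualArg_m S.p1_pos S.p1_lt, S.C_p1] using this

lemma minVol_one : minVol C m pN 1 = 2 * p1 := by
  obtain ⟨hμ, hD⟩ := S.dualMult_spec one_pos
  rw [dualDeriv, one_mul, one_mul] at hD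
  have h1 : C (dualArg m pN (dualMult C m pN 1)) = C p1 := by rw [S.C_p1]; linarith
  obtain ⟨h3, h4, -⟩ := S.dualArg_spec hμ
  have h2 := S.C_strictAntiOn.injOn ⟨h3, h4.le⟩ ⟨S.p1_pos, S.p1_lt.le⟩ h1
  rw [minVol, one_mul, h2]
  ring

lemma p1_le_minVol {β : ℝ} (hβ : 0 < β) (hβ1 : β < 1) : p1 ≤ minVol C m pN β := by
  obtain ⟨hμ, hD⟩ := S.dualMult_spec hβ
  have h1 := S.C_dualArg_nonneg (mul_pos hβ hμ) (S.mul_dualMult_lt hβ hβ1).le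
  rw [dualDeriv] at hD
  have h2 : C (dualArg m pN (dualMult C m pN β)) ≤ 0 := by nlinarith
  have h3 := (S.dualArg_spec (mul_pos hβ hμ)).1
  rw [minVol]
  by_contra! hlt
  have := S.C_pos (S.dualArg_spec hμ).1 (p := dualArg m pN (dualMult C m pN β)) (by linarith)
  linarith

lemma tendsto_minVol_zero : Tendsto (minVol C m pN) (nhdsWithin 0 (Ioi 0)) (nhds p1) := by
  refine tendsto_order.2 ⟨fun a ha => ?_, fun a ha => ?_⟩
  · filter_upwards [Ioo_mem_nhdsGT (zero_lt_one (α := ℝ))] with β hβ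
    exact ha.trans_le (S.p1_le_minVol hβ.1 hβ.2)
  · set δ := (a - p1) / 3 with hδ
    have hδ0 : 0 < δ := by rw [hδ]; linarith
    have hC := S.C_neg (p := p1 + δ) (by linarith)
    have ht : Tendsto (fun β : ℝ => C (p1 + δ) + β * C δ) (nhdsWithin 0 (Ioi 0))
        (nhds (C (p1 + δ) + 0 * C δ)) :=
      ((continuous_const.add (continuous_id.mul continuous_const)).tendsto 0).mono_left
        nhdsWithin_le_nhds
    rw [zero_mul, add_zero] at ht
    filter_upwards [ht.eventually_lt_const hC, self_mem_nhdsWithin] with β hβ hβ0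
    have := S.minVol_le hβ0 (by linarith [S.p1_pos]) hδ0 hβ.le
    linarith

end IsEnergyConst

end Duality

section RadialInequality

/-- The weighted primitive `∫₀ʳ s ^ (d - 1) W s ds`. -/
def massFun (d : ℕ) (W : ℝ → ℝ) (r : ℝ) : ℝ := ∫ s in (0)..r, s ^ (d - 1) * W s

lemma hasDerivAt_massFun {d : ℕ} {W : ℝ → ℝ} (hW : Continuous W) (r : ℝ) :
    HasDerivAt (massFun d W) (r ^ (d - 1) * W r) r :=
  (((continuous_pow _).mul hW).integral_hasStrictDerivAt 0 r).hasDerivAt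

lemma mul_massFun_sub {d : ℕ} (hd : d ≠ 0) {W : ℝ → ℝ} (hW : Continuous W) (r : ℝ) :
    r ^ d * W r - d * massFun d W r = d * ∫ s in (0)..r, s ^ (d - 1) * (W r - W s) := by
  have hd' : (d : ℝ) ≠ 0 := by exact_mod_cast hd
  have h1 : (∫ s in (0)..r, s ^ (d - 1) * (W r - W s)) =
      (∫ s in (0)..r, s ^ (d - 1) * W r) - ∫ s in (0)..r, s ^ (d - 1) * W s := by
    rw [← intervalIntegral.integral_sub]
    · simp only [mul_sub]
    · exact ((continuous_pow _).mul continuous_const).intervalIntegrable _ _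
    · exact ((continuous_pow _).mul hW).intervalIntegrable _ _
  have h2 : ((d - 1 : ℕ) : ℝ) + 1 = d := by
    rw [← Nat.cast_add_one, Nat.sub_add_cancel (Nat.one_le_iff_ne_zero.2 hd)]
  rw [h1, intervalIntegral.integral_mul_const, integral_pow, h2,
    Nat.sub_add_cancel (Nat.one_le_iff_ne_zero.2 hd), massFun]
  simp only [ne_eq, hd, not_false_eq_true, zero_pow, sub_zero]
  field_simp

lemma mul_massFun_sub_nonpos {d : ℕ} (hd : d ≠ 0) {W : ℝ → ℝ} (hW : Continuous W)
    (hanti : AntitoneOn W (Ici 0)) {r : ℝ} (hr : 0 ≤ r) :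
    r ^ d * W r - d * massFun d W r ≤ 0 := by
  rw [mul_massFun_sub hd hW]
  refine mul_nonpos_of_nonneg_of_nonpos (by positivity) ?_
  rw [← neg_nonneg, ← intervalIntegral.integral_neg]
  refine intervalIntegral.integral_nonneg hr fun s hs => ?_
  have h1 := hanti (mem_Ici.2 hs.1) (mem_Ici.2 hr) hs.2
  have h2 : 0 ≤ s ^ (d - 1) := pow_nonneg hs.1 _
  nlinarith

lemma abs_mul_massFun_sub_le {d : ℕ} (hd : d ≠ 0) {W : ℝ → ℝ} {K : NNReal}
    (hW : LipschitzWith K W) {r : ℝ} (hr : 0 ≤ r) :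
    |r ^ d * W r - d * massFun d W r| ≤ d * K * r ^ (d + 1) := by
  rw [mul_massFun_sub hd hW.continuous, abs_mul, Nat.abs_cast, mul_assoc]
  refine mul_le_mul_of_nonneg_left ?_ (by positivity)
  have := intervalIntegral.norm_integral_le_of_norm_le_const (a := 0) (b := r)
    (f := fun s => s ^ (d - 1) * (W r - W s)) (C := r ^ (d - 1) * (K * r)) fun s hs => ?_
  · refine this.trans (le_of_eq ?_)
    rw [sub_zero, abs_of_nonneg hr, pow_succ]
    have : r ^ d = r ^ (d - 1) * r := by
      rw [← pow_succ, Nat.sub_add_cancel (Nat.one_le_iff_ne_zero.2 hd)]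
    rw [this]
    ring
  · rw [uIoc_of_le hr] at hs
    have h1 := hW.dist_le_mul r s
    rw [Real.dist_eq, Real.dist_eq, abs_of_nonneg (a := r - s) (by linarith [hs.2])] at h1
    rw [norm_mul, norm_pow, Real.norm_eq_abs, Real.norm_eq_abs, abs_of_pos hs.1]
    have h2 : |W r - W s| ≤ K * r := h1.trans (by gcongr; linarith [hs.1])
    have := hs.1
    gcongr
    exact hs.2

namespace IsHelmholtz

variable {d : ℕ} {φ h h' : ℝ → ℝ} (H : IsHelmholtz d φ h h') {k : ℝ} (hk : IsFirstZero h k)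

include H

lemma exists_le_pow_mul_helmE : ∃ r₀ > 0, ∀ r, 0 ≤ r → r ≤ r₀ →
    r ^ (d + 2) / (2 * d * (d + 2)) ≤ r ^ d * helmE d φ h r := by
  have hd := H.d_pos
  have h0 : 1 / (2 * (d : ℝ)) < h 0 := by
    rw [H.h_zero]
    gcongr
    linarith
  obtain ⟨r₀, hr₀, hr⟩ := Metric.eventually_nhds_iff.1
    (H.continuous_h.continuousAt.eventually_const_lt h0)
  refine ⟨r₀ / 2, by positivity, fun r hr0 hrr => ?_⟩
  have hder : ∀ s, HasDerivAt (fun r => r ^ d * helmE d φ h r - r ^ (d + 2) / (2 * d * (d + 2)))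
      (s ^ (d + 1) * (h s - 1 / (2 * d))) s := by
    intro s
    refine ((H.hasDerivAt_pow_mul_helmE s).sub
      ((hasDerivAt_pow (d + 2) s).div_const (2 * d * (d + 2)))).congr_deriv ?_
    push_cast
    field_simp
  have hmono : MonotoneOn (fun r => r ^ d * helmE d φ h r - r ^ (d + 2) / (2 * d * (d + 2)))
      (Icc 0 r) := by
    refine monotoneOn_of_deriv_nonneg (convex_Icc 0 r)
      (fun s _ => (hder s).continuousAt.continuousWithinAt)
      (fun s _ => (hder s).differentiableAt.differentiableWithinAt) fun s hs => ?_
    rw [interior_Icc] at hs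
    rw [(hder s).deriv]
    have h1 : 1 / (2 * (d : ℝ)) < h s := by
      apply hr
      rw [Real.dist_eq, sub_zero, abs_of_pos hs.1]
      linarith [hs.2]
    exact mul_nonneg (pow_nonneg hs.1.le _) (by linarith)
  have h1 := hmono (left_mem_Icc.2 hr0) (right_mem_Icc.2 hr0) hr0
  simp only [ne_eq, H.d_ne_zero, not_false_eq_true, zero_pow, zero_mul,
    Nat.add_eq_zero_iff, OfNat.ofNat_ne_zero, and_self, zero_div, sub_zero] at h1
  linarith

include hk

lemma lipschitzOnWith_radConst {a : ℝ} (ha : 0 < a) :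
    ∃ L, LipschitzOnWith L (radConst d φ h k) (Ici a) := by
  have hk0 := hk.pos
  set b := min a k with hb
  have hb0 : 0 < b := lt_min ha hk0
  have he : ∀ r ∈ Icc b k, 0 < helmE d φ h r := fun r hr =>
    H.helmE_pos' hk (hb0.trans_le hr.1) hr.2
  have hcont : ContinuousOn (fun r => -(d * r ^ (d + 1) * h r ^ 2 / (r ^ d * helmE d φ h r) ^ 2))
      (Icc b k) := by
    refine (ContinuousOn.div ?_ ?_ fun r hr => ?_).neg
    · exact ((continuous_const.mul (continuous_pow _)).mul (H.continuous_h.pow 2)).continuousOn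
    · exact (((continuous_pow _).mul H.continuous_helmE).pow 2).continuousOn
    · have := he r hr
      have := hb0.trans_le hr.1
      positivity
  obtain ⟨M, hM⟩ := isCompact_Icc.exists_bound_of_continuousOn hcont
  have h1 : LipschitzOnWith M.toNNReal (fun r => φ r / (r ^ d * helmE d φ h r)) (Icc b k) := by
    refine (convex_Icc b k).lipschitzOnWith_of_nnnorm_hasDerivWithin_le
      (fun r hr => (H.hasDerivAt_ratio (hb0.trans_le hr.1) (he r hr)).hasDerivWithinAt)
      fun r hr => ?_
    rw [← NNReal.coe_le_coe, coe_nnnorm]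
    exact (hM r hr).trans (Real.le_coe_toNNReal M)
  have h2 : LipschitzOnWith 1 (fun r : ℝ => min r k) (Ici a) :=
    (LipschitzWith.id.min_const k).lipschitzOnWith
  exact ⟨_, h1.comp h2 fun r hr => ⟨min_le_min_right k hr, min_le_right _ _⟩⟩

lemma hasDerivAt_radConst_lt {r : ℝ} (hr : 0 < r) (hrk : r < k) :
    HasDerivAt (radConst d φ h k)
      (-(d * r ^ (d + 1) * h r ^ 2 / (r ^ d * helmE d φ h r) ^ 2)) r := by
  refine (H.hasDerivAt_ratio hr (H.helmE_pos' hk hr hrk.le)).congr_of_eventuallyEq ?_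
  filter_upwards [Iio_mem_nhds hrk] with s hs
  exact radConst_eq_of_le (le_of_lt hs)

lemma hasDerivAt_radConst_gt {r : ℝ} (hrk : k < r) : HasDerivAt (radConst d φ h k) 0 r := by
  refine (hasDerivAt_const r (-1 / k ^ d)).congr_of_eventuallyEq ?_
  filter_upwards [Ioi_mem_nhds hrk] with s hs
  exact H.radConst_eq_of_ge hk (le_of_lt hs)

end IsHelmholtz

/-- The calibration function for the radial inequality. -/
def calibration (d : ℕ) (φ h : ℝ → ℝ) (k : ℝ) (W : ℝ → ℝ) (r : ℝ) : ℝ :=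
  radConst d φ h k r * (r ^ d * W r - d * massFun d W r) ^ 2 / d + r ^ d * W r ^ 2 / d -
    2 * (W r * massFun d W r)

namespace IsHelmholtz

variable {d : ℕ} {φ h h' : ℝ → ℝ} (H : IsHelmholtz d φ h h') {k : ℝ} (hk : IsFirstZero h k)
  {W : ℝ → ℝ}

include H

lemma hasDerivAt_calibration (hWc : Continuous W) {r c' w : ℝ}
    (hc : HasDerivAt (radConst d φ h k) c' r) (hw : HasDerivAt W w r) :
    HasDerivAt (calibration d φ h k W)
      (c' * (r ^ d * W r - d * massFun d W r) ^ 2 / d +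
        2 / d * w * (r ^ d * W r - d * massFun d W r) * (1 + radConst d φ h k r * r ^ d) -
        W r ^ 2 * r ^ (d - 1)) r := by
  have hd := H.d_pos
  have hV := ((hasDerivAt_pow d r).mul hw).sub
    ((hasDerivAt_massFun (d := d) hWc r).const_mul (d : ℝ))
  have h1 := (hc.mul (hV.pow 2)).div_const (d : ℝ)
  have h2 := ((hasDerivAt_pow d r).mul (hw.pow 2)).div_const (d : ℝ)
  have h3 := (hw.mul (hasDerivAt_massFun (d := d) hWc r)).const_mul 2
  refine ((h1.add h2).sub h3).congr_deriv ?_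
  simp only [Pi.mul_apply, Pi.sub_apply, Pi.pow_apply]
  push_cast
  field_simp
  ring

include hk

lemma deriv_calibration_le (hWc : Continuous W) (hanti : AntitoneOn W (Ici 0)) {r : ℝ} (hr : 0 < r)
    (hrk : r ≠ k) (hw : DifferentiableAt ℝ W r) :
    deriv (calibration d φ h k W) r ≤ (deriv W r ^ 2 - W r ^ 2) * r ^ (d - 1) := by
  have hd := H.d_pos
  have hw0 : deriv W r ≤ 0 := by
    rw [← derivWithin_of_mem_nhds (Ici_mem_nhds hr)]
    exact hanti.derivWithin_nonpos
  have hV := mul_massFun_sub_nonpos H.d_ne_zero hWc hanti hr.le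
  set w := deriv W r
  set V := r ^ d * W r - d * massFun d W r
  rcases lt_or_gt_of_ne hrk with hlt | hgt
  · have he := H.helmE_pos' hk hr hlt.le
    rw [(H.hasDerivAt_calibration hWc (H.hasDerivAt_radConst_lt hk hr hlt) hw.hasDerivAt).deriv]
    have e1 : 1 + radConst d φ h k r * r ^ d = d * h r / helmE d φ h r := by
      rw [radConst_eq_of_le hlt.le]
      have : φ r = d * h r - helmE d φ h r := by rw [helmE]; ring
      rw [this]
      field_simp
      ring
    have e2 : 0 ≤ r ^ (d - 1) * (w - V * h r / (r ^ (d - 1) * helmE d φ h r)) ^ 2 := by positivity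
    have e3 : r ^ (d - 1) * (w - V * h r / (r ^ (d - 1) * helmE d φ h r)) ^ 2 =
        r ^ (d - 1) * w ^ 2 - 2 / d * w * V * (d * h r / helmE d φ h r) -
        -(d * r ^ (d + 1) * h r ^ 2 / (r ^ d * helmE d φ h r) ^ 2) * V ^ 2 / d := by
      rw [show r ^ (d + 1) = r ^ (d - 1) * r * r by rw [H.pow_pred_mul, pow_succ],
        ← H.pow_pred_mul r]
      field_simp
      ring
    rw [e1]
    linarith
  · rw [(H.hasDerivAt_calibration hWc (H.hasDerivAt_radConst_gt hk hgt) hw.hasDerivAt).deriv,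
      H.radConst_eq_of_ge hk hgt.le]
    have hk0 := hk.pos
    have e1 : 1 + -1 / k ^ d * r ^ d ≤ 0 := by
      have : 1 ≤ r ^ d / k ^ d := by
        rw [one_le_div (by positivity)]
        gcongr
      rw [neg_div, neg_mul, one_div_mul_eq_div]
      linarith
    have e2 : 0 ≤ 2 / d * w * V := by
      rw [mul_assoc]
      exact mul_nonneg (by positivity) (mul_nonneg_of_nonpos_of_nonpos hw0 hV)
    have e3 := mul_nonpos_of_nonneg_of_nonpos e2 e1
    have e4 : 0 ≤ w ^ 2 * r ^ (d - 1) := by positivity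
    simp only [zero_mul, zero_div, zero_add]
    linarith

omit H hk in
lemma intervalIntegrable_radial {K : NNReal} (hW : LipschitzWith K W) (a R : ℝ) :
    IntervalIntegrable (fun r => (deriv W r ^ 2 - W r ^ 2) * r ^ (d - 1)) volume a R := by
  have h1 : IntervalIntegrable (fun r => deriv W r ^ 2 * r ^ (d - 1)) volume a R := by
    have h2 : IntervalIntegrable (fun r : ℝ => (K : ℝ) ^ 2 * |r ^ (d - 1)|) volume a R :=
      (continuous_const.mul (continuous_pow _).abs).intervalIntegrable _ _
    refine h2.mono_fun (((measurable_deriv W).pow_const 2).mul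
      (measurable_id.pow_const _)).aestronglyMeasurable (ae_of_all _ fun r => ?_)
    beta_reduce
    rw [norm_mul, norm_mul, norm_pow, Real.norm_eq_abs, Real.norm_eq_abs, Real.norm_eq_abs,
      Real.norm_eq_abs, abs_abs, abs_of_nonneg (a := (K : ℝ) ^ 2) (by positivity)]
    have := norm_deriv_le_of_lipschitz (x₀ := r) hW
    rw [Real.norm_eq_abs] at this
    gcongr
  have h2 : IntervalIntegrable (fun r => W r ^ 2 * r ^ (d - 1)) volume a R :=
    ((hW.continuous.pow 2).mul (continuous_pow _)).intervalIntegrable _ _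
  simpa only [sub_mul] using h1.sub h2

lemma calibration_sub_le {K : NNReal} (hW : LipschitzWith K W) (hanti : AntitoneOn W (Ici 0))
    {a R : ℝ} (ha : 0 < a) (haR : a ≤ R) :
    calibration d φ h k W R - calibration d φ h k W a ≤
      ∫ r in a..R, (deriv W r ^ 2 - W r ^ 2) * r ^ (d - 1) := by
  obtain ⟨L, hL⟩ := H.lipschitzOnWith_radConst hk ha
  have hu : uIcc a R ⊆ Ici a := by
    rw [uIcc_of_le haR]
    exact Icc_subset_Ici_self
  have a1 : AbsolutelyContinuousOnInterval (radConst d φ h k) a R :=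
    (hL.mono hu).absolutelyContinuousOnInterval
  have a2 : AbsolutelyContinuousOnInterval W a R :=
    hW.lipschitzOnWith.absolutelyContinuousOnInterval
  have a3 : AbsolutelyContinuousOnInterval (fun r : ℝ => r ^ d) a R :=
    (contDiff_id.pow d).contDiffOn.absolutelyContinuousOnInterval
  have a4 : AbsolutelyContinuousOnInterval (massFun d W) a R := by
    have hc1 : ContDiff ℝ 1 (massFun d W) := by
      rw [contDiff_one_iff_deriv]
      refine ⟨fun r => (hasDerivAt_massFun hW.continuous r).differentiableAt, ?_⟩
      have : deriv (massFun d W) = fun r => r ^ (d - 1) * W r :=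
        funext fun r => (hasDerivAt_massFun hW.continuous r).deriv
      rw [this]
      exact (continuous_pow _).mul hW.continuous
    exact hc1.contDiffOn.absolutelyContinuousOnInterval
  have a5 : AbsolutelyContinuousOnInterval (calibration d φ h k W) a R := by
    have b1 := (a3.fun_mul a2).fun_sub (a4.const_mul d)
    have b2 := (a1.fun_mul (b1.fun_mul b1)).const_mul (1 / (d : ℝ))
    have b3 := (a3.fun_mul (a2.fun_mul a2)).const_mul (1 / (d : ℝ))
    have b4 := (b2.fun_add b3).fun_sub ((a2.fun_mul a4).const_mul 2)
    refine (congrArg (AbsolutelyContinuousOnInterval · a R) (funext fun r => ?_)).mp b4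
    simp only [calibration]
    ring
  rw [← a5.integral_deriv_eq_sub]
  refine intervalIntegral.integral_mono_ae_restrict haR a5.intervalIntegrable_deriv
    (intervalIntegrable_radial hW a R) ?_
  have h1 : ∀ᵐ r : ℝ, DifferentiableAt ℝ W r := hW.ae_differentiableAt_real
  have h2 : ∀ᵐ r : ℝ, r ≠ k := by simp [ae_iff]
  refine (ae_restrict_iff' measurableSet_Icc).2 ?_
  filter_upwards [h1, h2] with r hr1 hr2 hr3
  exact H.deriv_calibration_le hk hW.continuous hanti (ha.trans_le hr3.1) hr2 hr1

lemma tendsto_calibration {K : NNReal} (hW : LipschitzWith K W) :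
    Tendsto (calibration d φ h k W) (nhdsWithin 0 (Ioi 0)) (nhds 0) := by
  have hd := H.d_pos
  obtain ⟨r₀, hr₀, hr⟩ := H.exists_le_pow_mul_helmE
  have t1 : Tendsto (fun r => radConst d φ h k r * (r ^ d * W r - d * massFun d W r) ^ 2 / d)
      (nhdsWithin 0 (Ioi 0)) (nhds 0) := by
    have hc : Continuous fun r => |φ r| * (2 * d ^ 2 * (d + 2) * K ^ 2) * r ^ d :=
      (H.continuous_phi.abs.mul continuous_const).mul (continuous_pow _)
    have t := (hc.tendsto 0).mono_left (nhdsWithin_le_nhds (s := Ioi 0))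
    rw [zero_pow H.d_ne_zero, mul_zero] at t
    refine squeeze_zero_norm' ?_ t
    filter_upwards [self_mem_nhdsWithin, nhdsWithin_le_nhds (Iio_mem_nhds hr₀),
      nhdsWithin_le_nhds (Iio_mem_nhds hk.pos)] with r h0 h1 h2
    have h0' : 0 < r := h0
    have hV := abs_mul_massFun_sub_le H.d_ne_zero hW h0'.le
    have he := hr r h0'.le (le_of_lt h1)
    have hp : 0 < r ^ (d + 2) / (2 * d * (d + 2)) := by positivity
    have he' := hp.trans_le he
    rw [radConst_eq_of_le (le_of_lt h2), Real.norm_eq_abs, abs_div, abs_mul, abs_div, abs_pow,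
      abs_of_pos he', abs_of_pos hd]
    calc |φ r| / (r ^ d * helmE d φ h r) * |r ^ d * W r - d * massFun d W r| ^ 2 / d
        ≤ |φ r| / (r ^ (d + 2) / (2 * d * (d + 2))) * (d * K * r ^ (d + 1)) ^ 2 / d := by gcongr
      _ = |φ r| * (2 * d ^ 2 * (d + 2) * K ^ 2) * r ^ d := by
        field_simp
        ring
  have hc : Continuous fun r => r ^ d * W r ^ 2 / d - 2 * (W r * massFun d W r) := by
    have hm : Continuous (massFun d W) := continuous_iff_continuousAt.2 fun r =>
      (hasDerivAt_massFun hW.continuous r).continuousAt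
    exact (((continuous_pow _).mul (hW.continuous.pow 2)).div_const _).sub
      ((hW.continuous.mul hm).const_mul 2)
  have t2 := (hc.tendsto 0).mono_left (nhdsWithin_le_nhds (s := Ioi 0))
  have hm0 : massFun d W 0 = 0 := by simp [massFun]
  rw [hm0, zero_pow H.d_ne_zero] at t2
  have t3 := t1.add t2
  simp only [zero_mul, zero_div, mul_zero, sub_zero, add_zero] at t3
  refine t3.congr fun r => ?_
  rw [calibration]
  ring

lemma radial_ineq {K : NNReal} (hW : LipschitzWith K W) (hanti : AntitoneOn W (Ici 0))
    {R : ℝ} (hR : 0 < R) (hWR : W R = 0) :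
    d * radConst d φ h k R * massFun d W R ^ 2 ≤
      ∫ r in (0)..R, (deriv W r ^ 2 - W r ^ 2) * r ^ (d - 1) := by
  have hd := H.d_pos
  set F := fun r => (deriv W r ^ 2 - W r ^ 2) * r ^ (d - 1) with hF
  have hFi : ∀ a b, IntervalIntegrable F volume a b := intervalIntegrable_radial hW
  have hcR : calibration d φ h k W R = d * radConst d φ h k R * massFun d W R ^ 2 := by
    rw [calibration, hWR]
    field_simp
    ring
  have hprim := (intervalIntegral.continuous_primitive hFi 0).tendsto 0
  rw [intervalIntegral.integral_same] at hprim
  have t := (H.tendsto_calibration hk hW).add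
    ((hprim.mono_left (nhdsWithin_le_nhds (s := Ioi 0))).const_sub (∫ r in (0)..R, F r))
  rw [zero_add, sub_zero] at t
  refine ge_of_tendsto t ?_
  filter_upwards [self_mem_nhdsWithin, nhdsWithin_le_nhds (Iio_mem_nhds hR)] with a ha haR
  have h1 := H.calibration_sub_le hk hW hanti ha (le_of_lt haR)
  rw [hcR] at h1
  have h2 := intervalIntegral.integral_add_adjacent_intervals (hFi 0 a) (hFi a R)
  linarith

end IsHelmholtz

end RadialInequality

section RadialIntegration

variable {d : ℕ} {v : EuclideanSpace ℝ (Fin d) → ℝ} {K : NNReal} {R : ℝ}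

lemma norm_gradient_eq (v : EuclideanSpace ℝ (Fin d) → ℝ) (x : EuclideanSpace ℝ (Fin d)) :
    ‖gradient v x‖ = ‖fderiv ℝ v x‖ := by
  simp [gradient]

lemma integral_comp_norm (hd : 0 < d) {f : ℝ → ℝ} (hR0 : 0 ≤ R) (hf : ∀ r, R < r → f r = 0) :
    (∫ x : EuclideanSpace ℝ (Fin d), f ‖x‖) =
      d * ballVol d * ∫ r in (0)..R, f r * r ^ (d - 1) := by
  have : Nonempty (Fin d) := ⟨⟨0, hd⟩⟩
  have : Nontrivial (EuclideanSpace ℝ (Fin d)) := inferInstance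
  rw [integral_fun_norm_addHaar, finrank_euclideanSpace_fin, nsmul_eq_mul, smul_eq_mul,
    Measure.real, ← ballVol, intervalIntegral.integral_of_le hR0, ← mul_assoc]
  congr 1
  rw [← setIntegral_eq_of_subset_of_forall_sdiff_eq_zero measurableSet_Ioi Ioc_subset_Ioi_self]
  · simp only [smul_eq_mul, mul_comm]
  · intro r hr
    have : R < r := by
      by_contra! h
      exact hr.2 ⟨hr.1, h⟩
    simp [hf r this]

lemma integrable_norm_gradient_sq (hv : LipschitzWith K v) (hR : ∀ x, R ≤ ‖x‖ → v x = 0) :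
    Integrable fun x => ‖gradient v x‖ ^ 2 := by
  have hb : Integrable ((closedBall (0 : EuclideanSpace ℝ (Fin d)) R).indicator
      fun _ => (K : ℝ) ^ 2) :=
    (integrable_indicator_iff measurableSet_closedBall).2
      (integrableOn_const measure_closedBall_lt_top.ne)
  simp only [norm_gradient_eq]
  refine hb.mono' ((measurable_fderiv ℝ v).norm.pow_const 2).aestronglyMeasurable
    (ae_of_all _ fun x => ?_)
  rw [Real.norm_eq_abs, abs_of_nonneg (by positivity)]
  by_cases hx : x ∈ closedBall 0 R
  · rw [indicator_of_mem hx]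
    have := norm_fderiv_le_of_lipschitz ℝ hv (x₀ := x)
    gcongr
  · rw [indicator_of_notMem hx]
    simp only [mem_closedBall, dist_zero_right, not_le] at hx
    have : v =ᶠ[nhds x] fun _ => 0 := by
      filter_upwards [(isOpen_lt continuous_const continuous_norm).mem_nhds hx] with y hy
      exact hR y (le_of_lt hy)
    rw [this.fderiv_eq]
    simp

lemma sq_deriv_le_norm_gradient_sq {W : ℝ → ℝ} {x : EuclideanSpace ℝ (Fin d)} (hx : x ≠ 0)
    (hW : DifferentiableAt ℝ (fun y : EuclideanSpace ℝ (Fin d) => W ‖y‖) x) :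
    deriv W ‖x‖ ^ 2 ≤ ‖gradient (fun y : EuclideanSpace ℝ (Fin d) => W ‖y‖) x‖ ^ 2 := by
  have hx' : 0 < ‖x‖ := norm_pos_iff.2 hx
  have h1 : HasDerivAt (fun t : ℝ => t • (‖x‖⁻¹ • x)) ((1 : ℝ) • (‖x‖⁻¹ • x)) ‖x‖ :=
    (hasDerivAt_id ‖x‖).smul_const _
  have h2 : HasFDerivAt (fun y : EuclideanSpace ℝ (Fin d) => W ‖y‖)
      (fderiv ℝ (fun y : EuclideanSpace ℝ (Fin d) => W ‖y‖) x) (‖x‖ • (‖x‖⁻¹ • x)) := by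
    rw [smul_inv_smul₀ hx'.ne']
    exact hW.hasFDerivAt
  have h3 := h2.comp_hasDerivAt ‖x‖ h1
  have h4 : W =ᶠ[nhds ‖x‖] fun t => W ‖t • (‖x‖⁻¹ • x)‖ := by
    filter_upwards [Ioi_mem_nhds hx'] with t ht
    rw [norm_smul, norm_smul, norm_inv, norm_norm, inv_mul_cancel₀ hx'.ne', mul_one,
      Real.norm_eq_abs, abs_of_pos ht]
  rw [(h3.congr_of_eventuallyEq h4).deriv, norm_gradient_eq, ← sq_abs, ← Real.norm_eq_abs]
  have h5 := (fderiv ℝ (fun y : EuclideanSpace ℝ (Fin d) => W ‖y‖) x).le_opNorm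
    ((1 : ℝ) • (‖x‖⁻¹ • x))
  rw [one_smul, norm_smul, norm_inv, norm_norm, inv_mul_cancel₀ hx'.ne', mul_one] at h5
  rw [one_smul]
  gcongr

lemma levelRadius_zero_pos (hp : 0 < (volume {x | 0 < v x}).toReal) : 0 < levelRadius v 0 := by
  have := ballVol_pos d
  rw [levelRadius]
  positivity

namespace IsHelmholtz

variable {φ h h' : ℝ → ℝ} (H : IsHelmholtz d φ h h') {k : ℝ} (hk : IsFirstZero h k)

include H hk

theorem energy_ge (hv : LipschitzWith K v) (hv0 : ∀ x, 0 ≤ v x) (hR : ∀ x, R ≤ ‖x‖ → v x = 0)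
    (hp : 0 < (volume {x | 0 < v x}).toReal) :
    volConst d φ h k ((volume {x | 0 < v x}).toReal / ballVol d) / ballVol d * (∫ x, v x) ^ 2 ≤
      (∫ x, ‖gradient v x‖ ^ 2) - ∫ x, v x ^ 2 := by
  have hd : 0 < d := Nat.pos_of_ne_zero H.d_ne_zero
  have hω := ballVol_pos d
  obtain ⟨e1, e2, e3⟩ := rearrangement hd hv hv0 hR
  set W := decProfile v with hW
  set ρ := levelRadius v 0 with hρ
  have hρ0 : 0 < ρ := levelRadius_zero_pos hp
  have hWL : LipschitzWith K W := decProfile_lipschitz hd hv hR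
  have hW0 : ∀ r, ρ ≤ r → W r = 0 := fun r hr => decProfile_eq_zero hd hv hR hr
  have hWz : ∀ x : EuclideanSpace ℝ (Fin d), ρ ≤ ‖x‖ → W ‖x‖ = 0 := fun x hx => hW0 _ hx
  have hder : ∀ r, ρ < r → deriv W r = 0 := by
    intro r hr
    have : W =ᶠ[nhds r] fun _ => 0 := by
      filter_upwards [Ioi_mem_nhds hr] with s hs
      exact hW0 s (le_of_lt hs)
    rw [this.deriv_eq, deriv_const]
  have hrad := H.radial_ineq hk hWL (decProfile_antitoneOn hd hv hR) hρ0 (hW0 ρ le_rfl)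
  have i1 : (∫ x, v x) = d * ballVol d * massFun d W ρ := by
    rw [← e1, integral_comp_norm hd hρ0.le fun r hr => hW0 r hr.le, massFun]
    simp only [mul_comm]
  have i2 : (∫ x : EuclideanSpace ℝ (Fin d), (deriv W ‖x‖ ^ 2 - W ‖x‖ ^ 2)) =
      d * ballVol d * ∫ r in (0)..ρ, (deriv W r ^ 2 - W r ^ 2) * r ^ (d - 1) :=
    integral_comp_norm hd (f := fun r => deriv W r ^ 2 - W r ^ 2) hρ0.le fun r hr => by
      simp [hW0 r hr.le, hder r hr]
  have hae : ∀ᵐ x : EuclideanSpace ℝ (Fin d), deriv W ‖x‖ ^ 2 ≤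
      ‖gradient (fun y : EuclideanSpace ℝ (Fin d) => W ‖y‖) x‖ ^ 2 := by
    have : Nonempty (Fin d) := ⟨⟨0, hd⟩⟩
    have h0 : ∀ᵐ x : EuclideanSpace ℝ (Fin d), x ≠ 0 := by simp [ae_iff]
    filter_upwards [(lipschitz_comp_norm hWL).ae_differentiableAt (μ := volume), h0] with x hx hx0
    exact sq_deriv_le_norm_gradient_sq hx0 hx
  have hgi := integrable_norm_gradient_sq (lipschitz_comp_norm hWL) hWz
  have hdi : Integrable fun x : EuclideanSpace ℝ (Fin d) => deriv W ‖x‖ ^ 2 :=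
    hgi.mono' (((measurable_deriv W).comp measurable_norm).pow_const 2).aestronglyMeasurable (by
      filter_upwards [hae] with x hx
      rwa [Real.norm_eq_abs, abs_of_nonneg (by positivity)])
  have hWi : Integrable fun x : EuclideanSpace ℝ (Fin d) => W ‖x‖ ^ 2 :=
    integrable_of_continuous_of_eq_zero (R := ρ)
      ((lipschitz_comp_norm hWL).continuous.pow 2) fun x hx => by simp [hWz x hx]
  have i3 : (∫ x : EuclideanSpace ℝ (Fin d), deriv W ‖x‖ ^ 2) ≤ ∫ x, ‖gradient v x‖ ^ 2 :=
    (integral_mono_ae hdi hgi hae).trans e3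
  rw [integral_sub hdi hWi, e2] at i2
  have i4 : volConst d φ h k ((volume {x | 0 < v x}).toReal / ballVol d) =
      radConst d φ h k ρ := rfl
  calc volConst d φ h k ((volume {x | 0 < v x}).toReal / ballVol d) / ballVol d * (∫ x, v x) ^ 2
      = d * ballVol d * (d * radConst d φ h k ρ * massFun d W ρ ^ 2) := by
        rw [i4, i1]
        field_simp
    _ ≤ d * ballVol d * ∫ r in (0)..ρ, (deriv W r ^ 2 - W r ^ 2) * r ^ (d - 1) := by gcongr
    _ ≤ _ := by linarith

theorem scaled_energy_ge (hv : LipschitzWith K v) (hv0 : ∀ x, 0 ≤ v x)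
    (hR : ∀ x, R ≤ ‖x‖ → v x = 0) (hp : 0 < (volume {x | 0 < v x}).toReal) {s : ℝ} (hs : 0 < s) :
    s ^ (d + 2) * (volConst d φ h k (s ^ d * ((volume {x | 0 < v x}).toReal / ballVol d)) /
      ballVol d) * (∫ x, v x) ^ 2 ≤
      (∫ x, ‖gradient v x‖ ^ 2) - s ^ 2 * ∫ x, v x ^ 2 := by
  have hs' := hs.ne'
  set w : EuclideanSpace ℝ (Fin d) → ℝ := fun x => v (s⁻¹ • x) with hw
  have hwL : LipschitzWith (K * ‖s⁻¹‖₊) w := hv.comp (lipschitzWith_smul s⁻¹)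
  have hwR : ∀ x, s * R ≤ ‖x‖ → w x = 0 := fun x hx => hR _ (by
    rw [norm_smul, norm_inv, Real.norm_eq_abs, abs_of_pos hs, ← div_eq_inv_mul,
      le_div_iff₀ hs]
    linarith)
  have hvol : (volume {x | 0 < w x}).toReal = s ^ d * (volume {x | 0 < v x}).toReal := by
    have : {x | 0 < w x} = (fun x => s⁻¹ • x) ⁻¹' {x | 0 < v x} := rfl
    rw [this, Measure.addHaar_preimage_smul _ (inv_ne_zero hs'), ENNReal.toReal_mul,
      finrank_euclideanSpace_fin, inv_pow, inv_inv, ENNReal.toReal_ofReal (abs_nonneg _),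
      abs_of_pos (by positivity)]
  have hgrad : ∀ x, ‖gradient w x‖ ^ 2 = (s ^ 2)⁻¹ * ‖gradient v (s⁻¹ • x)‖ ^ 2 := by
    intro x
    rw [norm_gradient_eq, norm_gradient_eq, hw, fderiv_comp_smul, norm_smul, mul_pow, norm_inv,
      Real.norm_eq_abs, inv_pow, sq_abs]
  have j1 : (∫ x, w x) = s ^ d * ∫ x, v x := by
    rw [hw, Measure.integral_comp_inv_smul_of_nonneg _ _ hs.le, finrank_euclideanSpace_fin,
      smul_eq_mul]
  have j2 : (∫ x, w x ^ 2) = s ^ d * ∫ x, v x ^ 2 := by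
    rw [hw, Measure.integral_comp_inv_smul_of_nonneg _ (fun x => v x ^ 2) hs.le,
      finrank_euclideanSpace_fin, smul_eq_mul]
  have j3 : (∫ x, ‖gradient w x‖ ^ 2) = (s ^ 2)⁻¹ * (s ^ d * ∫ x, ‖gradient v x‖ ^ 2) := by
    simp only [hgrad]
    rw [integral_const_mul, Measure.integral_comp_inv_smul_of_nonneg _
      (fun x => ‖gradient v x‖ ^ 2) hs.le, finrank_euclideanSpace_fin, smul_eq_mul]
  have key := H.energy_ge hk hwL (fun x => hv0 _) hwR (by rw [hvol]; positivity)
  rw [hvol, j1, j2, j3, mul_div_assoc] at key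
  have hsd : 0 < s ^ d := by positivity
  have e1 : (s ^ 2)⁻¹ * (s ^ d * ∫ x, ‖gradient v x‖ ^ 2) - s ^ d * ∫ x, v x ^ 2 =
      (s ^ 2)⁻¹ * s ^ d * ((∫ x, ‖gradient v x‖ ^ 2) - s ^ 2 * ∫ x, v x ^ 2) := by
    field_simp
  have e2 : volConst d φ h k (s ^ d * ((volume {x | 0 < v x}).toReal / ballVol d)) / ballVol d *
      (s ^ d * ∫ x, v x) ^ 2 = (s ^ 2)⁻¹ * s ^ d * (s ^ (d + 2) * (volConst d φ h k
        (s ^ d * ((volume {x | 0 < v x}).toReal / ballVol d)) / ballVol d) * (∫ x, v x) ^ 2) := by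
    rw [pow_add]
    field_simp
  rw [e1, e2] at key
  exact le_of_mul_le_mul_left key (by positivity)

end IsHelmholtz

end RadialIntegration

section SignedFunctions

variable {d : ℕ} {u : EuclideanSpace ℝ (Fin d) → ℝ} {K : NNReal} {R : ℝ}

lemma norm_gradient_posPart_add_le (hu : LipschitzWith K u) :
    ∀ x, ‖gradient (fun y => max (u y) 0) x‖ ^ 2 + ‖gradient (fun y => max (-u y) 0) x‖ ^ 2 ≤
      ‖gradient u x‖ ^ 2 := by
  intro x
  simp only [norm_gradient_eq]
  rcases lt_trichotomy (u x) 0 with h | h | h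
  · have e1 : (fun y => max (u y) 0) =ᶠ[nhds x] fun _ => 0 := by
      filter_upwards [(isOpen_lt hu.continuous continuous_const).mem_nhds h] with y hy
      exact max_eq_right (le_of_lt hy)
    have e2 : (fun y => max (-u y) 0) =ᶠ[nhds x] fun y => -u y := by
      filter_upwards [(isOpen_lt hu.continuous continuous_const).mem_nhds h] with y hy
      have : u y < 0 := hy
      exact max_eq_left (by linarith)
    rw [e1.fderiv_eq, e2.fderiv_eq]
    simp
  · have e1 : IsLocalMin (fun y => max (u y) 0) x := by
      refine Eventually.of_forall fun y => ?_
      simp only [h, max_self]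
      exact le_max_right _ _
    have e2 : IsLocalMin (fun y => max (-u y) 0) x := by
      refine Eventually.of_forall fun y => ?_
      simp only [h, neg_zero, max_self]
      exact le_max_right _ _
    rw [e1.fderiv_eq_zero, e2.fderiv_eq_zero]
    simp
  · have e1 : (fun y => max (-u y) 0) =ᶠ[nhds x] fun _ => 0 := by
      filter_upwards [(isOpen_lt continuous_const hu.continuous).mem_nhds h] with y hy
      have : 0 < u y := hy
      exact max_eq_right (by linarith)
    have e2 : (fun y => max (u y) 0) =ᶠ[nhds x] fun y => u y := by
      filter_upwards [(isOpen_lt continuous_const hu.continuous).mem_nhds h] with y hy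
      exact max_eq_left (le_of_lt hy)
    rw [e1.fderiv_eq, e2.fderiv_eq]
    simp

lemma integral_gradient_posPart_add_le (hu : LipschitzWith K u) (hR : ∀ x, R ≤ ‖x‖ → u x = 0) :
    (∫ x, ‖gradient (fun y => max (u y) 0) x‖ ^ 2) +
      (∫ x, ‖gradient (fun y => max (-u y) 0) x‖ ^ 2) ≤ ∫ x, ‖gradient u x‖ ^ 2 := by
  have h1 : Integrable fun x => ‖gradient (fun y => max (u y) 0) x‖ ^ 2 :=
    integrable_norm_gradient_sq (R := R) (hu.max_const 0) fun x hx => by simp [hR x hx]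
  have h2 : Integrable fun x => ‖gradient (fun y => max (-u y) 0) x‖ ^ 2 :=
    integrable_norm_gradient_sq (R := R) (hu.neg.max_const 0) fun x hx => by simp [hR x hx]
  rw [← integral_add h1 h2]
  exact integral_mono (h1.add h2) (integrable_norm_gradient_sq hu hR)
    (norm_gradient_posPart_add_le hu)

lemma integral_sq_posPart_add (hu : Continuous u) (hR : ∀ x, R ≤ ‖x‖ → u x = 0) :
    (∫ x, max (u x) 0 ^ 2) + (∫ x, max (-u x) 0 ^ 2) = ∫ x, u x ^ 2 := by
  rw [← integral_add]
  · congr 1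
    ext x
    rcases le_total (u x) 0 with h | h
    · rw [max_eq_right h, max_eq_left (by linarith)]
      ring
    · rw [max_eq_left h, max_eq_right (by linarith)]
      ring
  · exact integrable_of_continuous_of_eq_zero (R := R) (by fun_prop) fun x hx => by simp [hR x hx]
  · exact integrable_of_continuous_of_eq_zero (R := R) (by fun_prop) fun x hx => by simp [hR x hx]

lemma integral_pos_of_volume_pos {v : EuclideanSpace ℝ (Fin d) → ℝ} (hv : Continuous v)
    (hv0 : ∀ x, 0 ≤ v x) (hR : ∀ x, R ≤ ‖x‖ → v x = 0) :
    0 < (∫ x, v x) ↔ 0 < (volume {x | 0 < v x}).toReal := by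
  rw [integral_pos_iff_support_of_nonneg hv0 (integrable_of_continuous_of_eq_zero hv hR)]
  have : Function.support v = {x | 0 < v x} := by
    ext x
    rw [Function.mem_support, mem_ofPred_eq, (hv0 x).lt_iff_ne']
  rw [this, ENNReal.toReal_pos_iff]
  exact ⟨fun h => ⟨h, volume_level_lt_top hR le_rfl⟩, fun h => h.1⟩

lemma volume_pos_add_volume_neg_le (hu : Continuous u) (hR : ∀ x, R ≤ ‖x‖ → u x = 0)
    {Ω : Set (EuclideanSpace ℝ (Fin d))} (hΩ : ∀ x ∉ Ω, u x = 0) (hΩb : volume Ω ≠ ∞) :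
    (volume {x | 0 < max (u x) 0}).toReal + (volume {x | 0 < max (-u x) 0}).toReal ≤
      (volume Ω).toReal := by
  have h1 : MeasurableSet {x | 0 < max (-u x) 0} :=
    (isOpen_lt continuous_const (by fun_prop)).measurableSet
  rw [← ENNReal.toReal_add (volume_level_lt_top (R := R) (fun x hx => by simp [hR x hx]) le_rfl).ne
    (volume_level_lt_top (R := R) (fun x hx => by simp [hR x hx]) le_rfl).ne,
    ← measure_union _ h1]
  · refine ENNReal.toReal_mono hΩb (measure_mono fun x hx => ?_)
    by_contra hxΩ
    simp [hΩ x hxΩ] at hx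
  · rw [Set.disjoint_left]
    intro x h2 h3
    simp only [mem_ofPred_eq, lt_max_iff, lt_self_iff_false, or_false] at h2 h3
    linarith

namespace IsHelmholtz

variable {φ h h' : ℝ → ℝ} (H : IsHelmholtz d φ h h') {k : ℝ} (hk : IsFirstZero h k)

include H hk

lemma scaled_energy_ge' {v : EuclideanSpace ℝ (Fin d) → ℝ} (hv : LipschitzWith K v)
    (hv0 : ∀ x, 0 ≤ v x) (hR : ∀ x, R ≤ ‖x‖ → v x = 0) {s : ℝ} (hs : 0 < s) :
    s ^ (d + 2) * (volConst d φ h k (s ^ d * ((volume {x | 0 < v x}).toReal / ballVol d)) /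
      ballVol d) * (∫ x, v x) ^ 2 ≤
      (∫ x, ‖gradient v x‖ ^ 2) - s ^ 2 * ∫ x, v x ^ 2 := by
  by_cases hp : 0 < (volume {x | 0 < v x}).toReal
  · exact H.scaled_energy_ge hk hv hv0 hR hp hs
  · have h0 : (∫ x, v x) = 0 := by
      rw [← integral_pos_of_volume_pos hv.continuous hv0 hR] at hp
      exact le_antisymm (not_lt.1 hp) (integral_nonneg hv0)
    have h1 : v =ᵐ[volume] 0 := (integral_eq_zero_iff_of_nonneg hv0
      (integrable_of_continuous_of_eq_zero hv.continuous hR)).1 h0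
    have h2 : (∫ x, v x ^ 2) = 0 := by
      refine integral_eq_zero_of_ae ?_
      filter_upwards [h1] with x hx
      simp [hx]
    rw [h0, h2]
    have : 0 ≤ ∫ x, ‖gradient v x‖ ^ 2 := integral_nonneg fun x => by positivity
    simpa using this

theorem signed_energy (hu : LipschitzWith K u) (hR : ∀ x, R ≤ ‖x‖ → u x = 0) {s : ℝ} (hs : 0 < s)
    (hE : (∫ x, ‖gradient u x‖ ^ 2) ≤ s ^ 2 * ∫ x, u x ^ 2) :
    volConst d φ h k (s ^ d * ((volume {x | 0 < max (u x) 0}).toReal / ballVol d)) *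
        (∫ x, max (u x) 0) ^ 2 +
      volConst d φ h k (s ^ d * ((volume {x | 0 < max (-u x) 0}).toReal / ballVol d)) *
        (∫ x, max (-u x) 0) ^ 2 ≤ 0 := by
  have hω := ballVol_pos d
  have h1 := H.scaled_energy_ge' hk (R := R) (hu.max_const 0) (fun x => le_max_right _ _)
    (fun x hx => by simp [hR x hx]) hs
  have h2 := H.scaled_energy_ge' hk (R := R) (hu.neg.max_const 0) (fun x => le_max_right _ _)
    (fun x hx => by simp [hR x hx]) hs
  simp only [Pi.neg_apply] at h2
  have h3 := integral_gradient_posPart_add_le hu hR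
  have h4 := integral_sq_posPart_add hu.continuous hR
  have h5 : 0 < s ^ (d + 2) / ballVol d := by positivity
  have h6 : s ^ (d + 2) / ballVol d *
      (volConst d φ h k (s ^ d * ((volume {x | 0 < max (u x) 0}).toReal / ballVol d)) *
        (∫ x, max (u x) 0) ^ 2 +
      volConst d φ h k (s ^ d * ((volume {x | 0 < max (-u x) 0}).toReal / ballVol d)) *
        (∫ x, max (-u x) 0) ^ 2) ≤ 0 := by
    rw [← h4] at hE
    calc _ = _ := by ring
      _ ≤ _ := add_le_add h1 h2
      _ ≤ 0 := by linarith
  exact nonpos_of_mul_nonpos_right h6 h5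

end IsHelmholtz

end SignedFunctions

section LowerBounds

variable {d : ℕ} {u : EuclideanSpace ℝ (Fin d) → ℝ} {K : NNReal} {R : ℝ}
  {Ω : Set (EuclideanSpace ℝ (Fin d))}

lemma IsDirTrial.integral_sq_pos (h : IsDirTrial d Ω u) (hR : ∀ x, R ≤ ‖x‖ → u x = 0) :
    0 < ∫ x, u x ^ 2 := by
  obtain ⟨⟨K, hu⟩, -, h0⟩ := h
  have hi : Integrable fun x => u x ^ 2 :=
    integrable_of_continuous_of_eq_zero (R := R) (hu.continuous.pow 2) fun x hx => by simp [hR x hx]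
  refine lt_of_le_of_ne (integral_nonneg fun x => sq_nonneg _) fun h => h0 ?_
  have := (integral_eq_zero_iff_of_nonneg (fun x => sq_nonneg (u x)) hi).1 h.symm
  filter_upwards [this] with x hx
  exact pow_eq_zero_iff (two_ne_zero) |>.1 hx

lemma exists_radius (hΩ : Bornology.IsBounded Ω) (h0 : ∀ x ∉ Ω, u x = 0) :
    ∃ R, ∀ x, R ≤ ‖x‖ → u x = 0 := by
  obtain ⟨R, hR⟩ := hΩ.subset_ball 0
  refine ⟨R, fun x hx => h0 x fun hxΩ => ?_⟩
  have := hR hxΩ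
  rw [mem_ball_zero_iff] at this
  linarith

lemma le_rayleigh (h : IsDirTrial d Ω u) (hΩ : Bornology.IsBounded Ω) {c : ℝ}
    (hc : ∀ s > 0, (∫ x, ‖gradient u x‖ ^ 2) ≤ s ^ 2 * (∫ x, u x ^ 2) → c ≤ s ^ 2) :
    c ≤ rayleigh d u := by
  obtain ⟨R, hR⟩ := exists_radius hΩ h.2.1
  have hN := h.integral_sq_pos hR
  have h0 : 0 ≤ rayleigh d u :=
    div_nonneg (integral_nonneg fun x => by positivity) hN.le
  refine le_of_forall_gt_imp_ge_of_dense fun t ht => ?_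
  have ht0 : 0 < t := h0.trans_lt ht
  rw [← Real.sq_sqrt ht0.le]
  refine hc _ (Real.sqrt_pos.2 ht0) ?_
  rw [Real.sq_sqrt ht0.le, ← div_le_iff₀ hN]
  exact ht.le

lemma integral_posPart_add_pos (h : IsDirTrial d Ω u) (hR : ∀ x, R ≤ ‖x‖ → u x = 0) :
    0 < (∫ x, max (u x) 0) ∨ 0 < ∫ x, max (-u x) 0 := by
  have hN := h.integral_sq_pos hR
  obtain ⟨⟨K, hu⟩, -, h0⟩ := h
  have hc := hu.continuous
  by_contra! hcon
  have i1 := (integral_eq_zero_iff_of_nonneg (μ := volume) (f := fun x => max (u x) 0)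
    (fun x => le_max_right _ _) (integrable_of_continuous_of_eq_zero (R := R) (by fun_prop)
      fun x hx => by simp [hR x hx])).1
    (le_antisymm hcon.1 (integral_nonneg fun x => le_max_right _ _))
  have i2 := (integral_eq_zero_iff_of_nonneg (μ := volume) (f := fun x => max (-u x) 0)
    (fun x => le_max_right _ _) (integrable_of_continuous_of_eq_zero (R := R) (by fun_prop)
      fun x hx => by simp [hR x hx])).1
    (le_antisymm hcon.2 (integral_nonneg fun x => le_max_right _ _))
  refine h0 ?_
  filter_upwards [i1, i2] with x h1 h2
  simp only [Pi.zero_apply, max_eq_right_iff] at h1 h2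
  linarith

lemma integral_mul_weight {v : EuclideanSpace ℝ (Fin d) → ℝ} (hv : Continuous v)
    (hv0 : ∀ x, 0 ≤ v x) (hvR : ∀ x, R ≤ ‖x‖ → v x = 0) {g : EuclideanSpace ℝ (Fin d) → ℝ}
    (hg : Measurable g) {α : ℝ} (hα : 0 < α) (hg1 : ∀ᵐ x, α ≤ g x ∧ g x ≤ 1) :
    Integrable (fun x => v x * g x) ∧
      α * (∫ x, v x) ≤ (∫ x, v x * g x) ∧ (∫ x, v x * g x) ≤ ∫ x, v x := by
  have hi := integrable_of_continuous_of_eq_zero hv hvR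
  have hig : Integrable fun x => v x * g x := by
    refine hi.mono (hv.measurable.mul hg).aestronglyMeasurable ?_
    filter_upwards [hg1] with x hx
    rw [norm_mul]
    refine mul_le_of_le_one_right (norm_nonneg _) ?_
    rw [Real.norm_eq_abs, abs_le]
    exact ⟨by linarith, hx.2⟩
  refine ⟨hig, ?_, ?_⟩
  · rw [← integral_const_mul]
    refine integral_mono_ae (hi.const_mul α) hig ?_
    filter_upwards [hg1] with x hx
    have := hv0 x
    nlinarith
  · refine integral_mono_ae hig hi ?_
    filter_upwards [hg1] with x hx
    exact mul_le_of_le_one_right (hv0 x) hx.2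

lemma posPart_twisted_le (hu : Continuous u) (hR : ∀ x, R ≤ ‖x‖ → u x = 0)
    {g : EuclideanSpace ℝ (Fin d) → ℝ} (hg : Measurable g) {α : ℝ} (hα : 0 < α)
    (hg1 : ∀ᵐ x, α ≤ g x ∧ g x ≤ 1) (h : (∫ x, u x * g x) = 0) :
    α * (∫ x, max (u x) 0) ≤ (∫ x, max (-u x) 0) ∧
      α * (∫ x, max (-u x) 0) ≤ ∫ x, max (u x) 0 := by
  obtain ⟨a1, a2, a3⟩ := integral_mul_weight (R := R) (v := fun x => max (u x) 0) (by fun_prop)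
    (fun x => le_max_right _ _) (fun x hx => by simp [hR x hx]) hg hα hg1
  obtain ⟨b1, b2, b3⟩ := integral_mul_weight (R := R) (v := fun x => max (-u x) 0) (by fun_prop)
    (fun x => le_max_right _ _) (fun x hx => by simp [hR x hx]) hg hα hg1
  have e : (∫ x, max (u x) 0 * g x) - (∫ x, max (-u x) 0 * g x) = 0 := by
    rw [← integral_sub a1 b1]
    refine (integral_congr_ae (ae_of_all _ fun x => ?_)).trans h
    rcases le_total (u x) 0 with h | h
    · rw [max_eq_right h, max_eq_left (by linarith)]
      ring
    · rw [max_eq_left h, max_eq_right (by linarith)]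
      ring
  constructor <;> linarith

namespace IsHelmholtz

variable {φ h h' : ℝ → ℝ} (H : IsHelmholtz d φ h h') {k : ℝ} (hk : IsFirstZero h k)

include H hk

theorem minVol_le_of_twisted {pN p1 : ℝ} {m : ℝ → ℝ}
    (S : IsEnergyConst (volConst d φ h k) m pN p1) (hΩ : Bornology.IsBounded Ω)
    (hu : IsDirTrial d Ω u) {g : EuclideanSpace ℝ (Fin d) → ℝ} (hg : Measurable g) {α : ℝ}
    (hα : 0 < α) (hg1 : ∀ᵐ x, α ≤ g x ∧ g x ≤ 1) (h0 : (∫ x, u x * g x) = 0) {s : ℝ} (hs : 0 < s)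
    (hE : (∫ x, ‖gradient u x‖ ^ 2) ≤ s ^ 2 * ∫ x, u x ^ 2) :
    ballVol d * minVol (volConst d φ h k) m pN (α ^ 2) ≤ s ^ d * (volume Ω).toReal := by
  obtain ⟨R, hR⟩ := exists_radius hΩ hu.2.1
  have hpos := integral_posPart_add_pos hu hR
  obtain ⟨⟨K, huL⟩, hu0, -⟩ := hu
  have hc := huL.continuous
  have hω := ballVol_pos d
  have hS := H.signed_energy hk huL hR hs hE
  obtain ⟨h1, h2⟩ := posPart_twisted_le hc hR hg hα hg1 h0
  have hV := volume_pos_add_volume_neg_le hc hR hu0 hΩ.measure_lt_top.ne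
  have w1 := integral_pos_of_volume_pos (R := R) (v := fun x => max (u x) 0) (by fun_prop)
    (fun x => le_max_right _ _) fun x hx => by simp [hR x hx]
  have w2 := integral_pos_of_volume_pos (R := R) (v := fun x => max (-u x) 0) (by fun_prop)
    (fun x => le_max_right _ _) fun x hx => by simp [hR x hx]
  set I := ∫ x, max (u x) 0
  set J := ∫ x, max (-u x) 0
  have hI : 0 < I := by
    rcases hpos with h | h
    · exact h
    · exact (mul_pos hα h).trans_le h2
  have hJ : 0 < J := (mul_pos hα hI).trans_le h1
  replace w1 := w1.1 hI
  replace w2 := w2.1 hJ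
  set V := (volume {x | 0 < max (u x) 0}).toReal
  set V' := (volume {x | 0 < max (-u x) 0}).toReal
  set P := s ^ d * (V / ballVol d) with hP
  set Q := s ^ d * (V' / ballVol d) with hQ
  set C := volConst d φ h k
  have hP0 : 0 < P := by positivity
  have hQ0 : 0 < Q := by positivity
  have hβ : 0 < α ^ 2 := by positivity
  have s1 : α ^ 2 * I ^ 2 ≤ J ^ 2 := by rw [← mul_pow]; gcongr
  have s2 : α ^ 2 * J ^ 2 ≤ I ^ 2 := by rw [← mul_pow]; gcongr
  have hI2 : 0 < I ^ 2 := by positivity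
  have hJ2 : 0 < J ^ 2 := by positivity
  have hM : minVol C m pN (α ^ 2) ≤ P + Q := by
    rcases lt_or_ge 0 (C P) with hCP | hCP
    · have h3 := mul_le_mul_of_nonneg_left s2 hCP.le
      have h4 : (C Q + α ^ 2 * C P) * J ^ 2 ≤ 0 := by linarith
      rw [add_comm]
      exact S.minVol_le hβ hQ0 hP0 (nonpos_of_mul_nonpos_left h4 hJ2)
    · rcases lt_or_ge 0 (C Q) with hCQ | hCQ
      · have h3 := mul_le_mul_of_nonneg_left s1 hCQ.le
        have h4 : (C P + α ^ 2 * C Q) * I ^ 2 ≤ 0 := by linarith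
        exact S.minVol_le hβ hP0 hQ0 (nonpos_of_mul_nonpos_left h4 hI2)
      · refine S.minVol_le hβ hP0 hQ0 ?_
        have := mul_nonpos_of_nonneg_of_nonpos hβ.le hCQ
        linarith
  have e : ballVol d * (P + Q) = s ^ d * (V + V') := by
    rw [hP, hQ]
    field_simp
  calc ballVol d * minVol C m pN (α ^ 2) ≤ ballVol d * (P + Q) := by gcongr
    _ = s ^ d * (V + V') := e
    _ ≤ s ^ d * (volume Ω).toReal := by gcongr

theorem sq_le_dirichletEV_ball {pN j : ℝ} {m : ℝ → ℝ} (hj : 0 < j)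
    (S : IsEnergyConst (volConst d φ h k) m pN (j ^ d))
    (hu : IsDirTrial d (ball 0 1) u) : j ^ 2 ≤ rayleigh d u := by
  refine le_rayleigh hu isBounded_ball fun s hs hE => ?_
  by_contra! hlt
  have hsj : s < j := lt_of_pow_lt_pow_left₀ 2 hj.le hlt
  obtain ⟨R, hR⟩ := exists_radius isBounded_ball hu.2.1
  have hpos := integral_posPart_add_pos hu hR
  obtain ⟨⟨K, huL⟩, hu0, -⟩ := hu
  have hc := huL.continuous
  have hω := ballVol_pos d
  have hS := H.signed_energy hk huL hR hs hE
  have hV := volume_pos_add_volume_neg_le hc hR hu0 measure_ball_lt_top.ne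
  rw [← ballVol] at hV
  have key : ∀ v : EuclideanSpace ℝ (Fin d) → ℝ, Continuous v → (∀ x, 0 ≤ v x) →
      (∀ x, R ≤ ‖x‖ → v x = 0) → (volume {x | 0 < v x}).toReal ≤ ballVol d →
      0 ≤ volConst d φ h k (s ^ d * ((volume {x | 0 < v x}).toReal / ballVol d)) *
        (∫ x, v x) ^ 2 ∧ (0 < (∫ x, v x) →
      0 < volConst d φ h k (s ^ d * ((volume {x | 0 < v x}).toReal / ballVol d)) *
        (∫ x, v x) ^ 2) := by
    intro v hv hv0 hvR hvV
    have w := integral_pos_of_volume_pos hv hv0 hvR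
    have hmain : 0 < (∫ x, v x) →
      0 < volConst d φ h k (s ^ d * ((volume {x | 0 < v x}).toReal / ballVol d)) *
        (∫ x, v x) ^ 2 := by
      intro hI
      have hp := w.1 hI
      refine mul_pos (S.C_pos (by positivity) ?_) (by positivity)
      calc s ^ d * ((volume {x | 0 < v x}).toReal / ballVol d) ≤ s ^ d * 1 := by
            gcongr
            exact (div_le_one hω).2 hvV
        _ < j ^ d := by
            rw [mul_one]
            exact pow_lt_pow_left₀ hsj hs.le H.d_ne_zero
    refine ⟨?_, hmain⟩
    rcases (integral_nonneg hv0 : 0 ≤ ∫ x, v x).eq_or_lt with h | h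
    · rw [← h]
      simp
    · exact (hmain h).le
  have k1 := key (fun x => max (u x) 0) (by fun_prop) (fun x => le_max_right _ _)
    (fun x hx => by simp [hR x hx]) (by
      have := ENNReal.toReal_nonneg (a := volume {x | 0 < max (-u x) 0})
      linarith)
  have k2 := key (fun x => max (-u x) 0) (by fun_prop) (fun x => le_max_right _ _)
    (fun x hx => by simp [hR x hx]) (by
      have := ENNReal.toReal_nonneg (a := volume {x | 0 < max (u x) 0})
      linarith)
  rcases hpos with h | h
  · have := k1.2 h
    linarith [k2.1]
  · have := k2.2 h
    linarith [k1.1]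

end IsHelmholtz

end LowerBounds

section Nonempty

variable {d : ℕ} {Ω : Set (EuclideanSpace ℝ (Fin d))}

lemma exists_twisted_trial (hd : 0 < d) (hΩ : IsOpen Ω) (hne : Ω.Nonempty)
    {g : EuclideanSpace ℝ (Fin d) → ℝ} (hg : Measurable g) {α : ℝ} (hα : 0 < α)
    (hg1 : ∀ᵐ x, α ≤ g x ∧ g x ≤ 1) :
    ∃ u, IsDirTrial d Ω u ∧ (∫ x, u x * g x) = 0 := by
  have : Nonempty (Fin d) := ⟨⟨0, hd⟩⟩
  obtain ⟨a, ha⟩ := hne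
  obtain ⟨r, hr, hball⟩ := Metric.isOpen_iff.1 hΩ a ha
  set b : ℝ → EuclideanSpace ℝ (Fin d) → ℝ := fun t x => max (t - dist x a) 0 with hb
  have hbL : ∀ t, LipschitzWith (0 + 1) (b t) := fun t =>
    ((LipschitzWith.const t).sub (LipschitzWith.dist_left a)).max_const 0
  have hb0 : ∀ t x, 0 ≤ b t x := fun t x => le_max_right _ _
  have hbz : ∀ t x, t ≤ dist x a → b t x = 0 := fun t x hx => max_eq_right (by linarith)
  have hbR : ∀ t, ∀ x, ‖a‖ + t ≤ ‖x‖ → b t x = 0 := fun t x hx => hbz t x (by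
    have := norm_sub_norm_le x a
    rw [dist_eq_norm]
    linarith)
  obtain ⟨i1, -, -⟩ := integral_mul_weight (hbL r).continuous (hb0 r) (hbR r) hg hα hg1
  obtain ⟨i2, l2, -⟩ := integral_mul_weight (hbL (r / 2)).continuous (hb0 _) (hbR _) hg hα hg1
  have hpos : 0 < ∫ x, b (r / 2) x := by
    refine (hbL (r / 2)).continuous.integral_pos_of_hasCompactSupport_nonneg_nonzero
      (HasCompactSupport.intro (isCompact_closedBall 0 (‖a‖ + r / 2)) fun x hx => hbR _ x ?_)
      (hb0 _) (x := a) ?_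
    · simp only [mem_closedBall, dist_zero_right, not_le] at hx
      exact hx.le
    · simp only [hb, dist_self, sub_zero]
      rw [max_eq_left (by positivity)]
      positivity
  set c₁ := ∫ x, b r x * g x
  set c₂ := ∫ x, b (r / 2) x * g x
  have hc₂ : 0 < c₂ := (mul_pos hα hpos).trans_le l2
  have hL := ((lipschitzWith_smul c₂).comp (hbL r)).sub ((lipschitzWith_smul c₁).comp (hbL (r / 2)))
  refine ⟨fun x => c₂ * b r x - c₁ * b (r / 2) x, ⟨⟨_, hL⟩, fun x hx => ?_, fun h => ?_⟩, ?_⟩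
  · have : r ≤ dist x a := by
      by_contra! hlt
      exact hx (hball hlt)
    beta_reduce
    rw [hbz r x this, hbz (r / 2) x (by linarith)]
    ring
  · have h1 := (Continuous.ae_eq_iff_eq volume hL.continuous continuous_const).1 h
    obtain ⟨y, hy⟩ := exists_norm_eq (EuclideanSpace ℝ (Fin d)) (c := r / 2) (by positivity)
    have h2 := congrFun h1 (a + y)
    have h3 : dist (a + y) a = r / 2 := by simp [hy]
    have h4 : b r (a + y) = r / 2 := by
      simp only [hb, h3]
      rw [max_eq_left (by linarith)]
      ring
    simp only [Function.comp_apply, smul_eq_mul, h4, hbz (r / 2) _ h3.ge] at h2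
    nlinarith
  · have : (fun x => (c₂ * b r x - c₁ * b (r / 2) x) * g x) =
        fun x => c₂ * (b r x * g x) - c₁ * (b (r / 2) x * g x) := by
      ext x
      ring
    rw [this, integral_sub (i1.const_mul _) (i2.const_mul _), integral_const_mul,
      integral_const_mul]
    ring

end Nonempty

section TrialFunctions

variable {d : ℕ}

/-- The radial solution on the ball of center `a` and radius `ρ`, shifted to vanish on the
boundary and extended by zero. -/
def ballTrial (φ : ℝ → ℝ) (a : EuclideanSpace ℝ (Fin d)) (ρ : ℝ) (x : EuclideanSpace ℝ (Fin d)) :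
    ℝ :=
  φ (min ‖x - a‖ ρ) - φ ρ

lemma ballTrial_of_le {φ : ℝ → ℝ} {a x : EuclideanSpace ℝ (Fin d)} {ρ : ℝ} (hx : ρ ≤ ‖x - a‖) :
    ballTrial φ a ρ x = 0 := by
  rw [ballTrial, min_eq_right hx, sub_self]

lemma ballTrial_of_not_mem {φ : ℝ → ℝ} {a x : EuclideanSpace ℝ (Fin d)} {ρ : ℝ}
    (hx : x ∉ ball a ρ) : ballTrial φ a ρ x = 0 :=
  ballTrial_of_le (not_lt.1 fun h => hx (mem_ball_iff_norm.2 h))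

lemma ballTrial_of_norm {φ : ℝ → ℝ} {a x : EuclideanSpace ℝ (Fin d)} {ρ : ℝ}
    (hx : ‖a‖ + ρ ≤ ‖x‖) : ballTrial φ a ρ x = 0 :=
  ballTrial_of_le (by linarith [norm_sub_norm_le x a])

lemma fderiv_ballTrial_of_lt {φ : ℝ → ℝ} {a x : EuclideanSpace ℝ (Fin d)} {ρ : ℝ}
    (hx : ρ < ‖x - a‖) : fderiv ℝ (ballTrial φ a ρ) x = 0 := by
  have : ballTrial φ a ρ =ᶠ[nhds x] fun _ => 0 := by
    filter_upwards [(isOpen_lt continuous_const (by fun_prop : Continuous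
      fun y : EuclideanSpace ℝ (Fin d) => ‖y - a‖)).mem_nhds hx] with y hy
    exact ballTrial_of_le (le_of_lt hy)
  rw [this.fderiv_eq]
  simp

namespace IsHelmholtz

variable {φ h h' : ℝ → ℝ} (H : IsHelmholtz d φ h h')

include H

lemma lipschitzWith_ballTrial (a : EuclideanSpace ℝ (Fin d)) {ρ : ℝ} (hρ : 0 < ρ) :
    ∃ K, LipschitzWith K (ballTrial φ a ρ) := by
  have hh := H.continuous_h
  obtain ⟨M, hM⟩ := (isCompact_Icc (a := (0 : ℝ)) (b := ρ)).exists_bound_of_continuousOn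
    (f := fun r => -(r * h r)) (by fun_prop)
  have h1 : LipschitzOnWith M.toNNReal φ (Icc 0 ρ) := by
    refine (convex_Icc 0 ρ).lipschitzOnWith_of_nnnorm_hasDerivWithin_le
      (fun r _ => (H.hasDerivAt_phi r).hasDerivWithinAt) fun r hr => ?_
    rw [← NNReal.coe_le_coe, coe_nnnorm]
    exact (hM r hr).trans (Real.le_coe_toNNReal M)
  have h2 : LipschitzWith (1 + 0) fun x : EuclideanSpace ℝ (Fin d) => x - a :=
    LipschitzWith.id.sub (LipschitzWith.const a)
  have h3 : LipschitzWith (1 * (1 + 0)) fun x : EuclideanSpace ℝ (Fin d) => min ‖x - a‖ ρ :=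
    (lipschitzWith_one_norm.comp h2).min_const ρ
  have h4 := h1.comp (h3.lipschitzOnWith (s := univ)) fun x _ =>
    ⟨le_min (norm_nonneg _) hρ.le, min_le_right _ _⟩
  rw [lipschitzOnWith_univ] at h4
  exact ⟨_, h4.sub (LipschitzWith.const (φ ρ))⟩

lemma norm_fderiv_ballTrial_le {a x : EuclideanSpace ℝ (Fin d)} {ρ : ℝ} (h0 : x ≠ a)
    (hx : ‖x - a‖ < ρ) : ‖fderiv ℝ (ballTrial φ a ρ) x‖ ≤ |‖x - a‖ * h ‖x - a‖| := by
  have e : ballTrial φ a ρ =ᶠ[nhds x] fun y => φ ‖y - a‖ - φ ρ := by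
    filter_upwards [(isOpen_lt (by fun_prop : Continuous
      fun y : EuclideanSpace ℝ (Fin d) => ‖y - a‖) continuous_const).mem_nhds hx] with y hy
    rw [ballTrial, min_eq_left (le_of_lt hy)]
  have hd : DifferentiableAt ℝ (fun y : EuclideanSpace ℝ (Fin d) => ‖y - a‖) x :=
    ((differentiableAt_id).sub (differentiableAt_const a)).norm ℝ (sub_ne_zero.2 h0)
  have h2 : LipschitzWith (1 * (1 + 0)) fun x : EuclideanSpace ℝ (Fin d) => ‖x - a‖ :=
    lipschitzWith_one_norm.comp (LipschitzWith.id.sub (LipschitzWith.const a))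
  have h3 := norm_fderiv_le_of_lipschitz ℝ h2 (x₀ := x)
  have h4 := ((H.hasDerivAt_phi ‖x - a‖).comp_hasFDerivAt x hd.hasFDerivAt).sub_const (φ ρ)
  rw [e.fderiv_eq]
  erw [h4.fderiv]
  rw [norm_smul, norm_neg, Real.norm_eq_abs]
  refine mul_le_of_le_one_right (abs_nonneg _) (h3.trans ?_)
  simp

lemma integral_flux_sub {ρ : ℝ} :
    (∫ r in (0)..ρ, (φ r - φ ρ) * r ^ (d - 1)) = ρ ^ d * helmE d φ h ρ / d := by
  have hφ := H.continuous_phi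
  have hd := H.d_pos
  have h1 := intervalIntegral.integral_eq_sub_of_hasDerivAt (a := 0) (b := ρ)
    (f := fun r => r ^ d * h r - φ ρ * r ^ d / d) (f' := fun r => (φ r - φ ρ) * r ^ (d - 1))
    (fun r _ => ((H.hasDerivAt_flux r).sub (((hasDerivAt_pow d r).const_mul (φ ρ)).div_const
      (d : ℝ))).congr_deriv (by field_simp)) (Continuous.intervalIntegrable (by fun_prop) _ _)
  rw [h1, helmE, zero_pow H.d_ne_zero]
  field_simp
  ring

lemma integral_radial_energy {ρ : ℝ} :
    (∫ r in (0)..ρ, (r * h r) ^ 2 * r ^ (d - 1)) =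
      (∫ r in (0)..ρ, (φ r - φ ρ) ^ 2 * r ^ (d - 1)) + φ ρ * (ρ ^ d * helmE d φ h ρ / d) := by
  have hφ := H.continuous_phi
  have hh := H.continuous_h
  have h1 := intervalIntegral.integral_eq_sub_of_hasDerivAt (a := 0) (b := ρ)
    (f := fun r => r ^ d * h r * (φ r - φ ρ))
    (f' := fun r => (φ r - φ ρ) ^ 2 * r ^ (d - 1) + φ ρ * ((φ r - φ ρ) * r ^ (d - 1)) -
      (r * h r) ^ 2 * r ^ (d - 1))
    (fun r _ => ((H.hasDerivAt_flux r).mul ((H.hasDerivAt_phi r).sub_const (φ ρ))).congr_deriv (by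
      rw [← H.pow_pred_mul r]
      ring)) (Continuous.intervalIntegrable (by fun_prop) _ _)
  rw [intervalIntegral.integral_sub (Continuous.intervalIntegrable (by fun_prop) _ _)
    (Continuous.intervalIntegrable (by fun_prop) _ _), intervalIntegral.integral_add
    (Continuous.intervalIntegrable (by fun_prop) _ _)
    (Continuous.intervalIntegrable (by fun_prop) _ _), intervalIntegral.integral_const_mul,
    H.integral_flux_sub, zero_pow H.d_ne_zero] at h1
  linarith

lemma integral_ballTrial_pow (a : EuclideanSpace ℝ (Fin d)) {ρ : ℝ} (hρ : 0 < ρ) {n : ℕ}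
    (hn : n ≠ 0) : (∫ x, ballTrial φ a ρ x ^ n) =
      d * ballVol d * ∫ r in (0)..ρ, (φ r - φ ρ) ^ n * r ^ (d - 1) := by
  have e : (fun x : EuclideanSpace ℝ (Fin d) => ballTrial φ a ρ x ^ n) =
      fun x => (φ (min ‖x - a‖ ρ) - φ ρ) ^ n := rfl
  rw [e, integral_sub_right_eq_self
    (fun y : EuclideanSpace ℝ (Fin d) => (φ (min ‖y‖ ρ) - φ ρ) ^ n),
    integral_comp_norm (Nat.pos_of_ne_zero H.d_ne_zero)
    (f := fun r => (φ (min r ρ) - φ ρ) ^ n) hρ.le]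
  · congr 1
    refine intervalIntegral.integral_congr fun r hr => ?_
    rw [uIcc_of_le hρ.le] at hr
    simp only [min_eq_left hr.2]
  · intro r hr
    simp only [min_eq_right hr.le, sub_self, zero_pow hn]

lemma integral_ballTrial (a : EuclideanSpace ℝ (Fin d)) {ρ : ℝ} (hρ : 0 < ρ) :
    (∫ x, ballTrial φ a ρ x) = ballVol d * (ρ ^ d * helmE d φ h ρ) := by
  have h1 := H.integral_ballTrial_pow a hρ one_ne_zero
  have hd := H.d_pos
  simp only [pow_one] at h1
  rw [h1, H.integral_flux_sub]
  field_simp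

lemma integral_gradient_ballTrial_le (a : EuclideanSpace ℝ (Fin d)) {ρ : ℝ} (hρ : 0 < ρ) :
    (∫ x, ‖gradient (ballTrial φ a ρ) x‖ ^ 2) ≤
      (∫ x, ballTrial φ a ρ x ^ 2) + φ ρ * ∫ x, ballTrial φ a ρ x := by
  have hd := H.d_pos
  have hd0 := Nat.pos_of_ne_zero H.d_ne_zero
  have hh := H.continuous_h
  have : Nonempty (Fin d) := ⟨⟨0, hd0⟩⟩
  set f : ℝ → ℝ := fun r => if r ≤ ρ then (r * h r) ^ 2 else 0 with hf
  have hfi : Integrable fun x : EuclideanSpace ℝ (Fin d) => f ‖x - a‖ := by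
    have h1 : (fun x : EuclideanSpace ℝ (Fin d) => f ‖x - a‖) =
        (closedBall a ρ).indicator fun x => (‖x - a‖ * h ‖x - a‖) ^ 2 := by
      ext x
      simp [hf, indicator, dist_eq_norm]
    rw [h1, integrable_indicator_iff isClosed_closedBall.measurableSet]
    exact ContinuousOn.integrableOn_compact (isCompact_closedBall a ρ) (by fun_prop)
  have hle : (∫ x, ‖gradient (ballTrial φ a ρ) x‖ ^ 2) ≤ ∫ x, f ‖x - a‖ := by
    refine integral_mono_of_nonneg (ae_of_all _ fun x => by positivity) hfi ?_
    have n1 : ∀ᵐ x : EuclideanSpace ℝ (Fin d), x ∉ sphere a ρ :=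
      measure_eq_zero_iff_ae_notMem.1 (Measure.addHaar_sphere_of_ne_zero _ a hρ.ne')
    have n2 : ∀ᵐ x : EuclideanSpace ℝ (Fin d), x ≠ a := by simp [ae_iff]
    filter_upwards [n1, n2] with x hx1 hx2
    rw [mem_sphere_iff_norm] at hx1
    rw [norm_gradient_eq]
    rcases lt_or_gt_of_ne hx1 with hlt | hlt
    · simp only [hf, if_pos hlt.le]
      rw [← sq_abs (‖x - a‖ * h ‖x - a‖)]
      exact pow_le_pow_left₀ (norm_nonneg _) (H.norm_fderiv_ballTrial_le hx2 hlt) 2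
    · simp [hf, fderiv_ballTrial_of_lt hlt, not_le.2 hlt]
  refine hle.trans_eq ?_
  rw [integral_sub_right_eq_self (fun x : EuclideanSpace ℝ (Fin d) => f ‖x‖),
    integral_comp_norm hd0 (f := f) hρ.le fun r hr => if_neg (not_le.2 hr),
    H.integral_ballTrial_pow a hρ two_ne_zero, H.integral_ballTrial a hρ]
  have : (∫ r in (0)..ρ, f r * r ^ (d - 1)) = ∫ r in (0)..ρ, (r * h r) ^ 2 * r ^ (d - 1) := by
    refine intervalIntegral.integral_congr fun r hr => ?_
    rw [uIcc_of_le hρ.le] at hr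
    simp only [hf, if_pos hr.2]
  rw [this, H.integral_radial_energy]
  field_simp

end IsHelmholtz

end TrialFunctions

section UpperBounds

variable {d : ℕ}

lemma bddBelow_rayleigh {P : (EuclideanSpace ℝ (Fin d) → ℝ) → Prop} :
    BddBelow {r | ∃ u, P u ∧ rayleigh d u = r} := by
  refine ⟨0, ?_⟩
  rintro _ ⟨u, -, rfl⟩
  exact div_nonneg (integral_nonneg fun x => by positivity) (integral_nonneg fun x => sq_nonneg _)

namespace IsHelmholtz

variable {φ h h' : ℝ → ℝ} (H : IsHelmholtz d φ h h') {k : ℝ} (hk : IsFirstZero h k)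

include H hk

lemma integral_ballTrial_pos (a : EuclideanSpace ℝ (Fin d)) {ρ : ℝ} (hρ : 0 < ρ) (hρk : ρ ≤ k) :
    0 < ∫ x, ballTrial φ a ρ x := by
  have := H.helmE_pos' hk hρ hρk
  have := ballVol_pos d
  rw [H.integral_ballTrial a hρ]
  positivity

lemma div_integral_ballTrial (a : EuclideanSpace ℝ (Fin d)) {ρ : ℝ} (hρ : 0 < ρ) (hρk : ρ ≤ k) :
    φ ρ / (∫ x, ballTrial φ a ρ x) = radConst d φ h k ρ / ballVol d := by
  have := H.helmE_pos' hk hρ hρk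
  have := ballVol_pos d
  rw [H.integral_ballTrial a hρ, radConst_eq_of_le hρk]
  field_simp

theorem dirichletEV_ball_le {j : ℝ} (hj : 0 < j) (hjk : j ≤ k) (hφj : φ j = 0) :
    ∃ u, IsDirTrial d (ball 0 1) u ∧ rayleigh d u ≤ j ^ 2 := by
  obtain ⟨K, hK⟩ := H.lipschitzWith_ballTrial 0 hj
  have hI := H.integral_ballTrial_pos hk 0 hj hjk
  have hE := H.integral_gradient_ballTrial_le 0 hj
  have hL := hK.comp (lipschitzWith_smul j)
  rw [hφj, zero_mul, add_zero] at hE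
  have hT : IsDirTrial d (ball 0 1) fun x => ballTrial φ 0 j (j • x) := by
    refine ⟨⟨_, hL⟩, fun x hx => ballTrial_of_le ?_, fun h0 => ?_⟩
    · rw [mem_ball_zero_iff, not_lt] at hx
      rw [sub_zero, norm_smul, Real.norm_eq_abs, abs_of_pos hj]
      exact le_mul_of_one_le_right hj.le hx
    · have h1 := (Continuous.ae_eq_iff_eq volume hL.continuous continuous_const).1 h0
      have h2 : ballTrial φ (0 : EuclideanSpace ℝ (Fin d)) j = 0 := by
        ext x
        have := congrFun h1 (j⁻¹ • x)
        simpa [smul_smul, hj.ne'] using this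
      rw [h2] at hI
      simp at hI
  refine ⟨_, hT, ?_⟩
  obtain ⟨R, hR⟩ := exists_radius isBounded_ball hT.2.1
  rw [rayleigh, div_le_iff₀ (hT.integral_sq_pos hR)]
  have e1 : ∀ x, ‖gradient (fun x => ballTrial φ (0 : EuclideanSpace ℝ (Fin d)) j (j • x)) x‖ ^ 2 =
      j ^ 2 * ‖gradient (ballTrial φ 0 j) (j • x)‖ ^ 2 := by
    intro x
    rw [norm_gradient_eq, norm_gradient_eq, fderiv_comp_smul, norm_smul, mul_pow,
      Real.norm_eq_abs, sq_abs]
  simp only [e1]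
  rw [integral_const_mul,
    Measure.integral_comp_smul volume (fun x => ‖gradient (ballTrial φ 0 j) x‖ ^ 2) j,
    Measure.integral_comp_smul volume (fun x => ballTrial φ 0 j x ^ 2) j]
  simp only [smul_eq_mul]
  gcongr

theorem exists_two_balls {α p q : ℝ} (hα : 0 < α) (hp : 0 < p) (hpk : p ≤ k ^ d) (hq : 0 < q)
    (hqk : q ≤ k ^ d)
    (hC : volConst d φ h k p + α ^ 2 * volConst d φ h k q ≤ 0) (hα1 : α ≤ 1) :
    ∃ (Ω : Set (EuclideanSpace ℝ (Fin d))) (g u : EuclideanSpace ℝ (Fin d) → ℝ),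
      IsOpen Ω ∧ Bornology.IsBounded Ω ∧ Ω.Nonempty ∧ Measurable g ∧
      (∀ᵐ x, α ≤ g x ∧ g x ≤ 1) ∧ (volume Ω).toReal = ballVol d * (p + q) ∧
      IsDirTrial d Ω u ∧ (∫ x, u x * g x) = 0 ∧ rayleigh d u ≤ 1 := by
  have hd0 := H.d_ne_zero
  have hω := ballVol_pos d
  have : Nonempty (Fin d) := ⟨⟨0, Nat.pos_of_ne_zero hd0⟩⟩
  set r := p ^ (1 / (d : ℝ)) with hr
  set s := q ^ (1 / (d : ℝ)) with hs
  have hr0 : 0 < r := Real.rpow_pos_of_pos hp _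
  have hs0 : 0 < s := Real.rpow_pos_of_pos hq _
  have hrp : r ^ d = p := rpow_one_div_pow hd0 hp.le
  have hsq : s ^ d = q := rpow_one_div_pow hd0 hq.le
  have hrk : r ≤ k := le_of_pow_le_pow_left₀ hd0 hk.pos.le (hrp.trans_le hpk)
  have hsk : s ≤ k := le_of_pow_le_pow_left₀ hd0 hk.pos.le (hsq.trans_le hqk)
  obtain ⟨b, hb⟩ := exists_norm_eq (EuclideanSpace ℝ (Fin d)) (c := r + s + 1) (by positivity)
  have hdisj : ∀ x : EuclideanSpace ℝ (Fin d), ‖x‖ ≤ r → s < ‖x - b‖ := by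
    intro x hx
    have := norm_sub_norm_le b x
    rw [norm_sub_rev] at this
    linarith
  set v := ballTrial φ (0 : EuclideanSpace ℝ (Fin d)) r with hv
  set w := ballTrial φ b s with hw
  have hv0 : ∀ x, r ≤ ‖x‖ → v x = 0 := fun x hx => ballTrial_of_le (by simpa using hx)
  have hw0 : ∀ x, ‖x‖ ≤ r → w x = 0 := fun x hx => ballTrial_of_le (hdisj x hx).le
  have hvw : ∀ x, v x * w x = 0 := by
    intro x
    rcases le_total r ‖x‖ with h | h
    · rw [hv0 x h, zero_mul]
    · rw [hw0 x h, mul_zero]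
  have hvR : ∀ x, ‖(0 : EuclideanSpace ℝ (Fin d))‖ + r ≤ ‖x‖ → v x = 0 := fun x => ballTrial_of_norm
  have hwR : ∀ x, ‖b‖ + s ≤ ‖x‖ → w x = 0 := fun x => ballTrial_of_norm
  obtain ⟨K₁, hv_lip⟩ := H.lipschitzWith_ballTrial (0 : EuclideanSpace ℝ (Fin d)) hr0
  obtain ⟨K₂, hw_lip⟩ := H.lipschitzWith_ballTrial b hs0
  rw [← hv] at hv_lip
  rw [← hw] at hw_lip
  have hIv := H.integral_ballTrial_pos hk (0 : EuclideanSpace ℝ (Fin d)) hr0 hrk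
  have hIw := H.integral_ballTrial_pos hk b hs0 hsk
  have hDv := H.div_integral_ballTrial hk (0 : EuclideanSpace ℝ (Fin d)) hr0 hrk
  have hDw := H.div_integral_ballTrial hk b hs0 hsk
  have hEv := H.integral_gradient_ballTrial_le (0 : EuclideanSpace ℝ (Fin d)) hr0
  have hEw := H.integral_gradient_ballTrial_le b hs0
  rw [← hv] at hIv hDv hEv
  rw [← hw] at hIw hDw hEw
  set I := ∫ x, v x
  set J := ∫ x, w x
  have iv : Integrable v := integrable_of_continuous_of_eq_zero hv_lip.continuous hvR
  have iw : Integrable w := integrable_of_continuous_of_eq_zero hw_lip.continuous hwR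
  have iv2 : Integrable fun x => v x ^ 2 :=
    integrable_of_continuous_of_eq_zero (R := ‖(0 : EuclideanSpace ℝ (Fin d))‖ + r)
      (hv_lip.continuous.pow 2) fun x hx => by simp [hvR x hx]
  have iw2 : Integrable fun x => w x ^ 2 :=
    integrable_of_continuous_of_eq_zero (R := ‖b‖ + s)
      (hw_lip.continuous.pow 2) fun x hx => by simp [hwR x hx]
  have ivg := integrable_norm_gradient_sq hv_lip hvR
  have iwg := integrable_norm_gradient_sq hw_lip hwR
  set Ω : Set (EuclideanSpace ℝ (Fin d)) := ball 0 r ∪ ball b s with hΩ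
  have hbdd : Bornology.IsBounded Ω := isBounded_ball.union isBounded_ball
  have hL : LipschitzWith (‖1 / I‖₊ * K₁ + ‖α / J‖₊ * K₂) fun x => 1 / I * v x - α / J * w x :=
    ((lipschitzWith_smul (1 / I)).comp hv_lip).sub ((lipschitzWith_smul (α / J)).comp hw_lip)
  have hT : IsDirTrial d Ω fun x => 1 / I * v x - α / J * w x := by
    refine ⟨⟨_, hL⟩, fun x hx => ?_, fun h0 => ?_⟩
    · beta_reduce
      rw [hv, hw, ballTrial_of_not_mem fun h => hx (Or.inl h),
        ballTrial_of_not_mem fun h => hx (Or.inr h)]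
      ring
    · have h1 := (Continuous.ae_eq_iff_eq volume hL.continuous continuous_const).1 h0
      have h2 : v = 0 := by
        ext x
        rcases le_total r ‖x‖ with h | h
        · exact hv0 x h
        · have h3 := congrFun h1 x
          simp only [hw0 x h, mul_zero, sub_zero] at h3
          exact (mul_eq_zero.1 h3).resolve_left (by positivity)
      have : I = 0 := by simp [I, h2]
      exact hIv.ne' this
  refine ⟨Ω, fun x => if ‖x‖ < r then α else 1, _, isOpen_ball.union isOpen_ball, hbdd,
    ⟨0, Or.inl (mem_ball_self hr0)⟩,
    Measurable.ite (measurableSet_lt measurable_norm measurable_const) measurable_const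
      measurable_const, ae_of_all _ fun x => ?_, ?_, hT, ?_, ?_⟩
  · beta_reduce
    split_ifs
    · exact ⟨le_rfl, hα1⟩
    · exact ⟨hα1, le_rfl⟩
  · have hd : Disjoint (ball (0 : EuclideanSpace ℝ (Fin d)) r) (ball b s) := by
      rw [Set.disjoint_left]
      intro x hx hx'
      rw [mem_ball_zero_iff] at hx
      rw [mem_ball_iff_norm] at hx'
      exact (hdisj x hx.le).not_gt hx'
    rw [hΩ, measure_union hd measurableSet_ball, volume_ball_eq (Nat.pos_of_ne_zero hd0) hr0.le,
      volume_ball_eq (Nat.pos_of_ne_zero hd0) hs0.le, hrp, hsq,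
      ← ENNReal.ofReal_add (by positivity) (by positivity), ENNReal.toReal_ofReal (by positivity)]
    ring
  · have e : (fun x => (1 / I * v x - α / J * w x) * (if ‖x‖ < r then α else 1)) =
        fun x => α / I * v x - α / J * w x := by
      ext x
      split_ifs with h
      · rw [hw0 x h.le]
        ring
      · rw [hv0 x (not_lt.1 h)]
        ring
    rw [e, integral_sub (iv.const_mul _) (iw.const_mul _), integral_const_mul, integral_const_mul,
      div_mul_cancel₀ _ hIv.ne', div_mul_cancel₀ _ hIw.ne', sub_self]
  · obtain ⟨R, hR⟩ := exists_radius hbdd hT.2.1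
    rw [rayleigh, div_le_one (hT.integral_sq_pos hR)]
    have e2 : (∫ x, (1 / I * v x - α / J * w x) ^ 2) =
        (1 / I) ^ 2 * (∫ x, v x ^ 2) + (α / J) ^ 2 * ∫ x, w x ^ 2 := by
      rw [← integral_const_mul, ← integral_const_mul,
        ← integral_add (iv2.const_mul _) (iw2.const_mul _)]
      refine integral_congr_ae (ae_of_all _ fun x => ?_)
      linear_combination (-2 * (1 / I) * (α / J)) * hvw x
    have e1 : (∫ x, ‖gradient (fun x => 1 / I * v x - α / J * w x) x‖ ^ 2) =
        (1 / I) ^ 2 * (∫ x, ‖gradient v x‖ ^ 2) + (α / J) ^ 2 * ∫ x, ‖gradient w x‖ ^ 2 := by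
      rw [← integral_const_mul, ← integral_const_mul,
        ← integral_add (ivg.const_mul _) (iwg.const_mul _)]
      refine integral_congr_ae ?_
      filter_upwards [hv_lip.ae_differentiableAt (μ := volume),
        hw_lip.ae_differentiableAt (μ := volume)] with x hx1 hx2
      have h1 := (hx1.hasFDerivAt.const_mul (1 / I)).sub (hx2.hasFDerivAt.const_mul (α / J))
      simp only [norm_gradient_eq]
      erw [h1.fderiv]
      rcases le_or_gt ‖x‖ r with h | h
      · have : fderiv ℝ w x = 0 := fderiv_ballTrial_of_lt (hdisj x h)
        rw [this, smul_zero, sub_zero, norm_smul, mul_pow, Real.norm_eq_abs, sq_abs, norm_zero]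
        ring
      · have : fderiv ℝ v x = 0 := fderiv_ballTrial_of_lt (by simpa using h)
        rw [this, smul_zero, zero_sub, norm_neg, norm_smul, mul_pow, Real.norm_eq_abs, sq_abs,
          norm_zero]
        ring
    rw [e1, e2]
    have k1 : (1 / I) ^ 2 * (φ r * I) = radConst d φ h k r / ballVol d := by
      rw [← hDv]
      field_simp
    have k2 : (α / J) ^ 2 * (φ s * J) = α ^ 2 * (radConst d φ h k s / ballVol d) := by
      rw [← hDw]
      field_simp
    have k3 : radConst d φ h k r / ballVol d + α ^ 2 * (radConst d φ h k s / ballVol d) ≤ 0 := by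
      rw [← mul_div_assoc, ← add_div]
      exact div_nonpos_of_nonpos_of_nonneg hC hω.le
    have m1 := mul_le_mul_of_nonneg_left hEv (sq_nonneg (1 / I))
    have m2 := mul_le_mul_of_nonneg_left hEw (sq_nonneg (α / J))
    rw [mul_add] at m1 m2
    linarith

end IsHelmholtz

end UpperBounds

section Assembly

variable {d : ℕ}

lemma pow_rpow_two_div (hd : d ≠ 0) {s : ℝ} (hs : 0 ≤ s) : (s ^ d) ^ ((2 : ℝ) / d) = s ^ 2 := by
  have : (d : ℝ) ≠ 0 := by exact_mod_cast hd
  rw [← Real.rpow_natCast, ← Real.rpow_mul hs, mul_div_cancel₀ _ this]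
  exact_mod_cast Real.rpow_natCast s 2

lemma IsEnergyConst.minVol_pos {C m : ℝ → ℝ} {pN p1 : ℝ} (S : IsEnergyConst C m pN p1) {β : ℝ}
    (hβ : 0 < β) (hβ1 : β ≤ 1) : 0 < minVol C m pN β := by
  rcases hβ1.eq_or_lt with rfl | h
  · rw [S.minVol_one]
    linarith [S.p1_pos]
  · exact S.p1_pos.trans_le (S.p1_le_minVol hβ h)

namespace IsHelmholtz

variable {φ h h' : ℝ → ℝ} (H : IsHelmholtz d φ h h') {k : ℝ} (hk : IsFirstZero h k)

include H hk

theorem le_scaled_twistedEV {pN p1 : ℝ} {m : ℝ → ℝ}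
    (S : IsEnergyConst (volConst d φ h k) m pN p1) {Ω : Set (EuclideanSpace ℝ (Fin d))}
    (hΩ : IsOpen Ω) (hb : Bornology.IsBounded Ω) (hne : Ω.Nonempty)
    {g : EuclideanSpace ℝ (Fin d) → ℝ} (hg : Measurable g) {α : ℝ} (hα : 0 < α) (hα1 : α ≤ 1)
    (hg1 : ∀ᵐ x, α ≤ g x ∧ g x ≤ 1) :
    (ballVol d * minVol (volConst d φ h k) m pN (α ^ 2)) ^ ((2 : ℝ) / d) ≤
      (volume Ω).toReal ^ ((2 : ℝ) / d) * twistedEV d Ω g := by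
  have hd0 := H.d_ne_zero
  have hω := ballVol_pos d
  have hM := S.minVol_pos (pow_pos hα 2) (pow_le_one₀ hα.le hα1)
  have hV : 0 < (volume Ω).toReal :=
    ENNReal.toReal_pos (hΩ.measure_pos volume hne).ne' hb.measure_lt_top.ne
  have hV2 := Real.rpow_pos_of_pos hV ((2 : ℝ) / d)
  rw [← div_le_iff₀' hV2]
  obtain ⟨u₀, hu₀, h₀⟩ := exists_twisted_trial (Nat.pos_of_ne_zero hd0) hΩ hne hg hα hg1
  refine le_csInf ⟨_, u₀, hu₀, h₀, rfl⟩ ?_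
  rintro _ ⟨u, hu, h0, rfl⟩
  refine le_rayleigh hu hb fun s hs hE => ?_
  rw [div_le_iff₀ hV2, ← pow_rpow_two_div hd0 hs.le, ← Real.mul_rpow (by positivity) hV.le]
  exact Real.rpow_le_rpow (by positivity)
    (H.minVol_le_of_twisted hk S hb hu hg hα hg1 h0 hs hE) (by positivity)

theorem scaled_twistedEV_eq {p1 : ℝ} {m : ℝ → ℝ}
    (S : IsEnergyConst (volConst d φ h k) m (k ^ d) p1) {α : ℝ} (hα : 0 < α) (hα1 : α ≤ 1) :
    sInf { r : ℝ |
      ∃ (Ω : Set (EuclideanSpace ℝ (Fin d))) (g : EuclideanSpace ℝ (Fin d) → ℝ),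
        IsOpen Ω ∧ Bornology.IsBounded Ω ∧ Ω.Nonempty ∧ Measurable g ∧
        (∀ᵐ x, α ≤ g x ∧ g x ≤ 1) ∧
        r = (volume Ω).toReal ^ ((2 : ℝ) / d) * twistedEV d Ω g } =
      (ballVol d * minVol (volConst d φ h k) m (k ^ d) (α ^ 2)) ^ ((2 : ℝ) / d) := by
  obtain ⟨p, q, hp, hpk, hq, hqk, hC, hpq⟩ := S.exists_minVol (pow_pos hα 2)
  obtain ⟨Ω, g, u, hΩ, hb, hne, hg, hg1, hV, hu, h0, hray⟩ :=
    H.exists_two_balls hk hα hp hpk.le hq hqk.le hC.le hα1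
  refine le_antisymm ?_ (le_csInf ⟨_, Ω, g, hΩ, hb, hne, hg, hg1, rfl⟩ ?_)
  · refine le_trans (csInf_le ?_ ⟨Ω, g, hΩ, hb, hne, hg, hg1, rfl⟩) ?_
    · refine ⟨(ballVol d * minVol (volConst d φ h k) m (k ^ d) (α ^ 2)) ^ ((2 : ℝ) / d), ?_⟩
      rintro _ ⟨Ω, g, hΩ, hb, hne, hg, hg1, rfl⟩
      exact H.le_scaled_twistedEV hk S hΩ hb hne hg hα hα1 hg1
    · rw [hV, hpq]
      refine mul_le_of_le_one_right (Real.rpow_nonneg ?_ _) ?_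
      · rw [← hpq, ← hV]
        exact ENNReal.toReal_nonneg
      · refine le_trans (csInf_le ?_ ⟨u, hu, h0, rfl⟩) hray
        have := bddBelow_rayleigh (P := fun u => IsDirTrial d Ω u ∧ (∫ x, u x * g x) = 0)
        simpa only [and_assoc] using this
  · rintro _ ⟨Ω, g, hΩ, hb, hne, hg, hg1, rfl⟩
    exact H.le_scaled_twistedEV hk S hΩ hb hne hg hα hα1 hg1

theorem dirichletEV_ball_eq {pN j : ℝ} {m : ℝ → ℝ} (hj : 0 < j) (hjk : j ≤ k) (hφj : φ j = 0)
    (S : IsEnergyConst (volConst d φ h k) m pN (j ^ d)) : dirichletEV d (ball 0 1) = j ^ 2 := by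
  obtain ⟨u, hu, hray⟩ := H.dirichletEV_ball_le hk hj hjk hφj
  refine le_antisymm ((csInf_le bddBelow_rayleigh ⟨u, hu, rfl⟩).trans hray)
    (le_csInf ⟨_, u, hu, rfl⟩ ?_)
  rintro _ ⟨u, hu, rfl⟩
  exact H.sq_le_dirichletEV_ball hk hj S hu

end IsHelmholtz

end Assembly

/-- the minimal scaled twisted eigenvalue `λ⋆(α)`, as a function of `α`, is
strictly increasing on `(0,1]`, continuously differentiable on `(0,1)`, tends to
`|B|^{2/d}λ₁(B)` as `α → 0⁺`, is left-continuous at `1`, and `λ⋆(1) = 2^{2/d}|B|^{2/d}λ₁(B)`. -/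
theorem stmt16 (d : ℕ) (hd : 2 ≤ d) (lamStar : ℝ → ℝ)
    (hdef : ∀ α : ℝ, lamStar α = sInf { r : ℝ |
      ∃ (Ω : Set (EuclideanSpace ℝ (Fin d))) (g : EuclideanSpace ℝ (Fin d) → ℝ),
        IsOpen Ω ∧ Bornology.IsBounded Ω ∧ Ω.Nonempty ∧ Measurable g ∧
        (∀ᵐ x, α ≤ g x ∧ g x ≤ 1) ∧
        r = (volume Ω).toReal ^ ((2 : ℝ) / d) * twistedEV d Ω g }) :
    StrictMonoOn lamStar (Set.Ioc 0 1) ∧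
    (∃ lamStar' : ℝ → ℝ, ContinuousOn lamStar' (Set.Ioo 0 1) ∧
      ∀ α ∈ Set.Ioo (0 : ℝ) 1, HasDerivAt lamStar (lamStar' α) α) ∧
    Tendsto lamStar (nhdsWithin 0 (Set.Ioi 0))
      (nhds ((volume (ball (0 : EuclideanSpace ℝ (Fin d)) 1)).toReal ^ ((2 : ℝ) / d) *
        dirichletEV d (ball (0 : EuclideanSpace ℝ (Fin d)) 1))) ∧
    Tendsto lamStar (nhdsWithin 1 (Set.Iio 1)) (nhds (lamStar 1)) ∧
    lamStar 1 = (2 : ℝ) ^ ((2 : ℝ) / d) *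
      ((volume (ball (0 : EuclideanSpace ℝ (Fin d)) 1)).toReal ^ ((2 : ℝ) / d) *
        dirichletEV d (ball (0 : EuclideanSpace ℝ (Fin d)) 1)) := by
  obtain ⟨φ, h, h', e1, e2, e3, e4⟩ := exists_helmholtz hd
  have H : IsHelmholtz d φ h h' := ⟨hd, e1, e2, e3, e4⟩
  obtain ⟨k, hk0, hhk, hkpos⟩ := H.exists_first_zero
  have hk : IsFirstZero h k := ⟨hk0, hhk, hkpos⟩
  obtain ⟨_, S, j, hj, hjk, hφj, rfl⟩ := H.isEnergyConst hk
  have hω := ballVol_pos d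
  have hd0 := H.d_ne_zero
  have hdpos := H.d_pos
  have hexp : 0 < (2 : ℝ) / d := by positivity
  rw [H.dirichletEV_ball_eq hk hj hjk.le hφj S, ← ballVol, ← pow_rpow_two_div hd0 hj.le,
    ← Real.mul_rpow hω.le (by positivity)]
  set M := minVol (volConst d φ h k) (volSlope d φ h) (k ^ d) with hM
  have hval : ∀ α, 0 < α → α ≤ 1 → lamStar α = (ballVol d * M (α ^ 2)) ^ ((2 : ℝ) / d) :=
    fun α h0 h1 => (hdef α).trans (H.scaled_twistedEV_eq hk S h0 h1)
  have hMpos : ∀ α : ℝ, 0 < α → α ≤ 1 → 0 < M (α ^ 2) := fun α h0 h1 =>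
    S.minVol_pos (pow_pos h0 2) (pow_le_one₀ h0.le h1)
  have hval1 : lamStar 1 = (ballVol d * (2 * j ^ d)) ^ ((2 : ℝ) / d) := by
    rw [hval 1 one_pos le_rfl, one_pow, hM, S.minVol_one]
  set D : ℝ → ℝ := fun β => dualMult (volConst d φ h k) (volSlope d φ h) (k ^ d) β *
    volConst d φ h k (dualArg (volSlope d φ h) (k ^ d)
      (β * dualMult (volConst d φ h k) (volSlope d φ h) (k ^ d) β)) with hD
  have hMder : ∀ α : ℝ, 0 < α → HasDerivAt (fun α : ℝ => ballVol d * M (α ^ 2))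
      (ballVol d * (D (α ^ 2) * (2 * α))) α := by
    intro α h0
    have h1 : HasDerivAt M (D (α ^ 2)) (α ^ 2) := S.hasDerivAt_minVol (pow_pos h0 2)
    have h2 : HasDerivAt (fun α : ℝ => α ^ 2) (2 * α) α := by simpa using hasDerivAt_pow 2 α
    exact (HasDerivAt.comp (h₂ := M) (h := fun α : ℝ => α ^ 2) α h1 h2).const_mul (ballVol d)
  have hMcont : ∀ α : ℝ, 0 < α → ContinuousAt (fun α : ℝ => ballVol d * M (α ^ 2)) α :=
    fun α h0 => (hMder α h0).continuousAt
  refine ⟨fun α hα β hβ hαβ => ?_, ⟨fun α => ballVol d * (D (α ^ 2) * (2 * α)) * ((2 : ℝ) / d) *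
    (ballVol d * M (α ^ 2)) ^ ((2 : ℝ) / d - 1), fun α hα => ?_, fun α hα => ?_⟩, ?_, ?_, ?_⟩
  · rw [hval α hα.1 hα.2, hval β hβ.1 hβ.2]
    have h1 := hMpos α hα.1 hα.2
    refine Real.rpow_lt_rpow (by positivity) (mul_lt_mul_of_pos_left ?_ hω) hexp
    exact S.minVol_strictMonoOn ⟨pow_pos hα.1 2, pow_le_one₀ hα.1.le hα.2⟩
      ⟨pow_pos hβ.1 2, pow_le_one₀ hβ.1.le hβ.2⟩ (pow_lt_pow_left₀ hαβ hα.1.le two_ne_zero)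
  · have h1 := hMpos α hα.1 hα.2.le
    have h2 : ContinuousAt (fun α : ℝ => D (α ^ 2)) α :=
      ContinuousAt.comp (g := D) (S.continuousAt_deriv_minVol (pow_pos hα.1 2))
        (continuous_pow 2).continuousAt
    refine ContinuousAt.continuousWithinAt (ContinuousAt.mul ?_ ?_)
    · exact (continuousAt_const.mul (h2.mul (continuousAt_const.mul continuousAt_id))).mul
        continuousAt_const
    · exact (hMcont α hα.1).rpow_const (Or.inl (by positivity))
  · have h1 := hMpos α hα.1 hα.2.le
    refine ((hMder α hα.1).rpow_const (Or.inl (by positivity))).congr_of_eventuallyEq ?_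
    filter_upwards [Ioo_mem_nhds hα.1 hα.2] with β hβ
    exact hval β hβ.1 hβ.2.le
  · have h1 : Tendsto (fun α : ℝ => α ^ 2) (nhdsWithin 0 (Ioi 0)) (nhdsWithin 0 (Ioi 0)) := by
      refine tendsto_nhdsWithin_iff.2 ⟨?_, ?_⟩
      · have := ((continuous_pow (M := ℝ) 2).tendsto 0).mono_left
          (nhdsWithin_le_nhds (s := Ioi (0 : ℝ)))
        simpa using this
      · filter_upwards [self_mem_nhdsWithin] with α hα
        exact pow_pos (mem_Ioi.1 hα) 2
    have h2 := ((S.tendsto_minVol_zero.comp h1).const_mul (ballVol d)).rpow_const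
      (p := (2 : ℝ) / d) (Or.inr hexp.le)
    refine h2.congr' ?_
    filter_upwards [Ioo_mem_nhdsGT (zero_lt_one (α := ℝ))] with α hα
    exact (hval α hα.1 hα.2.le).symm
  · have h1 := hMpos 1 one_pos le_rfl
    have h2 : Tendsto (fun α : ℝ => (ballVol d * M (α ^ 2)) ^ ((2 : ℝ) / d))
        (nhdsWithin 1 (Iio 1)) (nhds ((ballVol d * M (1 ^ 2)) ^ ((2 : ℝ) / d))) :=
      ((hMcont 1 one_pos).rpow_const (Or.inr hexp.le)).tendsto.mono_left nhdsWithin_le_nhds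
    rw [hval 1 one_pos le_rfl]
    refine h2.congr' ?_
    filter_upwards [Ioo_mem_nhdsLT (zero_lt_one (α := ℝ))] with α hα
    exact (hval α hα.1 hα.2.le).symm
  · rw [hval1, ← Real.mul_rpow (by positivity) (by positivity)]
    congr 1
    ring
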